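/- For every s ∈ I and every f ∈ C_b(ℝ^d), the Cauchy problem D_t u = Tr(Q D²_x u) + ⟨b, ∇_x u⟩ + c u on (s,+∞)×ℝ^d with u(s,·) = f admits a classical solution u; moreover this solution satisfies sup_{x∈ℝ^d} |u(t,x)| ≤ e^{c₀(t−s)}·sup_{ℝ^d}|f| for every t > s, so in particular it is bounded on strips. -/

import Mathlib

open Set Filter MeasureTheory

noncomputable section

abbrev Euc (d : ℕ) := EuclideanSpace ℝ (Fin d)

noncomputable def hess (d : ℕ) (g : Euc d → ℝ) (x : Euc d) (i j : Fin d) : ℝ :=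
  fderiv ℝ (fun y => fderiv ℝ g y (EuclideanSpace.single j 1)) x (EuclideanSpace.single i 1)

noncomputable def minEig (d : ℕ) (A : Fin d → Fin d → ℝ) : ℝ :=
  sInf {r : ℝ | ∃ ξ : Euc d, ‖ξ‖ = 1 ∧ (∑ i, ∑ j, A i j * ξ i * ξ j) = r}

noncomputable def pdist (d : ℕ) (p q : ℝ × Euc d) : ℝ :=
  Real.sqrt |p.1 - q.1| + ‖p.2 - q.2‖

def LocHolderParab (d : ℕ) (α : ℝ) (I : Set ℝ) (g : ℝ → Euc d → ℝ) : Prop :=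
  ∀ K : Set (ℝ × Euc d), IsCompact K → K ⊆ I ×ˢ (univ : Set (Euc d)) →
    ∃ C > 0, ∀ p ∈ K, ∀ q ∈ K, |g p.1 p.2 - g q.1 q.2| ≤ C * pdist d p q ^ α

noncomputable def Aop (d : ℕ) (Q : ℝ → Euc d → Fin d → Fin d → ℝ)
    (b : ℝ → Euc d → Fin d → ℝ) (c : ℝ → Euc d → ℝ)
    (t : ℝ) (g : Euc d → ℝ) (x : Euc d) : ℝ :=
  (∑ i, ∑ j, Q t x i j * hess d g x i j)
    + (∑ i, b t x i * fderiv ℝ g x (EuclideanSpace.single i 1))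
    + c t x * g x

structure IsClassicalSolution (d : ℕ) (Q : ℝ → Euc d → Fin d → Fin d → ℝ)
    (b : ℝ → Euc d → Fin d → ℝ) (c : ℝ → Euc d → ℝ)
    (s : ℝ) (f : Euc d → ℝ) (u : ℝ → Euc d → ℝ) : Prop where
  cont : ContinuousOn (fun p : ℝ × Euc d => u p.1 p.2) (Ici s ×ˢ univ)
  tdiff : ∀ t, s < t → ∀ x, DifferentiableAt ℝ (fun τ => u τ x) t
  tderiv_cont : ContinuousOn (fun p : ℝ × Euc d => deriv (fun τ => u τ p.2) p.1) (Ioi s ×ˢ univ)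
  xdiff : ∀ t, s < t → ContDiff ℝ 2 (u t)
  grad_cont : ContinuousOn (fun p : ℝ × Euc d => fderiv ℝ (u p.1) p.2) (Ioi s ×ˢ univ)
  hess_cont : ContinuousOn (fun p : ℝ × Euc d => hess d (u p.1) p.2) (Ioi s ×ˢ univ)
  pde : ∀ t, s < t → ∀ x, deriv (fun τ => u τ x) t = Aop d Q b c t (u t) x
  init : ∀ x, u s x = f x

def BoundedOnStrips (d : ℕ) (s : ℝ) (u : ℝ → Euc d → ℝ) : Prop :=
  ∀ T, s < T → ∃ M, ∀ t ∈ Icc s T, ∀ x, |u t x| ≤ M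

def LocBddOn (I : Set ℝ) (g : ℝ → ℝ) : Prop :=
  ∀ a b : ℝ, Icc a b ⊆ I → ∃ M, ∀ t ∈ Icc a b, |g t| ≤ M

open ProbabilityTheory Topology
set_option synthInstance.maxHeartbeats 200000

section gauss
variable {d : ℕ}

abbrev gam (d : ℕ) : Measure (Euc d) := stdGaussian (Euc d)

def phi (d : ℕ) (z : Euc d) : ℝ := (2*Real.pi)^(-(d:ℝ)/2) * Real.exp (-(1/2) * ‖z‖^2)

lemma phi_nonneg (z : Euc d) : 0 ≤ phi d z := by unfold phi; positivity

lemma phi_cont : Continuous (phi d) := by unfold phi; fun_prop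

lemma exp_int {b : ℝ} (hb : 0 < b) : Integrable (fun z : Euc d => Real.exp (-b * ‖z‖^2)) := by
  have := GaussianFourier.integrable_cexp_neg_mul_sq_norm_add (V := Euc d) (b := b) (by simpa using hb) 0 0
  refine this.re.congr (ae_of_all _ fun z => ?_)
  simp only [inner_zero_left, Complex.ofReal_zero, mul_zero, add_zero]
  rw [show (-(b:ℂ) * (‖z‖:ℂ)^2) = ((-b * ‖z‖^2 : ℝ) : ℂ) by push_cast; ring]
  exact Complex.exp_ofReal_re _

lemma gam_eq : gam d = volume.withDensity (fun z => ENNReal.ofReal (phi d z)) := by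
  have hint : Integrable (phi d) := (exp_int (by norm_num)).const_mul _
  have : IsFiniteMeasure (volume.withDensity (fun z => ENNReal.ofReal (phi d z))) :=
    isFiniteMeasure_withDensity_ofReal hint.2
  apply Measure.ext_of_charFun
  ext t
  rw [charFun_stdGaussian, charFun_apply,
    integral_withDensity_eq_integral_toReal_smul (by have := phi_cont (d := d); fun_prop) (by simp)]
  have h := GaussianFourier.integral_cexp_neg_mul_sq_norm_add (V := Euc d) (b := (1/2:ℝ)) (by simp) Complex.I t
  have e : ∀ z : Euc d, (ENNReal.ofReal (phi d z)).toReal • Complex.exp ((inner ℝ z t : ℝ) * Complex.I)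
     = (((2*Real.pi)^(-(d:ℝ)/2) : ℝ) : ℂ) * Complex.exp (-((1/2:ℝ):ℂ) * ‖z‖^2 + Complex.I * (inner ℝ t z : ℝ)) := by
    intro z
    rw [ENNReal.toReal_ofReal (phi_nonneg z), Complex.exp_add, real_inner_comm, Complex.real_smul, phi]
    push_cast
    rw [mul_comm (Complex.I)]; ring
  simp_rw [e]
  rw [integral_const_mul, h]
  rw [show ((Real.pi:ℂ) / ((1/2:ℝ):ℂ)) = ((2*Real.pi : ℝ):ℂ) by push_cast; ring,
    show ((Module.finrank ℝ (Euc d) : ℂ)/2) = (((d:ℝ)/2 : ℝ):ℂ) by simp,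
    ← Complex.ofReal_cpow (by positivity), ← mul_assoc, ← Complex.ofReal_mul,
    ← Real.rpow_add (by positivity)]
  rw [show -(d:ℝ)/2 + d/2 = 0 by ring]
  simp only [Real.rpow_zero, Complex.ofReal_one, one_mul, Complex.I_sq]
  push_cast; congr 1; ring

lemma mom_int (k : ℕ) : Integrable (fun z : Euc d => (1 + ‖z‖)^k) (gam d) := by
  have h0 : MemLp id (k : ENNReal) (gam d) := IsGaussian.memLp_id (gam d) k (ENNReal.natCast_ne_top k)
  have h1 : MemLp (fun z : Euc d => 1 + ‖z‖) (k : ENNReal) (gam d) := by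
    have := (memLp_const (μ := gam d) (p := k) (1:ℝ)).add h0.norm
    exact this
  have := h1.integrable_norm_pow'
  refine this.congr (ae_of_all _ fun z => ?_)
  simp only [Real.norm_eq_abs]
  rw [abs_of_nonneg (by positivity)]

def Cg (d : ℕ) : ℝ := ∫ z, (1 + ‖z‖)^3 ∂(gam d)

lemma one_le_Cg : 1 ≤ Cg d := by
  have : ∫ z, (1:ℝ) ∂(gam d) ≤ Cg d := integral_mono (integrable_const _) (mom_int 3)
    (fun z => by have := norm_nonneg z; exact one_le_pow₀ (by linarith))
  simpa using this

/-- master estimate -/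
lemma norm_int_le {F : Type*} [NormedAddCommGroup F] [NormedSpace ℝ F] {f : Euc d → F} {M : ℝ}
    (hf : ∀ z, ‖f z‖ ≤ M * (1+‖z‖)^3) : ‖∫ z, f z ∂(gam d)‖ ≤ M * Cg d := by
  rw [Cg, ← integral_const_mul]
  exact norm_integral_le_of_norm_le ((mom_int 3).const_mul _) (ae_of_all _ hf)

lemma semigroup_meas (a b c : ℝ) (h : a^2+b^2 = c^2) :
    ((gam d).prod (gam d)).map (fun z => a • z.1 + b • z.2) = (gam d).map (fun z => c • z) := by
  apply Measure.ext_of_charFun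
  ext t
  rw [charFun_map_smul, charFun_stdGaussian, charFun_apply, integral_map (by fun_prop) (by fun_prop)]
  have e : ∀ z : Euc d × Euc d, Complex.exp ((inner ℝ (a • z.1 + b • z.2) t : ℝ) * Complex.I)
     = Complex.exp ((inner ℝ z.1 (a • t) : ℝ) * Complex.I) * Complex.exp ((inner ℝ z.2 (b • t) : ℝ) * Complex.I) := by
    intro z
    rw [← Complex.exp_add, inner_add_left, real_inner_smul_left, real_inner_smul_left,
      real_inner_smul_right, real_inner_smul_right]; push_cast; ring_nf
  simp_rw [e]
  rw [integral_prod_mul (f := fun z : Euc d => Complex.exp ((inner ℝ z (a • t) : ℝ) * Complex.I))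
     (g := fun z : Euc d => Complex.exp ((inner ℝ z (b • t) : ℝ) * Complex.I)), ← charFun_apply, ← charFun_apply,
     charFun_stdGaussian, charFun_stdGaussian, ← Complex.exp_add]
  congr 1
  rw [norm_smul, norm_smul, norm_smul]
  have : ((‖a‖:ℝ):ℂ)^2 + (‖b‖:ℝ)^2 = (‖c‖:ℝ)^2 := by
    norm_cast; simp [h]
  push_cast
  linear_combination (-(‖t‖:ℂ)^2/2) * this

end gauss

section ops
variable {d : ℕ} {F : Type*} [NormedAddCommGroup F] [NormedSpace ℝ F]

def PP (a : ℝ) (f : Euc d → F) (x : Euc d) : F := ∫ z, f (x + a • z) ∂(gam d)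
def BB (a : ℝ) (f : Euc d → F) (x : Euc d) : Euc d →L[ℝ] F :=
  ∫ z, (innerSL ℝ z).smulRight (f (x + a • z)) ∂(gam d)

lemma norm_sr (z : Euc d) (v : F) : ‖(innerSL ℝ z).smulRight v‖ = ‖z‖ * ‖v‖ := by
  rw [ContinuousLinearMap.norm_smulRight_apply, innerSL_apply_norm]

lemma sr_cont : Continuous (fun q : Euc d × F => (innerSL ℝ q.1).smulRight q.2) := by
  have := (ContinuousLinearMap.smulRightL ℝ (Euc d) F).continuous₂.comp
    (((innerSL ℝ (E := Euc d)).continuous.comp continuous_fst).prodMk continuous_snd)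
  exact this

lemma one_le_mom (z : Euc d) : 1 ≤ (1+‖z‖)^3 := one_le_pow₀ (by have := norm_nonneg z; linarith)
lemma nle_mom (z : Euc d) : ‖z‖ ≤ (1+‖z‖)^3 := by
  have := norm_nonneg z
  nlinarith [mul_nonneg this this, mul_nonneg (mul_nonneg this this) this]

lemma PP_bdd {a : ℝ} {f : Euc d → F} {M : ℝ} (hf : ∀ x, ‖f x‖ ≤ M) (x : Euc d) : ‖PP a f x‖ ≤ M := by
  refine (norm_integral_le_of_norm_le_const (ae_of_all _ fun z => hf (x + a • z))).trans ?_
  simp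

lemma BB_bdd {a : ℝ} {f : Euc d → F} {M : ℝ} (hf : ∀ x, ‖f x‖ ≤ M) (x : Euc d) : ‖BB a f x‖ ≤ M * Cg d := by
  refine norm_int_le fun z => ?_
  rw [norm_sr, mul_comm M]
  exact mul_le_mul (nle_mom z) (hf _) (norm_nonneg _) (by positivity)

variable {X : Type*} [TopologicalSpace X] [FirstCountableTopology X]

lemma PP_cont {g : X → Euc d → F} {a : X → ℝ} {M : ℝ} (hg : Continuous (fun z : X × Euc d => g z.1 z.2))
    (ha : Continuous a) (hb : ∀ x y, ‖g x y‖ ≤ M) :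
    Continuous (fun z : X × Euc d => PP (a z.1) (g z.1) z.2) := by
  unfold PP
  have hk : ∀ z : Euc d, Continuous (fun q : X × Euc d => g q.1 (q.2 + a q.1 • z)) := fun z =>
    hg.comp (continuous_fst.prodMk (continuous_snd.add ((ha.comp continuous_fst).smul continuous_const)))
  refine continuous_of_dominated (bound := fun _ => M) (fun q => ?_) (fun q => ae_of_all _ fun z => hb _ _)
    (integrable_const _) (ae_of_all _ hk)
  exact (hg.comp (continuous_const.prodMk (by fun_prop : Continuous fun z : Euc d => q.2 + a q.1 • z))).aestronglyMeasurable

lemma BB_cont {g : X → Euc d → F} {a : X → ℝ} {M : ℝ} (hg : Continuous (fun z : X × Euc d => g z.1 z.2))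
    (ha : Continuous a) (hb : ∀ x y, ‖g x y‖ ≤ M) :
    Continuous (fun z : X × Euc d => BB (a z.1) (g z.1) z.2) := by
  unfold BB
  have hk : ∀ z : Euc d, Continuous (fun q : X × Euc d => g q.1 (q.2 + a q.1 • z)) := fun z =>
    hg.comp (continuous_fst.prodMk (continuous_snd.add ((ha.comp continuous_fst).smul continuous_const)))
  refine continuous_of_dominated (bound := fun z => M * (1+‖z‖)^3) (fun q => ?_) (fun q => ae_of_all _ fun z => ?_)
    ((mom_int 3).const_mul _) (ae_of_all _ fun z => sr_cont.comp (continuous_const.prodMk (hk z)))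
  · exact (sr_cont.comp (continuous_id.prodMk
      (hg.comp (continuous_const.prodMk (by fun_prop : Continuous fun z : Euc d => q.2 + a q.1 • z))))).aestronglyMeasurable
  · rw [norm_sr, mul_comm M]
    exact mul_le_mul (nle_mom z) (hb _ _) (norm_nonneg _) (by positivity)

lemma sr_int {f : Euc d → F} {M : ℝ} (hf : Continuous f) (hb : ∀ y, ‖f y‖ ≤ M) (x : Euc d) (a : ℝ) :
    Integrable (fun z => (innerSL ℝ z).smulRight (f (x + a • z))) (gam d) := by
  have hc : Continuous (fun z => (innerSL ℝ z).smulRight (f (x + a • z))) := sr_cont.comp (continuous_id.prodMk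
      (hf.comp (by fun_prop : Continuous fun z : Euc d => x + a • z)))
  refine ((mom_int 3).const_mul M).mono' hc.aestronglyMeasurable (ae_of_all _ fun z => ?_)
  rw [norm_sr, mul_comm M]
  exact mul_le_mul (nle_mom z) (hb _) (norm_nonneg _) (by positivity)

lemma sr_zero [CompleteSpace F] (v : F) : ∫ z : Euc d, (innerSL ℝ z).smulRight v ∂(gam d) = 0 := by
  have h := ((ContinuousLinearMap.smulRightL ℝ (Euc d) F).flip v).comp (innerSL ℝ (E := Euc d))
     |>.integral_comp_comm (μ := gam d) (φ := id) IsGaussian.integrable_id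
  have e : ∫ z, id z ∂(gam d) = 0 := integral_id_stdGaussian
  rw [e, map_zero] at h
  exact h

lemma BB_hol [CompleteSpace F] {a : ℝ} {f : Euc d → F} {M K α : ℝ} (hα : α ∈ Ioo (0:ℝ) 1) (hf : Continuous f)
    (hb : ∀ y, ‖f y‖ ≤ M) (hh : ∀ x y, ‖f x - f y‖ ≤ K * ‖x-y‖^α) (hK : 0 ≤ K) (x : Euc d) :
    ‖BB a f x‖ ≤ K * |a|^α * Cg d := by
  have e : BB a f x = ∫ z, (innerSL ℝ z).smulRight (f (x + a • z) - f x) ∂(gam d) := by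
    rw [← sub_zero (BB a f x), ← sr_zero (f x), BB, ← integral_sub (sr_int hf hb x a)]
    · congr 1; ext z w; simp [smul_sub]
    · exact sr_int (f := fun _ => f x) continuous_const (fun _ => le_rfl) 0 0
  rw [e]
  refine norm_int_le fun z => ?_
  rw [norm_sr]
  have h1 := hh (x + a • z) x
  rw [add_sub_cancel_left, norm_smul, Real.mul_rpow (norm_nonneg _) (norm_nonneg _), Real.norm_eq_abs] at h1
  have h2 : ‖z‖ * ‖z‖^α ≤ (1+‖z‖)^3 := by
    have hz := norm_nonneg z
    have : ‖z‖^α ≤ (1+‖z‖)^(1:ℝ) := (Real.rpow_le_rpow hz (by linarith) hα.1.le).trans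
      (Real.rpow_le_rpow_of_exponent_le (by linarith) hα.2.le)
    rw [Real.rpow_one] at this
    nlinarith [mul_nonneg hz hz, mul_nonneg (mul_nonneg hz hz) hz, mul_le_mul_of_nonneg_left this hz]
  calc ‖z‖ * ‖f (x + a • z) - f x‖ ≤ ‖z‖ * (K * (|a|^α * ‖z‖^α)) := by gcongr
    _ = K * |a|^α * (‖z‖ * ‖z‖^α) := by ring
    _ ≤ _ := by gcongr

lemma PP_deriv1 {f : Euc d → F} {M : ℝ} (hf : Continuous f) (hb : ∀ y, ‖f y‖ ≤ M) (x0 : Euc d) :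
    HasFDerivAt (PP 1 f) (BB 1 f x0) x0 := by
  have hM : 0 ≤ M := (norm_nonneg _).trans (hb 0)
  have e1 : PP 1 f = fun x => ∫ y, phi d (y - x) • f y := by
    ext x
    rw [PP, gam_eq, integral_withDensity_eq_integral_toReal_smul (by have := phi_cont (d := d); fun_prop) (by simp),
      ← integral_sub_right_eq_self _ x]
    congr 1; ext y
    rw [ENNReal.toReal_ofReal (phi_nonneg _)]; simp
  have e2 : BB 1 f x0 = ∫ y, phi d (y - x0) • (innerSL ℝ (y - x0)).smulRight (f y) := by
    rw [BB, gam_eq, integral_withDensity_eq_integral_toReal_smul (by have := phi_cont (d := d); fun_prop) (by simp),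
      ← integral_sub_right_eq_self _ x0]
    congr 1; ext1 y
    rw [ENNReal.toReal_ofReal (phi_nonneg _)]; simp
  rw [e1, e2]
  set c := (2*Real.pi)^(-(d:ℝ)/2) with hc
  have hc0 : 0 ≤ c := by positivity
  have key : ∀ x ∈ Metric.ball x0 1, ∀ y : Euc d,
      (1 + ‖y - x‖) * Real.exp (-(1/2) * ‖y-x‖^2) ≤ 2 * Real.exp (1/4) * Real.exp (-(1/8) * ‖y-x0‖^2) := by
    intro x hx y
    have h1 : ‖y - x0‖ ≤ ‖y - x‖ + 1 := by
      have := norm_add_le (y - x) (x - x0)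
      rw [sub_add_sub_cancel] at this
      rw [mem_ball_iff_norm] at hx; linarith
    have h2 := norm_nonneg (y - x0)
    have h3 := norm_nonneg (y - x)
    have h4 : 1 + ‖y-x‖ ≤ 2 * Real.exp ((1/4)*‖y-x‖^2) := by
      have := Real.add_one_le_exp ((1/4)*‖y-x‖^2)
      nlinarith [sq_nonneg (‖y-x‖ - 1)]
    calc _ ≤ 2 * Real.exp ((1/4)*‖y-x‖^2) * Real.exp (-(1/2) * ‖y-x‖^2) := by gcongr
      _ = 2 * Real.exp (-(1/4)*‖y-x‖^2) := by rw [mul_assoc, ← Real.exp_add]; ring_nf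
      _ ≤ 2 * Real.exp (1/4 + -(1/8) * ‖y-x0‖^2) := by
          gcongr; nlinarith [sq_nonneg (‖y-x‖ - 1)]
      _ = _ := by rw [Real.exp_add]; ring
  have hbi : Integrable (fun y : Euc d => c * (2 * Real.exp (1/4) * Real.exp (-(1/8) * ‖y-x0‖^2)) * M) :=
    ((((exp_int (by norm_num : (0:ℝ) < 1/8)).comp_sub_right x0).const_mul _).const_mul _).mul_const _
  have hmeas : ∀ x : Euc d, AEStronglyMeasurable (fun y => phi d (y - x) • f y) :=
    fun x => ((phi_cont.comp (by fun_prop)).smul hf).aestronglyMeasurable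
  refine hasFDerivAt_integral_of_dominated_of_fderiv_le (F := fun x y => phi d (y - x) • f y)
    (F' := fun x y => phi d (y - x) • (innerSL ℝ (y - x)).smulRight (f y)) (Metric.ball_mem_nhds x0 one_pos)
    (Eventually.of_forall hmeas) (hbi.mono' (hmeas x0) (ae_of_all _ fun y => ?_)) ?_
    (ae_of_all _ fun y x hx => ?_) hbi (ae_of_all _ fun y x hx => ?_)
  · rw [norm_smul, Real.norm_of_nonneg (phi_nonneg _), phi]
    have := key x0 (Metric.mem_ball_self one_pos) y
    have h2 : Real.exp (-(1/2) * ‖y-x0‖^2) ≤ (1 + ‖y - x0‖) * Real.exp (-(1/2) * ‖y-x0‖^2) :=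
      le_mul_of_one_le_left (Real.exp_pos _).le (by have := norm_nonneg (y - x0); linarith)
    exact mul_le_mul (mul_le_mul_of_nonneg_left (h2.trans this) hc0) (hb y) (norm_nonneg _) (by positivity)
  · exact ((phi_cont.comp (by fun_prop)).smul (sr_cont.comp ((by fun_prop : Continuous fun y : Euc d => y - x0).prodMk hf))).aestronglyMeasurable
  · rw [norm_smul, Real.norm_of_nonneg (phi_nonneg _), phi, norm_sr]
    have := key x hx y
    have h3 := hb y
    have h2 : Real.exp (-(1/2) * ‖y-x‖^2) * ‖y - x‖ ≤ (1 + ‖y - x‖) * Real.exp (-(1/2) * ‖y-x‖^2) := by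
      have := Real.exp_pos (-(1/2) * ‖y-x‖^2); nlinarith [norm_nonneg (y-x)]
    calc _ = c * (Real.exp (-(1/2) * ‖y-x‖^2) * ‖y - x‖) * ‖f y‖ := by ring
      _ ≤ _ := mul_le_mul (mul_le_mul_of_nonneg_left (h2.trans this) hc0) (hb y) (norm_nonneg _) (by positivity)
  · have h1 : HasFDerivAt (fun x : Euc d => ‖y - x‖^2) ((2:ℝ) • -(innerSL ℝ (y - x))) x := by
      have := ((hasFDerivAt_id x).const_sub y).norm_sq
      refine this.congr_fderiv ?_
      ext w; simp
    have h2 := (((h1.const_mul (-(1/2))).exp).const_mul c).smul_const (f y)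
    refine h2.congr_fderiv ?_
    ext w
    simp only [phi, smul_apply, ContinuousLinearMap.smulRight_apply,
      neg_apply, smul_smul, smul_eq_mul]
    congr 1; ring

lemma PP_deriv {f : Euc d → F} {M a : ℝ} (hf : Continuous f) (hb : ∀ y, ‖f y‖ ≤ M) (ha : a ≠ 0) (x : Euc d) :
    HasFDerivAt (PP a f) (a⁻¹ • BB a f x) x := by
  have e1 : PP a f = PP 1 (fun y => f (a • y)) ∘ (fun x => a⁻¹ • x) := by
    ext x; simp [PP, smul_add, smul_smul, ha]
  have e2 : BB a f x = BB 1 (fun y => f (a • y)) (a⁻¹ • x) := by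
    simp [BB, smul_add, smul_smul, ha]
  rw [e1, e2]
  have h := (PP_deriv1 (f := fun y => f (a • y)) (hf.comp (by fun_prop)) (fun y => hb _) (a⁻¹ • x)).comp x
    ((hasFDerivAt_id x).const_smul a⁻¹)
  refine h.congr_fderiv ?_
  ext w; simp

lemma PP_comm {f : Euc d → F} {f' : Euc d → Euc d →L[ℝ] F} {M M' a : ℝ} (hb : ∀ y, ‖f y‖ ≤ M)
    (hf' : Continuous f') (hb' : ∀ y, ‖f' y‖ ≤ M') (hd : ∀ y, HasFDerivAt f (f' y) y) (x : Euc d) :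
    HasFDerivAt (PP a f) (PP a f' x) x := by
  have hf : Continuous f := continuous_iff_continuousAt.2 fun y => (hd y).continuousAt
  refine hasFDerivAt_integral_of_dominated_of_fderiv_le (F := fun x z => f (x + a • z))
    (F' := fun x z => f' (x + a • z)) (bound := fun _ => M') univ_mem
    (Eventually.of_forall fun x => (hf.comp (by fun_prop)).aestronglyMeasurable)
    ((integrable_const M).mono' (hf.comp (by fun_prop)).aestronglyMeasurable (ae_of_all _ fun z => hb _))
    (hf'.comp (by fun_prop)).aestronglyMeasurable (ae_of_all _ fun z x _ => hb' _) (integrable_const _)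
    (ae_of_all _ fun z x _ => ?_)
  exact ((hd (x + a • z)).comp x ((hasFDerivAt_id x).add_const (a • z))).congr_fderiv (by ext w; simp)

lemma PP_semi {f : Euc d → F} {M a b c : ℝ} (hf : Continuous f) (hb : ∀ y, ‖f y‖ ≤ M)
    (h : a^2 + b^2 = c^2) : PP a (PP b f) = PP c f := by
  ext x
  have e := congrArg (fun μ : Measure (Euc d) => ∫ y, f (x + y) ∂μ) (semigroup_meas (d := d) a b c h)
  have hfx : Continuous (fun y => f (x + y)) := hf.comp (by fun_prop)
  rw [integral_map (by fun_prop) hfx.aestronglyMeasurable, integral_map (by fun_prop) hfx.aestronglyMeasurable,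
    integral_prod] at e
  · rw [PP, PP, ← e]; simp only [PP, add_assoc]
  · exact (integrable_const M).mono' (hf.comp (by fun_prop)).aestronglyMeasurable (ae_of_all _ fun z => hb _)

end ops

section insts
variable {d : ℕ}
instance l1a : NormedAddCommGroup (Euc d →L[ℝ] ℝ) := inferInstance
instance l1b : NormedSpace ℝ (Euc d →L[ℝ] ℝ) := inferInstance
instance l2a : NormedAddCommGroup (Euc d →L[ℝ] Euc d →L[ℝ] ℝ) := inferInstance
instance l2b : NormedSpace ℝ (Euc d →L[ℝ] Euc d →L[ℝ] ℝ) := inferInstance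
instance l2c : AddMonoid (Euc d →L[ℝ] Euc d →L[ℝ] ℝ) := inferInstance
instance l2d : AddCommGroup (Euc d →L[ℝ] Euc d →L[ℝ] ℝ) := inferInstance
instance l2e : Norm (Euc d →L[ℝ] Euc d →L[ℝ] ℝ) := inferInstance
instance l3a : NormedAddCommGroup (Euc d →L[ℝ] Euc d →L[ℝ] Euc d →L[ℝ] ℝ) := inferInstance
instance l3b : NormedSpace ℝ (Euc d →L[ℝ] Euc d →L[ℝ] Euc d →L[ℝ] ℝ) := inferInstance
instance l3e : Norm (Euc d →L[ℝ] Euc d →L[ℝ] Euc d →L[ℝ] ℝ) := inferInstance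
end insts

section pot
variable {d : ℕ} {F : Type*} [NormedAddCommGroup F] [NormedSpace ℝ F]

def Nn (α K : ℝ) (g : ℝ → Euc d → F) : Prop :=
  Continuous (fun z : ℝ × Euc d => g z.1 z.2) ∧ (∀ t x, ‖g t x‖ ≤ K) ∧
    ∀ t x y, ‖g t x - g t y‖ ≤ K * ‖x - y‖ ^ α

structure Jet (u : ℝ → Euc d → ℝ) (p : ℝ → Euc d → Euc d →L[ℝ] ℝ)
    (H : ℝ → Euc d → Euc d →L[ℝ] Euc d →L[ℝ] ℝ) : Prop where
  h1 : ∀ t x, HasFDerivAt (u t) (p t x) x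
  h2 : ∀ t x, HasFDerivAt (p t) (H t x) x

/-- integration of kernels in `τ` -/
lemma tau_cont {N : ℝ → ℝ → Euc d → F} {w β : ℝ → ℝ}
    (hN : Continuous (fun q : (ℝ × ℝ) × Euc d => N q.1.1 q.1.2 q.2)) (hw : Measurable w)
    (hβ : IntegrableOn β (Ioi 0)) (hb : ∀ τ > 0, ∀ t x, ‖w τ • N τ t x‖ ≤ β τ) :
    Continuous (fun q : ℝ × Euc d => ∫ τ in Ioi (0:ℝ), w τ • N τ q.1 q.2) := by
  refine continuous_of_dominated (bound := β) (fun q => ?_) (fun q => ?_) hβ (ae_of_all _ fun τ => ?_)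
  · refine (hw.aestronglyMeasurable).smul (Continuous.aestronglyMeasurable ?_)
    exact hN.comp (by fun_prop : Continuous fun τ : ℝ => (((τ, q.1), q.2) : (ℝ × ℝ) × Euc d))
  · exact (ae_restrict_iff' measurableSet_Ioi).2 (ae_of_all _ fun τ hτ => hb τ hτ _ _)
  · exact (hN.comp (by fun_prop : Continuous fun q : ℝ × Euc d => (((τ, q.1), q.2) : (ℝ × ℝ) × Euc d))).const_smul _

lemma tau_int {N : ℝ → ℝ → Euc d → F} {w β : ℝ → ℝ}
    (hN : Continuous (fun q : (ℝ × ℝ) × Euc d => N q.1.1 q.1.2 q.2)) (hw : Measurable w)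
    (hβ : IntegrableOn β (Ioi 0)) (hb : ∀ τ > 0, ∀ t x, ‖w τ • N τ t x‖ ≤ β τ) (t : ℝ) (x : Euc d) :
    IntegrableOn (fun τ => w τ • N τ t x) (Ioi 0) := by
  refine Integrable.mono' hβ ?_ ((ae_restrict_iff' measurableSet_Ioi).2 (ae_of_all _ fun τ hτ => hb τ hτ _ _))
  refine (hw.aestronglyMeasurable).smul (Continuous.aestronglyMeasurable ?_)
  exact hN.comp (by fun_prop : Continuous fun τ : ℝ => (((τ, t), x) : (ℝ × ℝ) × Euc d))

lemma tau_deriv {N : ℝ → ℝ → Euc d → F} {N' : ℝ → ℝ → Euc d → Euc d →L[ℝ] F} {w w' β β' : ℝ → ℝ}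
    (hN : Continuous (fun q : (ℝ × ℝ) × Euc d => N q.1.1 q.1.2 q.2)) (hw : Measurable w)
    (hβ : IntegrableOn β (Ioi 0)) (hb : ∀ τ > 0, ∀ t x, ‖w τ • N τ t x‖ ≤ β τ)
    (hN' : Continuous (fun q : (ℝ × ℝ) × Euc d => N' q.1.1 q.1.2 q.2)) (hw' : Measurable w')
    (hβ' : IntegrableOn β' (Ioi 0)) (hb' : ∀ τ > 0, ∀ t x, ‖w' τ • N' τ t x‖ ≤ β' τ)
    (hd : ∀ τ > 0, ∀ t x, HasFDerivAt (fun x => w τ • N τ t x) (w' τ • N' τ t x) x) (t : ℝ) (x : Euc d) :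
    HasFDerivAt (fun x => ∫ τ in Ioi (0:ℝ), w τ • N τ t x) (∫ τ in Ioi (0:ℝ), w' τ • N' τ t x) x := by
  refine hasFDerivAt_integral_of_dominated_of_fderiv_le (F := fun x τ => w τ • N τ t x)
    (F' := fun x τ => w' τ • N' τ t x) (bound := β') univ_mem
    (Eventually.of_forall fun x => (tau_int hN hw hβ hb t x).1) (tau_int hN hw hβ hb t x)
    (tau_int hN' hw' hβ' hb' t x).1 ?_ hβ' ?_
  · exact (ae_restrict_iff' measurableSet_Ioi).2 (ae_of_all _ fun τ hτ _ _ => hb' τ hτ _ _)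
  · exact (ae_restrict_iff' measurableSet_Ioi).2 (ae_of_all _ fun τ hτ _ _ => hd τ hτ _ _)

lemma tau_norm {N : ℝ → ℝ → Euc d → F} {w β : ℝ → ℝ}
    (hβ : IntegrableOn β (Ioi 0)) (hb : ∀ τ > 0, ∀ t x, ‖w τ • N τ t x‖ ≤ β τ) (t : ℝ) (x : Euc d) :
    ‖∫ τ in Ioi (0:ℝ), w τ • N τ t x‖ ≤ ∫ τ in Ioi (0:ℝ), β τ :=
  norm_integral_le_of_norm_le hβ
    ((ae_restrict_iff' measurableSet_Ioi).2 (ae_of_all _ fun τ hτ => hb τ hτ _ _))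

lemma gam_int {a r : ℝ} (ha : 0 < a) (hr : 0 < r) (B : ℝ) :
    IntegrableOn (fun t : ℝ => B * (t^(a-1) * Real.exp (-(r*t)))) (Ioi 0) ∧
    ∫ t in Ioi (0:ℝ), B * (t^(a-1) * Real.exp (-(r*t))) = B * ((1/r)^a * Real.Gamma a) := by
  have h := Real.integral_rpow_mul_exp_neg_mul_Ioi ha hr
  refine ⟨(Integrable.of_integral_ne_zero ?_).const_mul B, ?_⟩
  · rw [h]; have := Real.Gamma_pos_of_pos ha; positivity
  · rw [integral_const_mul, h]

def cc (τ : ℝ) : ℝ := Real.sqrt (2*τ/3)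

lemma cc_cont : Continuous cc := by unfold cc; fun_prop

lemma cc_pos {τ : ℝ} (h : 0 < τ) : 0 < cc τ := Real.sqrt_pos.2 (by positivity)

lemma cc_pow {τ α : ℝ} (h : 0 < τ) (k : ℕ) :
    (cc τ)⁻¹^k * (cc τ)^α = (2/3:ℝ)^((α-k)/2) * τ^((α-k)/2) := by
  have hc := cc_pos h
  rw [← Real.mul_rpow (by norm_num) h.le, inv_pow, ← Real.rpow_natCast, ← Real.rpow_neg hc.le,
    ← Real.rpow_add hc, cc, Real.sqrt_eq_rpow, ← Real.rpow_mul (by positivity)]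
  congr 1 <;> ring

variable (g : ℝ → Euc d → ℝ)

def T0 (τ t : ℝ) : Euc d → ℝ := PP (cc τ) (PP (cc τ) (PP (cc τ) (g (t - τ))))
def T1 (τ t : ℝ) : Euc d → Euc d →L[ℝ] ℝ := PP (cc τ) (PP (cc τ) (BB (cc τ) (g (t - τ))))
def T2 (τ t : ℝ) : Euc d → Euc d →L[ℝ] Euc d →L[ℝ] ℝ := PP (cc τ) (BB (cc τ) (BB (cc τ) (g (t - τ))))
def T3 (τ t : ℝ) : Euc d → Euc d →L[ℝ] Euc d →L[ℝ] Euc d →L[ℝ] ℝ :=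
  BB (cc τ) (BB (cc τ) (BB (cc τ) (g (t - τ))))

variable {g} {α K : ℝ}

lemma PP_cont' {g : ℝ × ℝ → Euc d → F} {M : ℝ} (hg : Continuous (fun z : (ℝ × ℝ) × Euc d => g z.1 z.2))
    (hb : ∀ x y, ‖g x y‖ ≤ M) :
    Continuous (fun z : (ℝ × ℝ) × Euc d => PP (cc z.1.1) (g z.1) z.2) :=
  PP_cont hg (cc_cont.comp continuous_fst) hb

lemma BB_cont' {g : ℝ × ℝ → Euc d → F} {M : ℝ} (hg : Continuous (fun z : (ℝ × ℝ) × Euc d => g z.1 z.2))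
    (hb : ∀ x y, ‖g x y‖ ≤ M) :
    Continuous (fun z : (ℝ × ℝ) × Euc d => BB (cc z.1.1) (g z.1) z.2) :=
  BB_cont hg (cc_cont.comp continuous_fst) hb

lemma g_cont' (hg : Nn α K g) : Continuous (fun z : (ℝ × ℝ) × Euc d => g (z.1.2 - z.1.1) z.2) :=
  hg.1.comp (by fun_prop : Continuous fun z : (ℝ × ℝ) × Euc d => (z.1.2 - z.1.1, z.2))

lemma T0_cont (hg : Nn α K g) : Continuous (fun q : (ℝ × ℝ) × Euc d => T0 g q.1.1 q.1.2 q.2) :=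
  PP_cont' (g := fun q => PP (cc q.1) (PP (cc q.1) (g (q.2 - q.1)))) (PP_cont' (g := fun q => PP (cc q.1) (g (q.2 - q.1)))
    (PP_cont' (g := fun q => g (q.2 - q.1)) (g_cont' hg) (fun q x => hg.2.1 _ _))
      (fun q x => PP_bdd (fun y => hg.2.1 _ _) _)) (fun q x => PP_bdd (fun y => PP_bdd (fun y => hg.2.1 _ _) _) _)

lemma T1_cont (hg : Nn α K g) : Continuous (fun q : (ℝ × ℝ) × Euc d => T1 g q.1.1 q.1.2 q.2) :=
  PP_cont' (g := fun q => PP (cc q.1) (BB (cc q.1) (g (q.2 - q.1)))) (PP_cont' (g := fun q => BB (cc q.1) (g (q.2 - q.1)))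
    (BB_cont' (g := fun q => g (q.2 - q.1)) (g_cont' hg) (fun q x => hg.2.1 _ _))
      (fun q x => BB_bdd (fun y => hg.2.1 _ _) _)) (fun q x => PP_bdd (fun y => BB_bdd (fun y => hg.2.1 _ _) _) _)

lemma T2_cont (hg : Nn α K g) : Continuous (fun q : (ℝ × ℝ) × Euc d => T2 g q.1.1 q.1.2 q.2) :=
  PP_cont' (g := fun q => BB (cc q.1) (BB (cc q.1) (g (q.2 - q.1)))) (BB_cont' (g := fun q => BB (cc q.1) (g (q.2 - q.1)))
    (BB_cont' (g := fun q => g (q.2 - q.1)) (g_cont' hg) (fun q x => hg.2.1 _ _))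
      (fun q x => BB_bdd (fun y => hg.2.1 _ _) _)) (fun q x => BB_bdd (fun y => BB_bdd (fun y => hg.2.1 _ _) _) _)

lemma Nn.nonneg {g : ℝ → Euc d → F} (hg : Nn α K g) : 0 ≤ K := (norm_nonneg _).trans (hg.2.1 0 0)

lemma gc (hg : Nn α K g) (t : ℝ) : Continuous (g t) :=
  hg.1.comp (by fun_prop : Continuous fun x : Euc d => (t, x))

lemma BBc {f : Euc d → F} {M a : ℝ} (hf : Continuous f) (hb : ∀ y, ‖f y‖ ≤ M) : Continuous (BB a f) :=
  (BB_cont (X := Unit) (g := fun _ => f) (a := fun _ => a) (hf.comp continuous_snd) continuous_const (fun _ => hb)).comp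
    (by fun_prop : Continuous fun x : Euc d => ((), x))
lemma PPc {f : Euc d → F} {M a : ℝ} (hf : Continuous f) (hb : ∀ y, ‖f y‖ ≤ M) : Continuous (PP a f) :=
  (PP_cont (X := Unit) (g := fun _ => f) (a := fun _ => a) (hf.comp continuous_snd) continuous_const (fun _ => hb)).comp
    (by fun_prop : Continuous fun x : Euc d => ((), x))

lemma PP_smul (a r : ℝ) (f : Euc d → F) : PP a (fun y => r • f y) = fun y => r • PP a f y := by
  ext x; simp [PP, integral_smul]

lemma PP_comm' {f : Euc d → F} {f' : Euc d → Euc d →L[ℝ] F} {M M' a r : ℝ} (hb : ∀ y, ‖f y‖ ≤ M)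
    (hf' : Continuous f') (hb' : ∀ y, ‖f' y‖ ≤ M') (hd : ∀ y, HasFDerivAt f (r • f' y) y) (x : Euc d) :
    HasFDerivAt (PP a f) (r • PP a f' x) x := by
  have := PP_comm (a := a) (M' := |r| * M') hb (hf'.const_smul r) (fun y => by
    rw [Pi.smul_apply, norm_smul]; exact mul_le_mul_of_nonneg_left (hb' y) (abs_nonneg _)) hd x
  exact this.congr_fderiv (congrFun (PP_smul a r f') x)

lemma T0_deriv (hg : Nn α K g) {τ : ℝ} (hτ : 0 < τ) (t : ℝ) (x : Euc d) :
    HasFDerivAt (T0 g τ t) ((cc τ)⁻¹ • T1 g τ t x) x := by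
  have b0 := hg.2.1 (t - τ)
  have c1 := BBc (a := cc τ) (gc hg (t-τ)) b0
  have b1 : ∀ x, _ := BB_bdd (a := cc τ) b0
  refine PP_comm' (PP_bdd (PP_bdd b0)) (PPc c1 b1) (PP_bdd b1) (PP_comm' (PP_bdd b0) c1 b1 (PP_deriv (gc hg _) b0 (cc_pos hτ).ne')) x

lemma T1_deriv (hg : Nn α K g) {τ : ℝ} (hτ : 0 < τ) (t : ℝ) (x : Euc d) :
    HasFDerivAt (T1 g τ t) ((cc τ)⁻¹ • T2 g τ t x) x := by
  have b0 := hg.2.1 (t - τ)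
  have c1 := BBc (a := cc τ) (gc hg (t-τ)) b0
  have b1 : ∀ x, _ := BB_bdd (a := cc τ) b0
  have c2 := BBc (a := cc τ) c1 b1
  have b2 : ∀ x, _ := BB_bdd (a := cc τ) b1
  exact PP_comm' (PP_bdd b1) c2 b2 (PP_deriv c1 b1 (cc_pos hτ).ne') x

lemma T2_deriv (hg : Nn α K g) {τ : ℝ} (hτ : 0 < τ) (t : ℝ) (x : Euc d) :
    HasFDerivAt (T2 g τ t) ((cc τ)⁻¹ • T3 g τ t x) x := by
  have b0 := hg.2.1 (t - τ)
  have c1 := BBc (a := cc τ) (gc hg (t-τ)) b0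
  have b1 : ∀ x, _ := BB_bdd (a := cc τ) b0
  have c2 := BBc (a := cc τ) c1 b1
  have b2 : ∀ x, _ := BB_bdd (a := cc τ) b1
  exact PP_deriv c2 b2 (cc_pos hτ).ne' x

lemma T_bdds (hα : α ∈ Ioo (0:ℝ) 1) (hg : Nn α K g) {τ : ℝ} (hτ : 0 < τ) (t : ℝ) (x : Euc d) :
    ‖T1 g τ t x‖ ≤ K * Cg d ^ 3 * (cc τ)^α ∧ ‖T2 g τ t x‖ ≤ K * Cg d ^ 3 * (cc τ)^α ∧
    ‖T3 g τ t x‖ ≤ K * Cg d ^ 3 * (cc τ)^α := by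
  have hK := hg.nonneg
  have hC := one_le_Cg (d := d)
  have hc := (Real.rpow_nonneg (cc_pos hτ).le α)
  have h0 : ∀ x, ‖BB (cc τ) (g (t - τ)) x‖ ≤ K * (cc τ)^α * Cg d := by
    have := fun x => BB_hol (a := cc τ) hα (gc hg (t-τ)) (hg.2.1 _) (hg.2.2 _) hK x
    rwa [abs_of_pos (cc_pos hτ)] at this
  have h1 : ∀ x, _ := BB_bdd (a := cc τ) h0
  refine ⟨(PP_bdd (PP_bdd h0) _).trans ?_, (PP_bdd h1 _).trans ?_, (BB_bdd h1 _).trans (le_of_eq ?_)⟩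
  rotate_right
  · ring
  · calc K * cc τ^α * Cg d ≤ K * cc τ^α * Cg d^3 := by gcongr; exact le_self_pow₀ hC (by norm_num)
      _ = _ := by ring
  · calc K * cc τ^α * Cg d * Cg d = K * cc τ^α * Cg d^2 := by ring
      _ ≤ K * cc τ^α * Cg d^3 := by gcongr; norm_num
      _ = _ := by ring

lemma T0_bdd (hg : Nn α K g) (τ t : ℝ) (x : Euc d) : ‖T0 g τ t x‖ ≤ K :=
  PP_bdd (PP_bdd (PP_bdd (hg.2.1 _))) x

end pot

section pot2
variable {d : ℕ} {F : Type*} [NormedAddCommGroup F] [NormedSpace ℝ F]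

lemma lip_of_deriv {f : Euc d → F} {f' : Euc d → Euc d →L[ℝ] F} {P : ℝ} (hd : ∀ x, HasFDerivAt f (f' x) x)
    (hp : ∀ x, ‖f' x‖ ≤ P) (x y : Euc d) : ‖f x - f y‖ ≤ P * ‖x - y‖ :=
  Convex.norm_image_sub_le_of_norm_hasFDerivWithin_le (s := univ)
    (fun z _ => (hd z).hasFDerivWithinAt) (fun z _ => hp z) convex_univ (mem_univ y) (mem_univ x)

lemma hol_interp {f : Euc d → F} {f' : Euc d → Euc d →L[ℝ] F} {U P α : ℝ} (hα : α ∈ Ioo (0:ℝ) 1)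
    (hd : ∀ x, HasFDerivAt f (f' x) x) (hu : ∀ x, ‖f x‖ ≤ U)
    (hp : ∀ x, ‖f' x‖ ≤ P) (x y : Euc d) : ‖f x - f y‖ ≤ (2*U+P) * ‖x - y‖^α := by
  have hU : 0 ≤ U := (norm_nonneg _).trans (hu 0)
  have hP : 0 ≤ P := (norm_nonneg _).trans (hp 0)
  rcases le_total ‖x-y‖ 1 with h | h
  · have h1 : ‖x-y‖ ≤ ‖x-y‖^α := Real.self_le_rpow_of_le_one (norm_nonneg _) h hα.2.le
    have := lip_of_deriv hd hp x y
    have h3 := Real.rpow_nonneg (norm_nonneg (x-y)) α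
    nlinarith [mul_le_mul_of_nonneg_left h1 hP, mul_nonneg hU h3]
  · have h1 : 1 ≤ ‖x-y‖^α := Real.one_le_rpow h hα.1.le
    have := norm_sub_le (f x) (f y)
    have h2 := hu x
    have h3 := hu y
    nlinarith [mul_le_mul_of_nonneg_left h1 hU, mul_nonneg hP (zero_le_one.trans h1)]

def ww (l : ℝ) (k : ℕ) (τ : ℝ) : ℝ := Real.exp (-(l*τ)) * (cc τ)⁻¹^k
lemma ww_meas (l : ℝ) (k : ℕ) : Measurable (ww l k) := by
  unfold ww
  exact (by fun_prop : Measurable fun τ : ℝ => Real.exp (-(l*τ))).mul ((cc_cont.measurable.inv).pow_const k)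

def A_ (d : ℕ) (α : ℝ) (k : ℕ) : ℝ := Cg d ^ 3 * (2/3:ℝ)^((α-k)/2)
lemma A_nonneg (α : ℝ) (k : ℕ) : 0 ≤ A_ d α k := by
  have := one_le_Cg (d := d); unfold A_; positivity

lemma ww_bdd {l α K τ : ℝ} {k : ℕ} (hτ : 0 < τ) {v : F} (hv : ‖v‖ ≤ K * Cg d^3 * cc τ^α) :
    ‖ww l k τ • v‖ ≤ A_ d α k * K * (τ^((1+(α-k)/2)-1) * Real.exp (-(l*τ))) := by
  have hc := cc_pos hτ
  rw [norm_smul, Real.norm_of_nonneg (by unfold ww; positivity), ww]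
  calc _ ≤ Real.exp (-(l*τ)) * (cc τ)⁻¹^k * (K * Cg d^3 * cc τ^α) := by gcongr
    _ = Real.exp (-(l*τ)) * K * Cg d^3 * ((cc τ)⁻¹^k * cc τ^α) := by ring
    _ = _ := by rw [cc_pow hτ, A_]; ring_nf

def U0 (l : ℝ) (g : ℝ → Euc d → ℝ) (t : ℝ) (x : Euc d) := ∫ τ in Ioi (0:ℝ), ww l 0 τ • T0 g τ t x
def U1 (l : ℝ) (g : ℝ → Euc d → ℝ) (t : ℝ) (x : Euc d) := ∫ τ in Ioi (0:ℝ), ww l 1 τ • T1 g τ t x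
def U2 (l : ℝ) (g : ℝ → Euc d → ℝ) (t : ℝ) (x : Euc d) := ∫ τ in Ioi (0:ℝ), ww l 2 τ • T2 g τ t x

variable {g : ℝ → Euc d → ℝ} {α K l : ℝ}

lemma b0 (hg : Nn α K g) : ∀ τ > 0, ∀ t x, ‖ww l 0 τ • T0 g τ t x‖ ≤ K * (τ^((1:ℝ)-1) * Real.exp (-(l*τ))) := by
  intro τ hτ t x
  rw [norm_smul, ww, pow_zero, mul_one, sub_self, Real.rpow_zero, one_mul, mul_comm, Real.norm_of_nonneg (Real.exp_pos _).le]
  exact mul_le_mul_of_nonneg_right (T0_bdd hg τ t x) (Real.exp_pos _).le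

lemma b1 (hα : α ∈ Ioo (0:ℝ) 1) (hg : Nn α K g) : ∀ τ > 0, ∀ t x, ‖ww l 1 τ • T1 g τ t x‖ ≤
    A_ d α 1 * K * (τ^((1+(α-(1:ℕ))/2)-1) * Real.exp (-(l*τ))) :=
  fun _ hτ t x => ww_bdd hτ (T_bdds hα hg hτ t x).1

lemma b2 (hα : α ∈ Ioo (0:ℝ) 1) (hg : Nn α K g) : ∀ τ > 0, ∀ t x, ‖ww l 2 τ • T2 g τ t x‖ ≤
    A_ d α 2 * K * (τ^((1+(α-(2:ℕ))/2)-1) * Real.exp (-(l*τ))) :=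
  fun _ hτ t x => ww_bdd hτ (T_bdds hα hg hτ t x).2.1

lemma b3 (hα : α ∈ Ioo (0:ℝ) 1) (hg : Nn α K g) : ∀ τ > 0, ∀ t x, ‖ww l 3 τ • T3 g τ t x‖ ≤
    A_ d α 3 * K * (τ^((1+(α-(3:ℕ))/2)-1) * Real.exp (-(l*τ))) :=
  fun _ hτ t x => ww_bdd hτ (T_bdds hα hg hτ t x).2.2

lemma ww_deriv {f : Euc d → F} {f' : Euc d →L[ℝ] F} {x : Euc d} {τ : ℝ} (k : ℕ) (h : HasFDerivAt f ((cc τ)⁻¹ • f') x) :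
    HasFDerivAt (fun x => ww l k τ • f x) (ww l (k+1) τ • f') x :=
  (h.const_smul (ww l k τ)).congr_fderiv (by rw [smul_smul, ww, ww]; congr 1; ring)

lemma U_jet (hα : α ∈ Ioo (0:ℝ) 1) (hl : 0 < l) (hg : Nn α K g) : Jet (U0 l g) (U1 l g) (U2 l g) where
  h1 t x := tau_deriv (T0_cont hg) (ww_meas l 0) (gam_int one_pos hl K).1 (b0 hg) (T1_cont hg) (ww_meas l 1)
    (gam_int (by have := hα.1; norm_num; linarith) hl _).1 (b1 hα hg) (fun τ hτ t x => ww_deriv 0 (T0_deriv hg hτ t x)) t x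
  h2 t x := tau_deriv (T1_cont hg) (ww_meas l 1)
    (gam_int (by have := hα.1; norm_num; linarith) hl _).1 (b1 hα hg) (T2_cont hg) (ww_meas l 2)
    (gam_int (by have := hα.1; norm_num; linarith) hl _).1 (b2 hα hg) (fun τ hτ t x => ww_deriv 1 (T1_deriv hg hτ t x)) t x

lemma U0_b (hl : 0 < l) (hg : Nn α K g) (t : ℝ) (x : Euc d) : ‖U0 l g t x‖ ≤ K * ((1/l)^(1:ℝ) * Real.Gamma 1) :=
  (tau_norm (gam_int one_pos hl K).1 (b0 hg) t x).trans_eq (gam_int one_pos hl K).2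
lemma U1_b (hα : α ∈ Ioo (0:ℝ) 1) (hl : 0 < l) (hg : Nn α K g) (t : ℝ) (x : Euc d) :
    ‖U1 l g t x‖ ≤ A_ d α 1 * K * ((1/l)^(1+(α-(1:ℕ))/2) * Real.Gamma (1+(α-(1:ℕ))/2)) :=
  (tau_norm (gam_int (by have := hα.1; norm_num; linarith) hl _).1 (b1 hα hg) t x).trans_eq
    (gam_int (by have := hα.1; norm_num; linarith) hl _).2
lemma U2_b (hα : α ∈ Ioo (0:ℝ) 1) (hl : 0 < l) (hg : Nn α K g) (t : ℝ) (x : Euc d) :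
    ‖U2 l g t x‖ ≤ A_ d α 2 * K * ((1/l)^(1+(α-(2:ℕ))/2) * Real.Gamma (1+(α-(2:ℕ))/2)) :=
  (tau_norm (gam_int (by have := hα.1; norm_num; linarith) hl _).1 (b2 hα hg) t x).trans_eq
    (gam_int (by have := hα.1; norm_num; linarith) hl _).2

lemma U0_c (hl : 0 < l) (hg : Nn α K g) : Continuous (fun q : ℝ × Euc d => U0 l g q.1 q.2) :=
  tau_cont (T0_cont hg) (ww_meas l 0) (gam_int one_pos hl K).1 (b0 hg)
lemma U1_c (hα : α ∈ Ioo (0:ℝ) 1) (hl : 0 < l) (hg : Nn α K g) : Continuous (fun q : ℝ × Euc d => U1 l g q.1 q.2) :=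
  tau_cont (T1_cont hg) (ww_meas l 1) (gam_int (by have := hα.1; norm_num; linarith) hl _).1 (b1 hα hg)
lemma U2_c (hα : α ∈ Ioo (0:ℝ) 1) (hl : 0 < l) (hg : Nn α K g) : Continuous (fun q : ℝ × Euc d => U2 l g q.1 q.2) :=
  tau_cont (T2_cont hg) (ww_meas l 2) (gam_int (by have := hα.1; norm_num; linarith) hl _).1 (b2 hα hg)

lemma U2_hol (hα : α ∈ Ioo (0:ℝ) 1) (hl : 0 < l) (hg : Nn α K g) (t : ℝ) (x y : Euc d) :
    ‖U2 l g t x - U2 l g t y‖ ≤ (4 * A_ d α 2 / α + 2 * A_ d α 3 / (1-α)) * K * ‖x-y‖^α := by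
  obtain ⟨ha, ha1⟩ := hα
  have hK := hg.nonneg
  have hA2 := A_nonneg (d := d) α 2
  have hA3 := A_nonneg (d := d) α 3
  by_cases hxy : x = y
  · subst hxy; rw [sub_self, norm_zero]
    have : (0:ℝ) < 1 - α := by linarith
    positivity
  set r := ‖x-y‖ with hr
  have hr0 : 0 < r := norm_pos_iff.2 (sub_ne_zero.2 hxy)
  have hi := fun x => tau_int (T2_cont hg) (ww_meas l 2) (gam_int (by norm_num; linarith) hl _).1 (b2 ⟨ha,ha1⟩ hg) t x
  rw [U2, U2, ← integral_sub (hi x) (hi y)]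
  have hd := fun (τ : ℝ) (hτ : 0 < τ) x => ww_deriv (l := l) 2 (T2_deriv hg hτ t x)
  have s1 : ∀ τ > 0, ‖ww l 2 τ • T2 g τ t x - ww l 2 τ • T2 g τ t y‖ ≤ 2 * (A_ d α 2 * K) * τ^(α/2-1) := by
    intro τ hτ
    have e : ∀ z, ‖ww l 2 τ • T2 g τ t z‖ ≤ A_ d α 2 * K * τ^(α/2-1) := fun z => by
      refine (b2 ⟨ha,ha1⟩ hg τ hτ t z).trans ?_
      rw [show (1+(α-(2:ℕ))/2)-1 = α/2-1 by push_cast; ring]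
      have : Real.exp (-(l*τ)) ≤ 1 := Real.exp_le_one_iff.2 (by have := mul_pos hl hτ; linarith)
      exact mul_le_mul_of_nonneg_left (mul_le_of_le_one_right (by positivity) this) (by positivity)
    have := norm_sub_le (ww l 2 τ • T2 g τ t x) (ww l 2 τ • T2 g τ t y)
    have := e x; have := e y; linarith
  have s2 : ∀ τ > 0, ‖ww l 2 τ • T2 g τ t x - ww l 2 τ • T2 g τ t y‖ ≤ (A_ d α 3 * K) * r * τ^((α-3)/2) := by
    intro τ hτ
    have e : ∀ z, ‖ww l (2+1) τ • T3 g τ t z‖ ≤ A_ d α 3 * K * τ^((α-3)/2) := fun z => by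
      refine (b3 ⟨ha,ha1⟩ hg τ hτ t z).trans ?_
      rw [show (1+(α-(3:ℕ))/2)-1 = (α-3)/2 by push_cast; ring]
      have : Real.exp (-(l*τ)) ≤ 1 := Real.exp_le_one_iff.2 (by have := mul_pos hl hτ; linarith)
      exact mul_le_mul_of_nonneg_left (mul_le_of_le_one_right (by positivity) this) (by positivity)
    refine (lip_of_deriv (hd τ hτ) e x y).trans_eq ?_
    rw [← hr]; ring
  have hr2 : 0 < r^2 := by positivity
  have hii : IntegrableOn (fun τ => ww l 2 τ • T2 g τ t x - ww l 2 τ • T2 g τ t y) (Ioi 0) := (hi x).sub (hi y)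
  have iI : IntegrableOn (fun τ : ℝ => τ^(α/2-1)) (Ioc 0 (r^2)) :=
    (intervalIntegrable_iff_integrableOn_Ioc_of_le hr2.le).1 (intervalIntegral.intervalIntegrable_rpow' (by linarith))
  rw [← Ioc_union_Ioi_eq_Ioi hr2.le, setIntegral_union (Set.Ioc_disjoint_Ioi le_rfl) measurableSet_Ioi
    (hii.mono_set Ioc_subset_Ioi_self) (hii.mono_set (Ioi_subset_Ioi hr2.le))]
  have e1 : ‖∫ τ in Ioc 0 (r^2), (ww l 2 τ • T2 g τ t x - ww l 2 τ • T2 g τ t y)‖ ≤ 4 * A_ d α 2 / α * K * r^α := by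
    refine (norm_integral_le_of_norm_le (iI.const_mul (2 * (A_ d α 2 * K))) ((ae_restrict_iff' measurableSet_Ioc).2
      (ae_of_all _ fun τ hτ => s1 τ hτ.1))).trans_eq ?_
    rw [integral_const_mul, ← intervalIntegral.integral_of_le hr2.le, integral_rpow (Or.inl (by linarith))]
    rw [Real.zero_rpow (by linarith), ← Real.rpow_natCast, ← Real.rpow_mul hr0.le]
    rw [show ((2:ℕ):ℝ) * (α/2-1+1) = α by push_cast; ring]
    rw [show α/2-1+1 = α/2 by ring]
    field_simp; ring
  have e2 : ‖∫ τ in Ioi (r^2), (ww l 2 τ • T2 g τ t x - ww l 2 τ • T2 g τ t y)‖ ≤ 2 * A_ d α 3 / (1-α) * K * r^α := by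
    refine (norm_integral_le_of_norm_le ((integrableOn_Ioi_rpow_of_lt (a := (α-3)/2) (by linarith) hr2).const_mul (A_ d α 3 * K * r)) ((ae_restrict_iff' measurableSet_Ioi).2
      (ae_of_all _ fun τ hτ => s2 τ (hr2.trans hτ)))).trans_eq ?_
    rw [integral_const_mul, integral_Ioi_rpow_of_lt (by linarith) hr2]
    rw [← Real.rpow_natCast, ← Real.rpow_mul hr0.le]
    rw [show ((2:ℕ):ℝ) * ((α-3)/2+1) = α - 1 by push_cast; ring, Real.rpow_sub_one hr0.ne']
    have : (1:ℝ) - α ≠ 0 := by linarith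
    have : (α-3)/2+1 ≠ 0 := by linarith
    rw [show (α-3)/2+1 = -(1-α)/2 by ring]
    field_simp
  refine (norm_add_le _ _).trans ((add_le_add e1 e2).trans_eq ?_)
  ring

/-- all estimates of the heat potential -/
lemma U_est (d : ℕ) (hα : α ∈ Ioo (0:ℝ) 1) : ∃ C : ℝ, 1 ≤ C ∧ ∀ l K : ℝ, 1 ≤ l → ∀ g : ℝ → Euc d → ℝ, Nn α K g →
    Nn α (C * l^(-(α/2)) * K) (U0 l g) ∧ Nn α (C * l^(-(α/2)) * K) (U1 l g) ∧ Nn α (C * K) (U2 l g) ∧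
    ∀ t x, ‖U2 l g t x‖ ≤ C * l^(-(α/2)) * K := by
  have hA := fun k => A_nonneg (d := d) α k
  set G1 := Real.Gamma (1+(α-(1:ℕ))/2)
  set G2 := Real.Gamma (1+(α-(2:ℕ))/2)
  have hG1 : 0 ≤ G1 := (Real.Gamma_pos_of_pos (by have := hα.1; norm_num; linarith)).le
  have hG2 : 0 ≤ G2 := (Real.Gamma_pos_of_pos (by have := hα.1; norm_num; linarith)).le
  have h1α : (0:ℝ) < 1 - α := by have := hα.2; linarith
  have hα0 := hα.1
  set B := (4 * A_ d α 2 / α + 2 * A_ d α 3 / (1-α)) with hB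
  have hB0 : 0 ≤ B := by have := hA 2; have := hA 3; positivity
  have h1 := mul_nonneg (hA 1) hG1
  have h2 := mul_nonneg (hA 2) hG2
  refine ⟨3 + 2 * (A_ d α 1 * G1) + 2 * (A_ d α 2 * G2) + B, by linarith, fun l K hl g hg => ?_⟩
  set C := 3 + 2 * (A_ d α 1 * G1) + 2 * (A_ d α 2 * G2) + B with hC
  have hl0 : 0 < l := by linarith
  have hK := hg.nonneg
  set m := l^(-(α/2)) with hm
  have hm0 : 0 ≤ m := by positivity
  have pw : ∀ e : ℝ, α/2 ≤ e → (1/l)^e ≤ m := fun e he => by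
    rw [one_div, Real.inv_rpow hl0.le, ← Real.rpow_neg hl0.le]
    exact Real.rpow_le_rpow_of_exponent_le hl (by linarith)
  have hm1 : m ≤ 1 := Real.rpow_le_one_of_one_le_of_nonpos hl (by linarith)
  have mK : 0 ≤ m * K := by positivity
  have J := U_jet hα hl0 hg
  have v0 : ∀ t x, ‖U0 l g t x‖ ≤ m * K := fun t x => (U0_b hl0 hg t x).trans (by
    rw [Real.Gamma_one, mul_one, mul_comm]; gcongr; exact pw _ (by linarith [hα.2]))
  have v1 : ∀ t x, ‖U1 l g t x‖ ≤ A_ d α 1 * G1 * (m * K) := fun t x => (U1_b hα hl0 hg t x).trans (by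
    have := pw (1+(α-(1:ℕ))/2) (by norm_num; linarith)
    calc A_ d α 1 * K * ((1/l)^(1+(α-(1:ℕ))/2) * G1) ≤ A_ d α 1 * K * (m * G1) := by
          have := hA 1; gcongr
      _ = _ := by ring)
  have v2 : ∀ t x, ‖U2 l g t x‖ ≤ A_ d α 2 * G2 * (m * K) := fun t x => (U2_b hα hl0 hg t x).trans (by
    have := pw (1+(α-(2:ℕ))/2) (by norm_num; linarith)
    calc A_ d α 2 * K * ((1/l)^(1+(α-(2:ℕ))/2) * G2) ≤ A_ d α 2 * K * (m * G2) := by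
          have := hA 2; gcongr
      _ = _ := by ring)
  refine ⟨⟨U0_c hl0 hg, fun t x => (v0 t x).trans ?_, fun t x y => (hol_interp hα (J.h1 t) (v0 t) (v1 t) x y).trans ?_⟩,
    ⟨U1_c hα hl0 hg, fun t x => (v1 t x).trans ?_, fun t x y => (hol_interp hα (J.h2 t) (v1 t) (v2 t) x y).trans ?_⟩,
    ⟨U2_c hα hl0 hg, fun t x => (v2 t x).trans ?_, fun t x y => (U2_hol hα hl0 hg t x y).trans ?_⟩,
    fun t x => (v2 t x).trans ?_⟩
  · rw [mul_assoc C]; exact le_mul_of_one_le_left mK (by linarith)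
  · rw [mul_assoc C]; refine mul_le_mul_of_nonneg_right ?_ (by positivity)
    nlinarith
  · rw [mul_assoc C]; exact mul_le_mul_of_nonneg_right (by linarith) mK
  · rw [mul_assoc C]; refine mul_le_mul_of_nonneg_right ?_ (by positivity)
    nlinarith
  · exact mul_le_mul (by linarith) (mul_le_of_le_one_left hK hm1) mK (by linarith)
  · refine mul_le_mul_of_nonneg_right (mul_le_mul_of_nonneg_right ?_ hK) (by positivity)
    linarith
  · rw [mul_assoc C]; exact mul_le_mul_of_nonneg_right (by linarith) mK

end pot2

section pot3
variable {d : ℕ}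

abbrev ee (i : Fin d) : Euc d := EuclideanSpace.single i 1

lemma euc_sum (z : Euc d) : z = ∑ i, z i • ee i := by
  ext j; simp [Pi.single_apply]

lemma gam_cov (i j : Fin d) : ∫ z, z i * z j ∂(gam d) = if i = j then 1 else 0 := by
  have h := covarianceBilin_apply (μ := gam d) (IsGaussian.memLp_id (gam d) 2 (by simp)) (ee i) (ee j)
  have e : ∫ z, id z ∂(gam d) = 0 := integral_id_stdGaussian
  rw [covarianceBilin_stdGaussian, e] at h
  simp only [sub_zero, ee, EuclideanSpace.inner_single_left, map_one, one_mul] at h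
  rw [← h]
  change inner ℝ (ee i) (ee j) = _
  simp [ee, EuclideanSpace.inner_single_left, Pi.single_apply]

lemma sq_le_mom (z : Euc d) : ‖z‖^2 ≤ (1+‖z‖)^3 := by
  have := norm_nonneg z
  nlinarith [mul_nonneg this this, mul_nonneg (mul_nonneg this this) this]

lemma gam_tr (H : Euc d →L[ℝ] Euc d →L[ℝ] ℝ) : ∫ z, H z z ∂(gam d) = ∑ i, H (ee i) (ee i) := by
  have e : ∀ z : Euc d, H z z = ∑ i, ∑ j, (z i * z j) * H (ee i) (ee j) := fun z => by
    conv_lhs => rw [euc_sum z]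
    simp only [map_sum, map_smul, sum_apply, smul_apply, smul_eq_mul, Finset.mul_sum, mul_assoc]
    rw [Finset.sum_comm]
    refine Finset.sum_congr rfl fun i _ => Finset.sum_congr rfl fun j _ => ?_
    ring
  have hi : ∀ i j : Fin d, Integrable (fun z : Euc d => (z i * z j) * H (ee i) (ee j)) (gam d) := fun i j => by
    refine Integrable.mul_const ((mom_int 3).mono' (Continuous.aestronglyMeasurable (by fun_prop)) (ae_of_all _ fun z => ?_)) _
    rw [norm_mul]
    refine le_trans ?_ (sq_le_mom z)
    rw [sq]
    exact mul_le_mul (PiLp.norm_apply_le z i) (PiLp.norm_apply_le z j) (norm_nonneg _) (norm_nonneg _)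
  simp_rw [e]
  rw [integral_finsetSum _ fun i _ => integrable_finsetSum _ fun j _ => hi i j]
  refine Finset.sum_congr rfl fun i _ => ?_
  rw [integral_finsetSum _ fun j _ => hi i j]
  simp_rw [integral_mul_const, gam_cov]
  simp

lemma taylor1 {F : Type*} [NormedAddCommGroup F] [NormedSpace ℝ F] {f : Euc d → F} {f' : Euc d → Euc d →L[ℝ] F} {α K : ℝ}
    (hα : 0 ≤ α) (hK : 0 ≤ K)
    (h1 : ∀ x, HasFDerivAt f (f' x) x) (hH : ∀ x y, ‖f' x - f' y‖ ≤ K * ‖x-y‖^α) (x z : Euc d) :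
    ‖f (x+z) - f x - f' x z‖ ≤ K * ‖z‖^α * ‖z‖ := by
  have := Convex.norm_image_sub_le_of_norm_hasFDerivWithin_le' (s := Metric.closedBall x ‖z‖) (f := f) (f' := f')
    (φ := f' x) (C := K * ‖z‖^α)
    (fun y _ => (h1 y).hasFDerivWithinAt) (fun y hy => (hH y x).trans (by
      rw [mem_closedBall_iff_norm] at hy; gcongr)) (convex_closedBall x ‖z‖)
    (Metric.mem_closedBall_self (norm_nonneg _)) (y := x + z) (by simp)
  simpa using this

lemma taylor2 {f : Euc d → ℝ} {p : Euc d → Euc d →L[ℝ] ℝ} {H : Euc d → Euc d →L[ℝ] Euc d →L[ℝ] ℝ} {α K : ℝ}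
    (hα : 0 ≤ α) (hK : 0 ≤ K)
    (h1 : ∀ x, HasFDerivAt f (p x) x) (h2 : ∀ x, HasFDerivAt p (H x) x)
    (hH : ∀ x y, ‖H x - H y‖ ≤ K * ‖x-y‖^α) (x z : Euc d) :
    ‖f (x+z) - f x - p x z - (1/2) * H x z z‖ ≤ K * (‖z‖^2 * ‖z‖^α) := by
  have hd : ∀ s : ℝ, HasDerivAt (fun s : ℝ => f (x + s • z) - s * p x z - s^2/2 * H x z z)
      (p (x + s • z) z - p x z - s * H x z z) s := fun s => by
    have e1 : HasDerivAt (fun s : ℝ => x + s • z) z s := by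
      simpa using ((hasDerivAt_id s).smul_const z).const_add x
    have e2 := (h1 (x + s • z)).comp_hasDerivAt s e1
    have e3 := ((hasDerivAt_id s).mul_const (p x z))
    have e4 := (((hasDerivAt_id s).pow 2).div_const 2).mul_const (H x z z)
    have := (e2.sub e3).sub e4
    refine this.congr_deriv ?_
    simp
  have := norm_image_sub_le_of_norm_deriv_le_segment_01' (C := K * (‖z‖^2 * ‖z‖^α))
    (fun s _ => (hd s).hasDerivWithinAt) (fun s hs => ?_)
  · simp only [one_smul, one_mul, zero_smul, zero_mul, add_zero] at this
    refine le_trans (le_of_eq ?_) this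
    congr 1; ring
  · have h := taylor1 hα hK h2 hH x (s • z)
    have hs1 : ‖s • z‖ ≤ ‖z‖ := by
      rw [norm_smul, Real.norm_of_nonneg hs.1]; exact mul_le_of_le_one_left (norm_nonneg _) hs.2.le
    have e : p (x + s • z) z - p x z - s * H x z z = (p (x + s • z) - p x - H x (s • z)) z := by simp
    rw [e]
    refine ((p (x + s • z) - p x - H x (s • z)).le_opNorm z).trans ?_
    calc _ ≤ (K * ‖s • z‖^α * ‖s • z‖) * ‖z‖ := by gcongr
      _ ≤ (K * ‖z‖^α * ‖z‖) * ‖z‖ := by gcongr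
      _ = _ := by ring

lemma PP_asym {f : Euc d → ℝ} {p : Euc d → Euc d →L[ℝ] ℝ} {H : Euc d → Euc d →L[ℝ] Euc d →L[ℝ] ℝ} {α K M a : ℝ}
    (hα : α ∈ Ioo (0:ℝ) 1) (hK : 0 ≤ K) (ha : 0 ≤ a) (hb : ∀ x, ‖f x‖ ≤ M)
    (h1 : ∀ x, HasFDerivAt f (p x) x) (h2 : ∀ x, HasFDerivAt p (H x) x)
    (hH : ∀ x y, ‖H x - H y‖ ≤ K * ‖x-y‖^α) (x : Euc d) :
    ‖PP a f x - f x - a^2/2 * ∑ i, H x (ee i) (ee i)‖ ≤ K * a^2 * a^α * Cg d := by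
  have hf : Continuous f := continuous_iff_continuousAt.2 fun y => (h1 y).continuousAt
  have i1 : Integrable (fun z => f (x + a • z)) (gam d) :=
    (integrable_const M).mono' (hf.comp (by fun_prop)).aestronglyMeasurable (ae_of_all _ fun z => hb _)
  have i2 : Integrable (fun z : Euc d => a * p x z) (gam d) :=
    ((p x).integrable_comp IsGaussian.integrable_id).const_mul a
  have i3 : Integrable (fun z : Euc d => a^2/2 * H x z z) (gam d) := by
    refine (((mom_int 3).const_mul ‖H x‖).mono' (Continuous.aestronglyMeasurable (by fun_prop)) (ae_of_all _ fun z => ?_)).const_mul _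
    refine ((H x).le_opNorm₂ z z).trans ?_
    rw [mul_assoc, ← sq]; exact mul_le_mul_of_nonneg_left (sq_le_mom z) (norm_nonneg _)
  have e : PP a f x - f x - a^2/2 * ∑ i, H x (ee i) (ee i)
      = ∫ z, (f (x + a • z) - f x - a * p x z - a^2/2 * H x z z) ∂(gam d) := by
    rw [integral_sub _ i3, integral_sub _ i2, integral_sub i1 (integrable_const _), integral_const_mul,
      integral_const_mul, gam_tr, PP]
    · have : ∫ z, p x z ∂(gam d) = 0 := integral_strongDual_stdGaussian (p x)
      rw [this]; simp
    · exact i1.sub (integrable_const _)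
    · exact (i1.sub (integrable_const _)).sub i2
  rw [e]
  refine norm_int_le fun z => ?_
  have h := taylor2 hα.1.le hK h1 h2 hH x (a • z)
  simp only [map_smul, smul_apply, smul_eq_mul, norm_smul, Real.norm_of_nonneg ha] at h
  have hz := norm_nonneg z
  have h3 : ‖z‖^2 * ‖z‖^α ≤ (1+‖z‖)^3 := by
    have : ‖z‖^α ≤ (1+‖z‖)^(1:ℝ) := (Real.rpow_le_rpow hz (by linarith) hα.1.le).trans
      (Real.rpow_le_rpow_of_exponent_le (by linarith) hα.2.le)
    rw [Real.rpow_one] at this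
    calc _ ≤ (1+‖z‖)^2 * (1+‖z‖) := by gcongr; linarith
      _ = _ := by ring
  rw [Real.mul_rpow ha hz] at h
  rw [show f (x + a • z) - f x - a * p x z - a^2/2 * H x z z = f (x + a • z) - f x - a * p x z - 1/2 * (a * (a * H x z z)) by ring]
  refine h.trans ?_
  calc _ = K * a^2 * a^α * (‖z‖^2 * ‖z‖^α) := by ring
    _ ≤ _ := by gcongr

end pot3

section pot4
variable {d : ℕ} {g : ℝ → Euc d → ℝ} {α K l : ℝ}

lemma T0_eq (hg : Nn α K g) {τ : ℝ} (hτ : 0 ≤ τ) (t : ℝ) : T0 g τ t = PP (Real.sqrt (2*τ)) (g (t-τ)) := by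
  have hc : cc τ^2 = 2*τ/3 := Real.sq_sqrt (by positivity)
  have h2 : Real.sqrt (2*τ)^2 = 2*τ := Real.sq_sqrt (by positivity)
  have h3 : Real.sqrt (4*τ/3)^2 = 4*τ/3 := Real.sq_sqrt (by positivity)
  rw [T0, PP_semi (c := Real.sqrt (4*τ/3)) (PPc (gc hg _) (hg.2.1 _)) (PP_bdd (hg.2.1 _)) (by rw [hc, h3]; ring),
    PP_semi (c := Real.sqrt (2*τ)) (gc hg _) (hg.2.1 _) (by rw [h3, hc, h2]; ring)]

lemma shift_Ioi (f : ℝ → ℝ) (h : ℝ) : ∫ τ in Ioi h, f τ = ∫ σ in Ioi (0:ℝ), f (σ + h) := by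
  rw [← integral_indicator measurableSet_Ioi, ← integral_indicator measurableSet_Ioi,
    ← integral_add_right_eq_self _ h]
  congr 1; ext σ
  by_cases hs : 0 < σ
  · rw [indicator_of_mem (by simpa using hs), indicator_of_mem (by simpa using hs)]
  · rw [indicator_of_notMem (by simpa using hs), indicator_of_notMem (by simpa using hs)]

lemma U0_semi (hl : 0 < l) (hg : Nn α K g) {h : ℝ} (hh : 0 ≤ h) (t : ℝ) (x : Euc d) :
    U0 l g (t+h) x = Real.exp (-(l*h)) * PP (Real.sqrt (2*h)) (U0 l g t) x
      + ∫ τ in (0:ℝ)..h, Real.exp (-(l*τ)) * T0 g τ (t+h) x := by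
  have hi := tau_int (T0_cont hg) (ww_meas l 0) (gam_int one_pos hl K).1 (b0 hg) (t+h) x
  simp only [ww, pow_zero, mul_one, smul_eq_mul] at hi
  have e0 : ∀ t x, U0 l g t x = ∫ τ in Ioi (0:ℝ), Real.exp (-(l*τ)) * T0 g τ t x := fun t x => by
    simp [U0, ww]
  rw [e0, ← Ioc_union_Ioi_eq_Ioi hh, setIntegral_union (Set.Ioc_disjoint_Ioi le_rfl) measurableSet_Ioi
    (hi.mono_set Ioc_subset_Ioi_self) (hi.mono_set (Ioi_subset_Ioi hh)), ← intervalIntegral.integral_of_le hh, add_comm,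
    shift_Ioi]
  congr 1
  rw [PP, ← integral_const_mul]
  simp_rw [e0, ← integral_const_mul]
  rw [integral_integral_swap]
  · refine setIntegral_congr_fun measurableSet_Ioi fun σ hσ => ?_
    have hσ : 0 < σ := hσ
    simp only [← mul_assoc, ← Real.exp_add]
    rw [integral_const_mul]
    congr 1
    · congr 1; ring
    rw [T0_eq hg (by positivity), show t + h - (σ+h) = t - σ by ring]
    rw [← PP_semi (a := Real.sqrt (2*h)) (b := Real.sqrt (2*σ)) (gc hg _) (hg.2.1 _), PP, T0_eq hg hσ.le]
    rw [Real.sq_sqrt (by positivity), Real.sq_sqrt (by positivity), Real.sq_sqrt (by positivity)]; ring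
  · have hc : Continuous (fun q : Euc d × ℝ => Real.exp (-(l*h)) * (Real.exp (-(l*q.2)) * T0 g q.2 t (x + Real.sqrt (2*h) • q.1))) := by
      have := (T0_cont hg).comp (by fun_prop : Continuous fun q : Euc d × ℝ => (((q.2, t), x + Real.sqrt (2*h) • q.1) : (ℝ × ℝ) × Euc d))
      exact continuous_const.mul ((by fun_prop : Continuous fun q : Euc d × ℝ => Real.exp (-(l*q.2))).mul this)
    have hG := (gam_int one_pos hl (Real.exp (-(l*h)) * K)).1.integrable
    refine (hG.comp_snd (gam d)).mono' hc.aestronglyMeasurable ?_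
    have : ∀ᵐ q ∂((gam d).prod (volume.restrict (Ioi (0:ℝ)))), q.2 ∈ Ioi (0:ℝ) :=
      Measure.quasiMeasurePreserving_snd.ae (ae_restrict_mem measurableSet_Ioi)
    filter_upwards [this] with q hq
    have := b0 (l := l) hg q.2 hq t (x + Real.sqrt (2*h) • q.1)
    simp only [ww, pow_zero, mul_one, smul_eq_mul] at this
    rw [Function.uncurry, norm_mul, Real.norm_of_nonneg (Real.exp_pos _).le, mul_assoc]
    exact mul_le_mul_of_nonneg_left this (Real.exp_pos _).le

lemma PP_zero (f : Euc d → ℝ) (x : Euc d) : PP 0 f x = f x := by simp [PP]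

lemma U0_right (hα : α ∈ Ioo (0:ℝ) 1) (hl : 0 < l) (hg : Nn α K g) {KH : ℝ}
    (hKH : ∀ t x y, ‖U2 l g t x - U2 l g t y‖ ≤ KH * ‖x-y‖^α) (hKH0 : 0 ≤ KH) (t : ℝ) (x : Euc d) :
    HasDerivWithinAt (fun t => U0 l g t x) (∑ i, U2 l g t x (ee i) (ee i) - l * U0 l g t x + g t x) (Ioi t) t := by
  have J := U_jet hα hl hg
  -- semigroup part
  have s1 : HasDerivWithinAt (fun h => PP (Real.sqrt (2*h)) (U0 l g t) x) (∑ i, U2 l g t x (ee i) (ee i)) (Ioi 0) 0 := by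
    rw [hasDerivWithinAt_iff_isLittleO]
    have hbig : (fun h : ℝ => PP (Real.sqrt (2*h)) (U0 l g t) x - PP (Real.sqrt (2*0)) (U0 l g t) x - (h - 0) • ∑ i, U2 l g t x (ee i) (ee i))
        =O[𝓝[>] 0] fun h : ℝ => h * Real.sqrt (2*h)^α := by
      refine Asymptotics.IsBigO.of_bound (KH * 2 * Cg d) ?_
      filter_upwards [self_mem_nhdsWithin] with h hh
      have hh : 0 < h := hh
      have := PP_asym hα hKH0 (Real.sqrt_nonneg (2*h)) (U0_b hl hg t) (J.h1 t) (J.h2 t) (hKH t) x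
      rw [Real.sq_sqrt (by positivity)] at this
      simp only [mul_zero, Real.sqrt_zero, PP_zero, sub_zero, smul_eq_mul]
      rw [show 2*h/2 = h by ring] at this
      refine this.trans_eq ?_
      rw [Real.norm_of_nonneg (by positivity)]; ring
    refine hbig.trans_isLittleO ?_
    have hz : Tendsto (fun h : ℝ => Real.sqrt (2*h)^α) (𝓝[>] 0) (𝓝 0) := by
      have : Continuous (fun h : ℝ => Real.sqrt (2*h)^α) := (by fun_prop : Continuous fun h : ℝ => Real.sqrt (2*h)).rpow_const (fun _ => Or.inr hα.1.le)
      have := (this.tendsto 0).mono_left (nhdsWithin_le_nhds (s := Ioi (0:ℝ)))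
      simpa [Real.zero_rpow hα.1.ne'] using this
    have := (Asymptotics.isBigO_refl (fun h : ℝ => h) (𝓝[>] 0)).mul_isLittleO ((Asymptotics.isLittleO_one_iff ℝ).2 hz)
    simpa using this
  -- source part
  have s2 : HasDerivWithinAt (fun h => ∫ τ in (0:ℝ)..h, Real.exp (-(l*τ)) * T0 g τ (t+h) x) (g t x) (Ioi 0) 0 := by
    rw [hasDerivWithinAt_iff_isLittleO, Asymptotics.isLittleO_iff]
    intro ε hε
    have hc : Continuous (fun q : ℝ × ℝ => Real.exp (-(l*q.1)) * T0 g q.1 (t+q.2) x) :=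
      (by fun_prop : Continuous fun q : ℝ × ℝ => Real.exp (-(l*q.1))).mul
        ((T0_cont hg).comp (by fun_prop : Continuous fun q : ℝ × ℝ => (((q.1, t+q.2), x) : (ℝ × ℝ) × Euc d)))
    obtain ⟨δ, hδ, hball⟩ := Metric.continuousAt_iff.1 (hc.continuousAt (x := (0,0))) ε hε
    filter_upwards [Ioo_mem_nhdsGT hδ] with h hh
    have e : T0 g 0 t x = g t x := by rw [T0_eq hg le_rfl]; simp [PP_zero]
    simp only [mul_zero, neg_zero, Real.exp_zero, one_mul, add_zero, e] at hball
    have hint : IntervalIntegrable (fun τ => Real.exp (-(l*τ)) * T0 g τ (t+h) x) volume 0 h :=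
      (hc.comp (by fun_prop : Continuous fun τ : ℝ => ((τ, h) : ℝ × ℝ))).intervalIntegrable _ _
    have e2 : ∫ τ in (0:ℝ)..h, Real.exp (-(l*τ)) * T0 g τ (t+h) x - g t x
       = (∫ τ in (0:ℝ)..h, Real.exp (-(l*τ)) * T0 g τ (t+h) x) - h * g t x := by
      rw [intervalIntegral.integral_sub hint (by simp)]; simp
    simp only [intervalIntegral.integral_same, sub_zero, smul_eq_mul]
    rw [← e2]
    refine (intervalIntegral.norm_integral_le_of_norm_le_const (C := ε) fun τ hτ => ?_).trans_eq (by simp)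
    rw [uIoc_of_le hh.1.le] at hτ
    have := hball (x := (τ, h)) (by
      rw [Prod.dist_eq, max_lt_iff]; simp only [Real.dist_eq, sub_zero]
      rw [abs_of_pos hτ.1, abs_of_pos hh.1]; exact ⟨hτ.2.trans_lt hh.2, hh.2⟩)
    rw [Real.dist_eq] at this; exact this.le
  have s3 : HasDerivWithinAt (fun h : ℝ => Real.exp (-(l*h))) (-l) (Ioi 0) 0 := by
    have := (((hasDerivAt_id (0:ℝ)).const_mul l).neg.exp).hasDerivWithinAt (s := Ioi 0)
    simpa using this
  have s4 := (s3.mul s1).add s2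
  have s5 : HasDerivWithinAt (fun h => U0 l g (t+h) x) (∑ i, U2 l g t x (ee i) (ee i) - l * U0 l g t x + g t x) (Ioi 0) 0 := by
    refine (s4.congr_of_eventuallyEq (f₁ := fun h => U0 l g (t+h) x) ?_ ?_).congr_deriv ?_
    · filter_upwards [self_mem_nhdsWithin] with h hh
      exact U0_semi hl hg (le_of_lt hh) t x
    · exact U0_semi hl hg le_rfl t x
    · simp [PP_zero]; ring
  rw [hasDerivWithinAt_iff_isLittleO] at s5 ⊢
  have hm : Tendsto (fun y : ℝ => y - t) (𝓝[>] t) (𝓝[>] 0) := by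
    refine tendsto_nhdsWithin_iff.2 ⟨?_, ?_⟩
    · have : Continuous (fun y : ℝ => y - t) := by fun_prop
      simpa using (this.tendsto t).mono_left (nhdsWithin_le_nhds (s := Ioi t))
    · filter_upwards [self_mem_nhdsWithin] with y hy
      simpa using hy
  have := s5.comp_tendsto hm
  simpa [Function.comp_def] using this

theorem M1 (d : ℕ) (hα : α ∈ Ioo (0:ℝ) 1) : ∃ C : ℝ, 1 ≤ C ∧ ∀ l K : ℝ, 1 ≤ l → ∀ g : ℝ → Euc d → ℝ, Nn α K g →
    ∃ u p H, Jet u p H ∧ Nn α (C * l^(-(α/2)) * K) u ∧ Nn α (C * l^(-(α/2)) * K) p ∧ Nn α (C * K) H ∧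
    (∀ t x, ‖H t x‖ ≤ C * l^(-(α/2)) * K) ∧
    ∀ t x, HasDerivAt (fun t => u t x) (∑ i, H t x (ee i) (ee i) - l * u t x + g t x) t := by
  obtain ⟨C, hC, h⟩ := U_est d hα
  refine ⟨C, hC, fun l K hl g hg => ?_⟩
  obtain ⟨h0, h1, h2, h3⟩ := h l K hl g hg
  have hl0 : 0 < l := by linarith
  refine ⟨U0 l g, U1 l g, U2 l g, U_jet hα hl0 hg, h0, h1, h2, h3, fun t x => ?_⟩
  set D := fun t => ∑ i, U2 l g t x (ee i) (ee i) - l * U0 l g t x + g t x with hD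
  have tc : Continuous fun t : ℝ => ((t, x) : ℝ × Euc d) := by fun_prop
  have c0 := h0.1.comp tc
  have c2 := h2.1.comp tc
  have cg := hg.1.comp tc
  have hDc : Continuous D := by
    refine ((continuous_finsetSum _ fun i _ => ?_).sub (c0.const_mul l)).add cg
    exact (c2.clm_apply continuous_const).clm_apply continuous_const
  have hr := fun t => U0_right hα hl0 hg h2.2.2 h2.nonneg t x
  have e : (fun t => U0 l g t x) = fun s => U0 l g t x + ∫ y in t..s, D y := by
    ext s
    rw [intervalIntegral.integral_eq_sub_of_hasDeriv_right c0.continuousOn (fun y _ => hr y) (hDc.intervalIntegrable _ _)]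
    simp
  rw [e]
  exact (intervalIntegral.integral_hasDerivAt_right (hDc.intervalIntegrable _ _)
    (hDc.stronglyMeasurableAtFilter _ _) hDc.continuousAt).const_add _

end pot4

section cst
variable {d : ℕ} {F G : Type*} [NormedAddCommGroup F] [NormedSpace ℝ F] [NormedAddCommGroup G] [NormedSpace ℝ G] {α K : ℝ}

def qtr (Q : Fin d → Fin d → ℝ) (H : Euc d →L[ℝ] Euc d →L[ℝ] ℝ) : ℝ := ∑ i, ∑ j, Q i j * H (ee i) (ee j)

lemma Nn.mono {g : ℝ → Euc d → F} {K' : ℝ} (h : Nn α K g) (hK : K ≤ K') : Nn α K' g :=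
  ⟨h.1, fun t x => (h.2.1 t x).trans hK, fun t x y => (h.2.2 t x y).trans (by gcongr)⟩

lemma Nn_comp {g : ℝ → Euc d → F} (hα : α ∈ Ioo (0:ℝ) 1) (h : Nn α K g) (S : Euc d →L[ℝ] Euc d) {s : ℝ} (hs : 1 ≤ s) (hS : ‖S‖ ≤ s) :
    Nn α (s * K) (fun t x => g t (S x)) := by
  have hK := h.nonneg
  refine ⟨h.1.comp (by fun_prop : Continuous fun z : ℝ × Euc d => (z.1, S z.2)), fun t x => (h.2.1 _ _).trans (le_mul_of_one_le_left hK hs), fun t x y => (h.2.2 _ _ _).trans ?_⟩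
  have h1 : ‖S x - S y‖ ≤ s * ‖x - y‖ := by
    rw [← map_sub]; exact (S.le_opNorm _).trans (by gcongr)
  have hα0 := hα.1.le
  calc K * ‖S x - S y‖^α ≤ K * (s * ‖x-y‖)^α := by gcongr
    _ = K * (s^α * ‖x-y‖^α) := by rw [Real.mul_rpow (by linarith) (norm_nonneg _)]
    _ ≤ K * (s * ‖x-y‖^α) := by gcongr; exact Real.rpow_le_self_of_one_le hs hα.2.le
    _ = _ := by ring

lemma Nn_map {g : ℝ → Euc d → F} (h : Nn α K g) (L : F →L[ℝ] G) {s : ℝ} (hL : ∀ v, ‖L v‖ ≤ s * ‖v‖) (hs : 0 ≤ s) :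
    Nn α (s * K) (fun t x => L (g t x)) := by
  refine ⟨L.continuous.comp h.1, fun t x => (hL _).trans (by have := h.2.1 t x; gcongr), fun t x y => ?_⟩
  rw [← map_sub, mul_assoc]
  exact (hL _).trans (by have := h.2.2 t x y; gcongr)

open scoped MatrixOrder in
lemma factor {Q : Fin d → Fin d → ℝ} (hs : ∀ i j, Q i j = Q j i) {ν Λ : ℝ} (hν : 0 < ν)
    (hQ : ∀ ξ : Euc d, ν * ‖ξ‖^2 ≤ ∑ i, ∑ j, Q i j * ξ i * ξ j) (hΛ : ∀ ξ : Euc d, ∑ i, ∑ j, Q i j * ξ i * ξ j ≤ Λ * ‖ξ‖^2) :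
    ∃ S R : Euc d →L[ℝ] Euc d, (∀ x, S (R x) = x) ∧ ‖S‖ ≤ Real.sqrt Λ ∧ ‖R‖ ≤ (Real.sqrt ν)⁻¹ ∧
      ∀ H : Euc d →L[ℝ] Euc d →L[ℝ] ℝ, ∑ i, ∑ j, Q i j * H (R (ee i)) (R (ee j)) = ∑ k, H (ee k) (ee k) := by
  have hps : (Matrix.of Q).PosSemidef := by
    refine Matrix.PosSemidef.of_dotProduct_mulVec_nonneg (by ext i j; simp [Matrix.conjTranspose_apply, hs]) fun x => ?_
    have := hQ (WithLp.toLp 2 x)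
    refine (le_trans (by positivity) this).trans_eq ?_
    simp only [dotProduct, Matrix.mulVec, Matrix.of_apply, Pi.star_apply, star_trivial, Finset.mul_sum]
    refine Finset.sum_congr rfl fun i _ => Finset.sum_congr rfl fun j _ => by ring
  obtain ⟨M, hM⟩ := CStarAlgebra.nonneg_iff_eq_star_mul_self.mp hps.nonneg
  have hM' : ∀ i j, Q i j = ∑ k, M k i * M k j := fun i j => by
    have := congrFun (congrFun hM i) j
    simpa [Matrix.mul_apply, Matrix.star_eq_conjTranspose] using this
  set B : Euc d →L[ℝ] Euc d := Matrix.toEuclideanCLM (𝕜 := ℝ) M with hB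
  have hBa : ∀ (ξ : Euc d) k, B ξ k = ∑ i, M k i * ξ i := fun ξ k => rfl
  have hn : ∀ ξ, ‖B ξ‖^2 = ∑ i, ∑ j, Q i j * ξ i * ξ j := fun ξ => by
    rw [EuclideanSpace.norm_sq_eq]
    simp only [hBa, Real.norm_eq_abs, sq_abs, hM', Finset.sum_mul]
    simp only [sq, Finset.sum_mul, Finset.mul_sum]
    rw [Finset.sum_comm]
    refine Finset.sum_congr rfl fun i _ => ?_
    rw [Finset.sum_comm]
    refine Finset.sum_congr rfl fun j _ => Finset.sum_congr rfl fun k _ => by ring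
  have hlow : ∀ ξ, Real.sqrt ν * ‖ξ‖ ≤ ‖B ξ‖ := fun ξ => by
    refine abs_le_of_sq_le_sq' ?_ (norm_nonneg _) |>.2
    rw [mul_pow, Real.sq_sqrt hν.le, hn]; exact hQ ξ
  have hsν : 0 < Real.sqrt ν := Real.sqrt_pos.2 hν
  have hup : ‖B‖ ≤ Real.sqrt Λ := by
    refine B.opNorm_le_bound (Real.sqrt_nonneg _) fun ξ => ?_
    by_cases hξ : ξ = 0
    · simp [hξ]
    have hΛ0 : 0 ≤ Λ := by
      have h1 := (hQ ξ).trans (hΛ ξ)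
      have h2 : 0 < ‖ξ‖^2 := by have := norm_pos_iff.2 hξ; positivity
      exact hν.le.trans (le_of_mul_le_mul_right h1 h2)
    refine abs_le_of_sq_le_sq' ?_ (by positivity) |>.2
    rw [mul_pow, Real.sq_sqrt hΛ0, hn]; exact hΛ ξ
  have hinj : Function.Injective B := by
    refine (injective_iff_map_eq_zero B).2 fun ξ hξ => ?_
    have := hlow ξ
    rw [hξ, norm_zero] at this
    exact norm_le_zero_iff.1 (by nlinarith [norm_nonneg ξ])
  let e : Euc d ≃L[ℝ] Euc d := (LinearEquiv.ofInjectiveEndo (B : Euc d →ₗ[ℝ] Euc d) hinj).toContinuousLinearEquiv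
  have he : ∀ x, B (e.symm x) = x := fun x => e.apply_symm_apply x
  set T : Euc d →L[ℝ] Euc d := e.symm.toContinuousLinearMap with hT
  refine ⟨B.adjoint, T.adjoint, fun x => ?_, by simpa using hup, ?_, fun H => ?_⟩
  · refine ext_inner_left ℝ fun y => ?_
    rw [ContinuousLinearMap.adjoint_inner_right, ContinuousLinearMap.adjoint_inner_right]
    have : T (B y) = y := e.symm_apply_apply y
    rw [this]
  · rw [LinearIsometryEquiv.norm_map]
    refine T.opNorm_le_bound (by positivity) fun x => ?_
    have := hlow (T x)
    rw [hT] at this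
    erw [he x] at this
    rw [← div_eq_inv_mul, le_div_iff₀ hsν, mul_comm]; exact this
  · have hk : ∀ k, ∑ i, M k i • T.adjoint (ee i) = ee k := fun k => by
      refine ext_inner_left ℝ fun y => ?_
      rw [inner_sum]
      simp only [inner_smul_right, ContinuousLinearMap.adjoint_inner_right]
      have := congrArg (fun v : Euc d => v k) (he y)
      simp only [hBa] at this
      simp only [ee, EuclideanSpace.inner_single_right, map_one, one_mul, conj_trivial]
      exact this
    rw [← Finset.sum_congr rfl fun k _ => congrArg₂ (fun a b => H a b) (hk k) (hk k)]
    simp only [map_sum, map_smul, sum_apply, smul_apply, smul_eq_mul, Finset.mul_sum, hM', Finset.sum_mul]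
    rw [Finset.sum_congr rfl fun i _ => Finset.sum_comm, Finset.sum_comm]
    refine Finset.sum_congr rfl fun k _ => ?_
    rw [Finset.sum_comm]
    refine Finset.sum_congr rfl fun j _ => Finset.sum_congr rfl fun i _ => by ring

theorem M2 (d : ℕ) (hα : α ∈ Ioo (0:ℝ) 1) {ν : ℝ} (hν : 0 < ν) (Λ : ℝ) : ∃ C : ℝ, 1 ≤ C ∧ ∀ Q : Fin d → Fin d → ℝ,
    (∀ i j, Q i j = Q j i) → (∀ ξ : Euc d, ν * ‖ξ‖^2 ≤ ∑ i, ∑ j, Q i j * ξ i * ξ j) →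
    (∀ ξ : Euc d, ∑ i, ∑ j, Q i j * ξ i * ξ j ≤ Λ * ‖ξ‖^2) →
    ∀ l K : ℝ, 1 ≤ l → ∀ g : ℝ → Euc d → ℝ, Nn α K g →
    ∃ u p H, Jet u p H ∧ Nn α (C * l^(-(α/2)) * K) u ∧ Nn α (C * l^(-(α/2)) * K) p ∧ Nn α (C * K) H ∧
    (∀ t x, ‖H t x‖ ≤ C * l^(-(α/2)) * K) ∧
    ∀ t x, HasDerivAt (fun t => u t x) (qtr Q (H t x) - l * u t x + g t x) t := by
  obtain ⟨C, hC, h⟩ := M1 d hα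
  set s := 1 + Real.sqrt Λ + (Real.sqrt ν)⁻¹ with hs
  have hs1 : 1 ≤ s := by have := Real.sqrt_nonneg Λ; have : 0 ≤ (Real.sqrt ν)⁻¹ := by positivity
                         linarith
  refine ⟨C * s^4, one_le_mul_of_one_le_of_one_le hC (one_le_pow₀ hs1), fun Q hQs hQ1 hQ2 l K hl g hg => ?_⟩
  obtain ⟨S, R, hSR, hS, hR, hH⟩ := factor hQs hν hQ1 hQ2
  have hS' : ‖S‖ ≤ s := by have : 0 ≤ (Real.sqrt ν)⁻¹ := by positivity
                           linarith
  have hR' : ‖R‖ ≤ s := by have := Real.sqrt_nonneg Λ; linarith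
  obtain ⟨u, p, H, J, hu, hp, hHH, hHb, ht⟩ := h l (s*K) hl _ (Nn_comp hα hg S hs1 hS')
  have hs0 : 0 ≤ s := by linarith
  have hl0 : 0 < l := by linarith
  have hK := hg.nonneg
  have hm : 0 ≤ l^(-(α/2)) := by positivity
  let P1 : (Euc d →L[ℝ] ℝ) →L[ℝ] (Euc d →L[ℝ] ℝ) := ContinuousLinearMap.precomp ℝ R
  let P2 : (Euc d →L[ℝ] Euc d →L[ℝ] ℝ) →L[ℝ] (Euc d →L[ℝ] Euc d →L[ℝ] ℝ) :=
    (ContinuousLinearMap.postcomp (Euc d) P1).comp (ContinuousLinearMap.precomp (Euc d →L[ℝ] ℝ) R)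
  have hP1 : ∀ v, ‖P1 v‖ ≤ s * ‖v‖ := fun v => by
    refine (ContinuousLinearMap.opNorm_comp_le v R).trans ?_
    rw [mul_comm]; gcongr
  have hP2 : ∀ v, ‖P2 v‖ ≤ s^2 * ‖v‖ := fun v => by
    refine ContinuousLinearMap.opNorm_le_bound _ (by positivity) fun y => ?_
    refine (hP1 (v (R y))).trans ?_
    calc s * ‖v (R y)‖ ≤ s * (‖v‖ * (s * ‖y‖)) := by
          gcongr; exact (v.le_opNorm _).trans (by gcongr; exact (R.le_opNorm _).trans (by gcongr))
      _ = _ := by ring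
  have w1 : s ≤ s^2 := le_self_pow₀ hs1 (by norm_num)
  have w2 : s^2 ≤ s^3 := by gcongr; norm_num
  have w3 : s^3 ≤ s^4 := by gcongr; norm_num
  have m1 : 0 ≤ C * l^(-(α/2)) * K := by positivity
  refine ⟨fun t x => u t (R x), fun t x => P1 (p t (R x)), fun t x => P2 (H t (R x)), ⟨fun t x => ?_, fun t x => ?_⟩,
    (Nn_comp hα hu R hs1 hR').mono ?_, (Nn_map (Nn_comp hα hp R hs1 hR') P1 hP1 hs0).mono ?_,
    (Nn_map (Nn_comp hα hHH R hs1 hR') P2 hP2 (by positivity)).mono ?_, fun t x => (hP2 _).trans ?_, fun t x => ?_⟩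
  · exact (J.h1 t (R x)).comp x R.hasFDerivAt
  · exact P1.hasFDerivAt.comp x ((J.h2 t (R x)).comp x R.hasFDerivAt)
  · calc s * (C * l^(-(α/2)) * (s*K)) = s^2 * (C * l^(-(α/2)) * K) := by ring
      _ ≤ s^4 * (C * l^(-(α/2)) * K) := by gcongr 1; linarith
      _ = _ := by ring
  · calc s * (s * (C * l^(-(α/2)) * (s*K))) = s^3 * (C * l^(-(α/2)) * K) := by ring
      _ ≤ s^4 * (C * l^(-(α/2)) * K) := by gcongr 1
      _ = _ := by ring
  · apply le_of_eq; ring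
  · calc s^2 * ‖H t (R x)‖ ≤ s^2 * (C * l^(-(α/2)) * (s*K)) := by gcongr; exact hHb _ _
      _ = s^3 * (C * l^(-(α/2)) * K) := by ring
      _ ≤ s^4 * (C * l^(-(α/2)) * K) := by gcongr 1
      _ = _ := by ring
  · refine (ht t (R x)).congr_deriv ?_
    rw [hSR, ← hH]; rfl

end cst

section alg
variable {d : ℕ} {F G W : Type*} [NormedAddCommGroup F] [NormedSpace ℝ F] [NormedAddCommGroup G] [NormedSpace ℝ G]
  [NormedAddCommGroup W] [NormedSpace ℝ W] {α K L : ℝ}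

abbrev Bil (d : ℕ) := Euc d →L[ℝ] Euc d →L[ℝ] ℝ
abbrev Lin (d : ℕ) := Euc d →L[ℝ] ℝ

lemma Nn.add {g h : ℝ → Euc d → F} (hg : Nn α K g) (hh : Nn α L h) : Nn α (K + L) (fun t x => g t x + h t x) := by
  refine ⟨hg.1.add hh.1, fun t x => (norm_add_le _ _).trans (add_le_add (hg.2.1 _ _) (hh.2.1 _ _)), fun t x y => ?_⟩
  rw [add_sub_add_comm, add_mul]
  exact (norm_add_le _ _).trans (add_le_add (hg.2.2 _ _ _) (hh.2.2 _ _ _))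

lemma Nn.neg {g : ℝ → Euc d → F} (hg : Nn α K g) : Nn α K (fun t x => - g t x) := by
  refine ⟨hg.1.neg, fun t x => (norm_neg _).trans_le (hg.2.1 _ _), fun t x y => ?_⟩
  rw [← neg_sub', norm_neg]; exact hg.2.2 _ _ _

lemma Nn.sub {g h : ℝ → Euc d → F} (hg : Nn α K g) (hh : Nn α L h) : Nn α (K + L) (fun t x => g t x - h t x) := by
  simpa only [sub_eq_add_neg] using hg.add hh.neg

lemma Nn.sum {ι : Type*} (s : Finset ι) {k : ι → ℝ} {g : ι → ℝ → Euc d → F} (hg : ∀ i ∈ s, Nn α (k i) (g i)) :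
    Nn α (∑ i ∈ s, k i) (fun t x => ∑ i ∈ s, g i t x) := by
  refine ⟨continuous_finsetSum _ fun i hi => (hg i hi).1, fun t x => norm_sum_le_of_le _ fun i hi => (hg i hi).2.1 _ _, fun t x y => ?_⟩
  rw [← Finset.sum_sub_distrib, Finset.sum_mul]
  exact norm_sum_le_of_le _ fun i hi => (hg i hi).2.2 _ _ _

lemma Nn.const (hα : 0 < α) (v : F) : Nn α ‖v‖ (fun (_:ℝ) (_:Euc d) => v) :=
  ⟨continuous_const, fun _ _ => le_rfl, fun _ x y => by simp; positivity⟩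

lemma Nn.const_mul {g : ℝ → Euc d → F} (hg : Nn α K g) (r : ℝ) (hr : 0 ≤ r) : Nn α (r * K) (fun t x => r • g t x) := by
  refine ⟨hg.1.const_smul r, fun t x => ?_, fun t x y => ?_⟩
  · rw [norm_smul, Real.norm_of_nonneg hr]; have := hg.2.1 t x; gcongr
  · rw [← smul_sub, norm_smul, Real.norm_of_nonneg hr, mul_assoc]; have := hg.2.2 t x y; gcongr

/-- bilinear products -/
lemma Nn.bil (B : F →L[ℝ] G →L[ℝ] W) (hB : ∀ a b, ‖B a b‖ ≤ ‖a‖ * ‖b‖) {g : ℝ → Euc d → F} {h : ℝ → Euc d → G}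
    (hg : Nn α K g) (hh : Nn α L h) : Nn α (2 * K * L) (fun t x => B (g t x) (h t x)) := by
  have hK := hg.nonneg
  have hL := hh.nonneg
  refine ⟨(B.continuous.comp hg.1).clm_apply hh.1, fun t x => (hB _ _).trans ?_, fun t x y => ?_⟩
  · calc _ ≤ K * L := by have := hg.2.1 t x; have := hh.2.1 t x; gcongr
      _ ≤ _ := by nlinarith [mul_nonneg hK hL]
  · have e : B (g t x) (h t x) - B (g t y) (h t y) = B (g t x) (h t x - h t y) + B (g t x - g t y) (h t y) := by
      simp only [map_sub, sub_apply]; abel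
    rw [e]
    refine (norm_add_le _ _).trans ((add_le_add (hB _ _) (hB _ _)).trans ?_)
    have h1 := hg.2.1 t x
    have h2 := hh.2.2 t x y
    have h3 := hg.2.2 t x y
    have h4 := hh.2.1 t y
    calc _ ≤ K * (L * ‖x-y‖^α) + (K * ‖x-y‖^α) * L := by gcongr
      _ = _ := by ring

lemma Nn.app {g : ℝ → Euc d → F →L[ℝ] G} {h : ℝ → Euc d → F} (hg : Nn α K g) (hh : Nn α L h) :
    Nn α (2 * K * L) (fun t x => g t x (h t x)) :=
  Nn.bil (ContinuousLinearMap.id ℝ (F →L[ℝ] G)) (fun a b => a.le_opNorm b) hg hh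

lemma Nn.smul {g : ℝ → Euc d → ℝ} {h : ℝ → Euc d → F} (hg : Nn α K g) (hh : Nn α L h) :
    Nn α (2 * K * L) (fun t x => g t x • h t x) :=
  Nn.bil (ContinuousLinearMap.lsmul ℝ ℝ) (fun a b => by simp [norm_smul]) hg hh

lemma Nn.mul {g h : ℝ → Euc d → ℝ} (hg : Nn α K g) (hh : Nn α L h) :
    Nn α (2 * K * L) (fun t x => g t x * h t x) := hg.smul hh

/-- tensor product of two covectors -/
def tens (d : ℕ) : Lin d →L[ℝ] Lin d →L[ℝ] Bil d := ContinuousLinearMap.smulRightL ℝ (Euc d) (Lin d)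

lemma tens_apply (p q : Lin d) (x y : Euc d) : tens d p q x y = p x * q y := rfl

lemma tens_le (a b : Lin d) : ‖tens d a b‖ ≤ ‖a‖ * ‖b‖ := by
  refine ContinuousLinearMap.opNorm_le_bound _ (by positivity) fun x => ContinuousLinearMap.opNorm_le_bound _ (by positivity) fun y => ?_
  rw [tens_apply, norm_mul]
  calc _ ≤ (‖a‖ * ‖x‖) * (‖b‖ * ‖y‖) := by gcongr <;> exact ContinuousLinearMap.le_opNorm _ _
    _ = _ := by ring

/-- jets of products -/
lemma Jet.mul {u v : ℝ → Euc d → ℝ} {p q : ℝ → Euc d → Lin d} {H J : ℝ → Euc d → Bil d} (hu : Jet u p H) (hv : Jet v q J) :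
    Jet (fun t x => u t x * v t x) (fun t x => u t x • q t x + v t x • p t x)
      (fun t x => u t x • J t x + v t x • H t x + tens d (p t x) (q t x) + tens d (q t x) (p t x)) where
  h1 t x := (hu.h1 t x).mul (hv.h1 t x)
  h2 t x := by
    refine (((hu.h1 t x).smul (hv.h2 t x)).add ((hv.h1 t x).smul (hu.h2 t x))).congr_fderiv ?_
    ext y z
    simp only [add_apply, smul_apply, tens_apply, ContinuousLinearMap.smulRight_apply, smul_eq_mul]
    ring

lemma Jet.add {u v : ℝ → Euc d → ℝ} {p q : ℝ → Euc d → Lin d} {H J : ℝ → Euc d → Bil d} (hu : Jet u p H) (hv : Jet v q J) :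
    Jet (fun t x => u t x + v t x) (fun t x => p t x + q t x) (fun t x => H t x + J t x) :=
  ⟨fun t x => (hu.h1 t x).add (hv.h1 t x), fun t x => (hu.h2 t x).add (hv.h2 t x)⟩

lemma Jet.sub {u v : ℝ → Euc d → ℝ} {p q : ℝ → Euc d → Lin d} {H J : ℝ → Euc d → Bil d} (hu : Jet u p H) (hv : Jet v q J) :
    Jet (fun t x => u t x - v t x) (fun t x => p t x - q t x) (fun t x => H t x - J t x) :=
  ⟨fun t x => (hu.h1 t x).sub (hv.h1 t x), fun t x => (hu.h2 t x).sub (hv.h2 t x)⟩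

lemma Jet.sm {u : ℝ → Euc d → ℝ} {p : ℝ → Euc d → Lin d} {H : ℝ → Euc d → Bil d} (hu : Jet u p H) (r : ℝ → ℝ) :
    Jet (fun t x => r t * u t x) (fun t x => r t • p t x) (fun t x => r t • H t x) :=
  ⟨fun t x => (hu.h1 t x).const_smul (r t), fun t x => (hu.h2 t x).const_smul (r t)⟩

lemma Jet.const (r : ℝ → ℝ) : Jet (fun t (_ : Euc d) => r t) (fun _ _ => 0) (fun _ _ => 0) :=
  ⟨fun t x => hasFDerivAt_const _ _, fun t x => hasFDerivAt_const _ _⟩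

lemma Jet.sum {ι : Type*} (s : Finset ι) {u : ι → ℝ → Euc d → ℝ} {p : ι → ℝ → Euc d → Lin d} {H : ι → ℝ → Euc d → Bil d}
    (hu : ∀ i ∈ s, Jet (u i) (p i) (H i)) :
    Jet (fun t x => ∑ i ∈ s, u i t x) (fun t x => ∑ i ∈ s, p i t x) (fun t x => ∑ i ∈ s, H i t x) :=
  ⟨fun t x => HasFDerivAt.fun_sum fun i hi => (hu i hi).h1 t x, fun t x => HasFDerivAt.fun_sum fun i hi => (hu i hi).h2 t x⟩

/-- matrices as functionals on bilinear forms -/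
def qf (Q : Fin d → Fin d → ℝ) : Bil d →L[ℝ] ℝ :=
  ∑ i, ∑ j, Q i j • ((ContinuousLinearMap.apply ℝ ℝ (ee j : Euc d)).comp (ContinuousLinearMap.apply ℝ (Lin d) (ee i : Euc d)))

lemma qf_apply (Q : Fin d → Fin d → ℝ) (H : Bil d) : qf Q H = qtr Q H := by
  simp [qf, qtr, sum_apply, smul_apply]

lemma ee_inner (ξ : Euc d) (i : Fin d) : innerSL ℝ ξ (ee i) = ξ i := by
  simp [ee, EuclideanSpace.inner_single_right]

lemma qf_tens (Q : Fin d → Fin d → ℝ) (ξ : Euc d) : qf Q (tens d (innerSL ℝ ξ) (innerSL ℝ ξ)) = ∑ i, ∑ j, Q i j * ξ i * ξ j := by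
  rw [qf_apply, qtr]
  simp only [tens_apply, ee_inner, mul_assoc]

def Ell (ν : ℝ) (q : Bil d →L[ℝ] ℝ) : Prop := ∃ Q : Fin d → Fin d → ℝ, (∀ i j, Q i j = Q j i) ∧
  (∀ ξ : Euc d, ν * ‖ξ‖^2 ≤ ∑ i, ∑ j, Q i j * ξ i * ξ j) ∧ q = qf Q

lemma Ell.upper {Q : Fin d → Fin d → ℝ} (ξ : Euc d) : ∑ i, ∑ j, Q i j * ξ i * ξ j ≤ ‖qf Q‖ * ‖ξ‖^2 := by
  rw [← qf_tens]
  refine (le_abs_self _).trans (((qf Q).le_opNorm _).trans ?_)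
  gcongr
  refine (tens_le _ _).trans ?_
  simp [innerSL_apply_norm, sq]

lemma Ell.neg {ν : ℝ} (hν : 0 < ν) {q : Bil d →L[ℝ] ℝ} (hq : Ell ν q) {H : Bil d} (hH : ∀ ξ, H ξ ξ ≤ 0) : q H ≤ 0 := by
  obtain ⟨Q, hs, hl, rfl⟩ := hq
  obtain ⟨S, R, hSR, -, -, h⟩ := factor hs hν hl Ell.upper
  have := h (((ContinuousLinearMap.precomp ℝ S)).comp (H.comp S))
  rw [qf_apply, qtr]
  have e : ∀ x y, ((ContinuousLinearMap.precomp ℝ S).comp (H.comp S)) x y = H (S x) (S y) := fun x y => rfl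
  simp only [e, hSR] at this
  rw [this]
  exact Finset.sum_nonpos fun k _ => hH _

/-- linear interpolation towards the identity -/
lemma Ell.mix {ν : ℝ} {q r : Bil d →L[ℝ] ℝ} (hq : Ell ν q) (hr : Ell ν r) {θ : ℝ} (h0 : 0 ≤ θ) (h1 : θ ≤ 1) :
    Ell ν (θ • q + (1-θ) • r) := by
  obtain ⟨Q, hs, hl, rfl⟩ := hq
  obtain ⟨R, hs', hl', rfl⟩ := hr
  refine ⟨fun i j => θ * Q i j + (1-θ) * R i j, fun i j => by simp only [hs i j, hs' i j], fun ξ => ?_, ?_⟩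
  · have e : ∑ i, ∑ j, (θ * Q i j + (1-θ) * R i j) * ξ i * ξ j = θ * (∑ i, ∑ j, Q i j * ξ i * ξ j) + (1-θ) * (∑ i, ∑ j, R i j * ξ i * ξ j) := by
      simp only [Finset.mul_sum, ← Finset.sum_add_distrib]
      refine Finset.sum_congr rfl fun i _ => Finset.sum_congr rfl fun j _ => by ring
    rw [e]
    nlinarith [mul_le_mul_of_nonneg_left (hl ξ) h0, mul_le_mul_of_nonneg_left (hl' ξ) (sub_nonneg.2 h1)]
  · ext H
    simp only [add_apply, smul_apply, qf_apply, qtr, smul_eq_mul, Finset.mul_sum, ← Finset.sum_add_distrib]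
    refine Finset.sum_congr rfl fun i _ => Finset.sum_congr rfl fun j _ => by ring

end alg

section mp
variable {d : ℕ}

lemma max_hess {f : Euc d → ℝ} {p : Euc d → Lin d} {H : Bil d} {x : Euc d} (h1 : ∀ y, HasFDerivAt f (p y) y)
    (h2 : HasFDerivAt p H x) (hm : IsLocalMax f x) : p x = 0 ∧ ∀ ξ, H ξ ξ ≤ 0 := by
  have hp := hm.hasFDerivAt_eq_zero (h1 x)
  refine ⟨hp, fun ξ => ?_⟩
  by_contra hc
  push Not at hc
  set g : ℝ → ℝ := fun r => f (x + r • ξ) with hg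
  have hl : ∀ r : ℝ, HasDerivAt (fun r : ℝ => x + r • ξ) ξ r := fun r => by
    simpa using ((hasDerivAt_id r).smul_const ξ).const_add x
  have hg1 : ∀ r, HasDerivAt g (p (x + r • ξ) ξ) r := fun r => (h1 _).comp_hasDerivAt r (hl r)
  have hd : deriv g = fun r => p (x + r • ξ) ξ := funext fun r => (hg1 r).deriv
  have hg2 : HasDerivAt (deriv g) (H ξ ξ) 0 := by
    rw [hd]
    have h2' : HasFDerivAt p H (x + (0:ℝ) • ξ) := by simpa using h2
    exact ((ContinuousLinearMap.apply ℝ ℝ ξ).hasFDerivAt.comp_hasDerivAt (0:ℝ) (h2'.comp_hasDerivAt (0:ℝ) (hl 0)))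
  have hmin : IsLocalMin g 0 := isLocalMin_of_deriv_deriv_pos (by rw [hg2.deriv]; exact hc)
    (by rw [hd]; simp [hp]) (hg1 0).continuousAt
  have hmax : IsLocalMax g 0 := by
    have hc : ContinuousAt (fun r : ℝ => x + r • ξ) 0 := (hl 0).continuousAt
    have : Tendsto (fun r : ℝ => x + r • ξ) (𝓝 0) (𝓝 x) := by simpa [ContinuousAt] using hc
    have := this.eventually hm
    simpa [IsLocalMax, IsMaxFilter, hg] using this
  have he : g =ᶠ[𝓝 0] fun _ => g 0 := by
    filter_upwards [hmin, hmax] with r a b using le_antisymm b a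
  have he2 : deriv g =ᶠ[𝓝 0] fun _ => 0 := by
    have := he.deriv
    filter_upwards [this] with r hr
    rw [hr]; simp
  have := he2.deriv_eq
  rw [hg2.deriv] at this
  simp at this
  linarith

lemma left_deriv {h : ℝ → ℝ} {h' s t : ℝ} (hd : HasDerivAt h h' t) (hst : s < t) (hm : ∀ τ ∈ Icc s t, h τ ≤ h t) : 0 ≤ h' := by
  have h1 : Tendsto (slope h t) (𝓝[<] t) (𝓝 h') :=
    (hasDerivAt_iff_tendsto_slope.1 hd).mono_left (nhdsWithin_mono _ fun x (hx : x < t) => hx.ne)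
  refine ge_of_tendsto h1 ?_
  filter_upwards [Ioo_mem_nhdsLT hst] with τ hτ
  rw [slope_def_field]
  exact div_nonneg_of_nonpos (by linarith [hm τ ⟨hτ.1.le, hτ.2.le⟩]) (by linarith [hτ.2])

set_option maxHeartbeats 800000 in
/-- parabolic maximum principle -/
theorem MP {ν B M s T : ℝ} (hν : 0 < ν) {w : ℝ → Euc d → ℝ} (hc : Continuous fun z : ℝ × Euc d => w z.1 z.2)
    (hM : ∀ t ∈ Icc s T, ∀ x, w t x ≤ M) (h0 : ∀ x, w s x ≤ 0)
    (hw : ∀ t ∈ Ioc s T, ∀ x, 0 < w t x → ∃ (p : Euc d → Lin d) (H : Bil d) (w' : ℝ) (q : Bil d →L[ℝ] ℝ) (b : Lin d →L[ℝ] ℝ),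
      (∀ y, HasFDerivAt (w t) (p y) y) ∧ HasFDerivAt p H x ∧ HasDerivAt (fun t => w t x) w' t ∧ Ell ν q ∧ ‖q‖ ≤ B ∧ ‖b‖ ≤ B ∧
      w' ≤ q H + b (p x)) : ∀ t ∈ Icc s T, ∀ x, w t x ≤ 0 := by
  intro t ht x
  by_contra hcon
  push Not at hcon
  set l := 3 * |B| + 1 with hl
  have hB := abs_nonneg B
  set N : ℝ := Real.exp (l * (t - s)) * (1 + ‖x‖^2) with hN
  have hN0 : 0 < N := by positivity
  set ε := w t x / (2 * N) with hε
  have hε0 : 0 < ε := by positivity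
  set φ : ℝ → Euc d → ℝ := fun t x => ε * Real.exp (l * (t - s)) * (1 + ‖x‖^2) with hφ
  have hφc : Continuous fun z : ℝ × Euc d => φ z.1 z.2 := by fun_prop
  have hφ0 : ∀ t x, 0 < φ t x := fun t x => by positivity
  have hpos : 0 < w t x - φ t x := by
    have : φ t x = w t x / 2 := by simp only [hφ, hε]; rw [mul_assoc, ← hN]; field_simp
    linarith
  set R := ‖x‖ + |M| / ε + 1 with hR
  have hR1 : 1 ≤ R := by have : 0 ≤ |M| / ε := by positivity
                         have := norm_nonneg x; linarith
  have hlarge : ∀ t ∈ Icc s T, ∀ y : Euc d, R ≤ ‖y‖ → w t y - φ t y < 0 := fun t ht y hy => by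
    have h1 : 1 ≤ Real.exp (l * (t - s)) := Real.one_le_exp (mul_nonneg (by positivity) (by linarith [ht.1]))
    have h2 : R ≤ 1 + ‖y‖^2 := by nlinarith [norm_nonneg y]
    have h3 : ε * R ≤ φ t y := by
      simp only [hφ]
      calc ε * R ≤ ε * 1 * (1 + ‖y‖^2) := by rw [mul_one]; gcongr
        _ ≤ _ := by gcongr
    have h4 : |M| < ε * R := by
      have : ε * R = ε * ‖x‖ + |M| + ε := by rw [hR]; field_simp
      have := mul_nonneg hε0.le (norm_nonneg x)
      linarith
    linarith [hM t ht y, le_abs_self M]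
  have hxR : ‖x‖ ≤ R := by
    have : 0 ≤ |M| / ε := by positivity
    linarith
  obtain ⟨⟨t1, x1⟩, ⟨ht1, hx1⟩, hmax⟩ := (isCompact_Icc.prod (isCompact_closedBall (0:Euc d) R)).exists_isMaxOn
    (s := Icc s T ×ˢ Metric.closedBall (0:Euc d) R) ⟨(t, x), ht, by simpa using hxR⟩ ((hc.sub hφc).continuousOn)
  simp only at ht1 hx1
  have hmax' : ∀ t ∈ Icc s T, ∀ y, w t y - φ t y ≤ max 0 (w t1 x1 - φ t1 x1) := fun t ht y => by
    rcases le_total R ‖y‖ with h | h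
    · exact le_max_of_le_left (hlarge t ht y h).le
    · have hm2 : (t, y) ∈ Icc s T ×ˢ Metric.closedBall (0:Euc d) R := mk_mem_prod ht (mem_closedBall_zero_iff.2 h)
      have := isMaxOn_iff.1 hmax (t, y) hm2
      exact le_max_of_le_right this
  have hp1 : 0 < w t1 x1 - φ t1 x1 := by
    have := hmax' t ht x
    rcases le_max_iff.1 this with h | h <;> linarith
  rw [max_eq_right hp1.le] at hmax'
  have hs1 : s < t1 := by
    rcases eq_or_lt_of_le ht1.1 with h | h
    · have := h0 x1; rw [h] at this; linarith [hφ0 t1 x1]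
    · exact h
  obtain ⟨p, H, w', q, b, j1, j2, j3, hq, hqB, hbB, hin⟩ := hw t1 ⟨hs1, ht1.2⟩ x1 (by linarith [hφ0 t1 x1])
  set e := Real.exp (l * (t1 - s)) with he
  have he0 : 0 < e := Real.exp_pos _
  have k1 : ∀ y, HasFDerivAt (φ t1) ((ε * e * 2) • innerSL ℝ y) y := fun y => by
    have := ((hasStrictFDerivAt_norm_sq y).hasFDerivAt.const_add (1:ℝ)).const_mul (ε * e)
    refine this.congr_fderiv ?_
    ext z; simp; ring
  have k2 : HasFDerivAt (fun y : Euc d => (ε * e * 2) • innerSL ℝ y) ((ε * e * 2) • (innerSL ℝ : Euc d →L[ℝ] Euc d →L[ℝ] ℝ)) x1 :=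
    ((ε * e * 2) • (innerSL ℝ : Euc d →L[ℝ] Euc d →L[ℝ] ℝ)).hasFDerivAt
  have k3 : HasDerivAt (fun t => φ t x1) (l * φ t1 x1) t1 := by
    have := ((((hasDerivAt_id t1).sub_const s).const_mul l).exp.const_mul ε).mul_const (1 + ‖x1‖^2)
    refine this.congr_deriv ?_
    simp only [hφ, id]; ring
  obtain ⟨hp, hH⟩ := max_hess (fun y => (j1 y).sub (k1 y)) (j2.sub k2)
    (Filter.Eventually.of_forall fun y => hmax' t1 ht1 y)
  have hd := left_deriv (j3.sub k3) hs1 fun τ hτ => hmax' τ ⟨hτ.1, hτ.2.trans ht1.2⟩ x1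
  have hqn := hq.neg hν hH
  rw [map_sub, map_smul, smul_eq_mul] at hqn
  have hb : b (p x1) = (ε * e * 2) * b (innerSL ℝ x1) := by
    rw [sub_eq_zero.1 hp, map_smul, smul_eq_mul]
  have b1 : b (innerSL ℝ x1) ≤ |B| * ‖x1‖ := by
    refine (le_abs_self _).trans ((b.le_opNorm _).trans ?_)
    rw [innerSL_apply_norm]; gcongr; exact hbB.trans (le_abs_self _)
  have b2 : q (innerSL ℝ : Euc d →L[ℝ] Euc d →L[ℝ] ℝ) ≤ |B| := by
    refine (le_abs_self _).trans ((q.le_opNorm _).trans ?_)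
    have h1 : ‖(innerSL ℝ : Euc d →L[ℝ] Euc d →L[ℝ] ℝ)‖ ≤ 1 :=
      ContinuousLinearMap.opNorm_le_bound _ zero_le_one fun y => by rw [one_mul, innerSL_apply_norm]
    exact (mul_le_of_le_one_right (norm_nonneg _) h1).trans (hqB.trans (le_abs_self _))
  have hee : 0 < ε * e := by positivity
  have f1 : l * φ t1 x1 ≤ (ε * e) * (2 * |B| + 2 * |B| * ‖x1‖) := by
    have := mul_le_mul_of_nonneg_left b1 hee.le
    have := mul_le_mul_of_nonneg_left b2 hee.le
    linarith
  have f2 : l * φ t1 x1 = (ε * e) * (l * (1 + ‖x1‖^2)) := by simp only [hφ]; ring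
  rw [f2] at f1
  have f3 := le_of_mul_le_mul_left f1 hee
  nlinarith [mul_nonneg hB (sq_nonneg (‖x1‖ - 1)), sq_nonneg ‖x1‖, mul_nonneg hB (sq_nonneg ‖x1‖)]

end mp

section cut
variable {d : ℕ} {F : Type*} [NormedAddCommGroup F] [NormedSpace ℝ F] {α : ℝ}

lemma uniq_aux {ν B M k l T : ℝ} (hν : 0 < ν) (hkl : k < l) {z : ℝ → Euc d → ℝ} {p : ℝ → Euc d → Lin d} {H : ℝ → Euc d → Bil d}
    {q : ℝ → Euc d → Bil d →L[ℝ] ℝ} {b : ℝ → Euc d → Lin d →L[ℝ] ℝ} {c : ℝ → Euc d → ℝ}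
    (hE : ∀ t x, Ell ν (q t x)) (hq : ∀ t x, ‖q t x‖ ≤ B) (hb : ∀ t x, ‖b t x‖ ≤ B) (hk : ∀ t x, c t x ≤ k)
    (hz : Jet z p H) (hc : Continuous fun y : ℝ × Euc d => z y.1 y.2) (hM : ∀ t x, z t x ≤ M)
    (ht : ∀ t ≤ T, ∀ x, HasDerivAt (fun t => z t x) (q t x (H t x) + b t x (p t x) + c t x * z t x - l * z t x) t) (x : Euc d) :
    z T x ≤ 0 := by
  refine le_of_forall_pos_le_add fun δ hδ => ?_
  set m := l - k with hm
  have hm0 : 0 < m := by linarith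
  obtain ⟨s, hsT, hs⟩ : ∃ s ≤ T, Real.exp (m * (s - T)) * |M| ≤ δ := by
    have h1 : Tendsto (fun s : ℝ => Real.exp (m * (s - T)) * |M|) atBot (𝓝 (0 * |M|)) := by
      refine Tendsto.mul_const _ (Real.tendsto_exp_atBot.comp ?_)
      exact (tendsto_atBot_add_const_right _ (-T) tendsto_id).const_mul_atBot hm0
    rw [zero_mul] at h1
    obtain ⟨s, h2, h3⟩ := ((h1.eventually (eventually_le_nhds hδ)).and (eventually_le_atBot T)).exists
    exact ⟨s, h3, h2⟩
  set r : ℝ → ℝ := fun t => Real.exp (m * (t - T)) with hr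
  have hr0 : ∀ t, 0 < r t := fun t => Real.exp_pos _
  have hrd : ∀ t, HasDerivAt r (m * r t) t := fun t => by
    refine (((hasDerivAt_id t).sub_const T).const_mul m).exp.congr_deriv ?_
    simp only [hr, id]; ring
  have hj := (hz.sm r).sub (Jet.const fun _ => δ)
  have := MP (ν := ν) (B := B) (M := |M|) (s := s) (T := T) hν (w := fun t x => r t * z t x - δ)
    (by have : Continuous fun y : ℝ × Euc d => r y.1 := by fun_prop
        exact (this.mul hc).sub continuous_const) (fun t ht x => ?_) (fun x => ?_) (fun t htt y hy => ?_) T ⟨hsT, le_rfl⟩ x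
  · have e : r T = 1 := by simp [hr]
    simp only [e, one_mul] at this
    linarith
  · have h1 : r t ≤ 1 := Real.exp_le_one_iff.2 (mul_nonpos_of_nonneg_of_nonpos hm0.le (by linarith [ht.2]))
    have h2 := mul_le_mul_of_nonneg_left ((hM t x).trans (le_abs_self M)) (hr0 t).le
    nlinarith [abs_nonneg M, hr0 t]
  · have h2 := mul_le_mul_of_nonneg_left ((hM s x).trans (le_abs_self M)) (hr0 s).le
    simp only [hr] at h2 ⊢
    linarith
  · refine ⟨_, _, _, q t y, b t y, hj.h1 t, hj.h2 t y, ((hrd t).mul (ht t htt.2 y)).sub_const δ, hE t y, hq t y, hb t y, ?_⟩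
    simp only [sub_zero, map_smul, smul_eq_mul]
    have h3 : 0 < r t * z t y := by linarith
    nlinarith [hk t y]

lemma uniq {ν B M k l T : ℝ} (hν : 0 < ν) (hkl : k < l) {z : ℝ → Euc d → ℝ} {p : ℝ → Euc d → Lin d} {H : ℝ → Euc d → Bil d}
    {q : ℝ → Euc d → Bil d →L[ℝ] ℝ} {b : ℝ → Euc d → Lin d →L[ℝ] ℝ} {c : ℝ → Euc d → ℝ}
    (hE : ∀ t x, Ell ν (q t x)) (hq : ∀ t x, ‖q t x‖ ≤ B) (hb : ∀ t x, ‖b t x‖ ≤ B) (hk : ∀ t x, c t x ≤ k)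
    (hz : Jet z p H) (hc : Continuous fun y : ℝ × Euc d => z y.1 y.2) (hM : ∀ t x, |z t x| ≤ M)
    (ht : ∀ t ≤ T, ∀ x, HasDerivAt (fun t => z t x) (q t x (H t x) + b t x (p t x) + c t x * z t x - l * z t x) t) (x : Euc d) :
    z T x = 0 := by
  refine le_antisymm (uniq_aux hν hkl hE hq hb hk hz hc (fun t x => (le_abs_self _).trans (hM t x)) ht x) ?_
  have := uniq_aux hν hkl hE hq hb hk (hz.sm fun _ => -1) (continuous_const.mul hc) (M := M)
    (fun t x => by have := (neg_le_abs _).trans (hM t x); simpa using this)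
    (fun t htt y => ((ht t htt y).const_mul (-1)).congr_deriv (by simp; ring)) x (T := T)
  linarith

lemma nn_lip (hα : α ∈ Ioo (0:ℝ) 1) {g : ℝ → Euc d → F} {U P : ℝ} (hP : 0 ≤ P) (hc : Continuous (fun z : ℝ × Euc d => g z.1 z.2))
    (hu : ∀ t x, ‖g t x‖ ≤ U) (hl : ∀ t x y, ‖g t x - g t y‖ ≤ P * ‖x - y‖) : Nn α (2 * U + P) g := by
  have hU : 0 ≤ U := (norm_nonneg _).trans (hu 0 0)
  refine ⟨hc, fun t x => (hu t x).trans (by linarith), fun t x y => ?_⟩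
  have h3 := Real.rpow_nonneg (norm_nonneg (x-y)) α
  rcases le_total ‖x-y‖ 1 with h | h
  · have h1 : ‖x-y‖ ≤ ‖x-y‖^α := Real.self_le_rpow_of_le_one (norm_nonneg _) h hα.2.le
    nlinarith [mul_le_mul_of_nonneg_left h1 hP, mul_nonneg hU h3, hl t x y]
  · have h1 : 1 ≤ ‖x-y‖^α := Real.one_le_rpow h hα.1.le
    have := norm_sub_le (g t x) (g t y)
    nlinarith [hu t x, hu t y, mul_nonneg hP h3]

def dx (ψ : ℝ × Euc d → F) (z : ℝ × Euc d) : Euc d →L[ℝ] F := (fderiv ℝ ψ z).comp (ContinuousLinearMap.inr ℝ ℝ (Euc d))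

def dt (ψ : ℝ × Euc d → F) (z : ℝ × Euc d) : F := fderiv ℝ ψ z (1, 0)

open scoped ContDiff

lemma dx_smooth {ψ : ℝ × Euc d → F} (h : ContDiff ℝ ∞ ψ) : ContDiff ℝ ∞ (dx ψ) :=
  ((ContinuousLinearMap.precomp F (ContinuousLinearMap.inr ℝ ℝ (Euc d))).contDiff).comp (h.fderiv_right (by simp))

lemma dt_smooth {ψ : ℝ × Euc d → F} (h : ContDiff ℝ ∞ ψ) : ContDiff ℝ ∞ (dt ψ) :=
  (h.fderiv_right (m := ∞) (by simp)).clm_apply contDiff_const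

lemma dx_supp {ψ : ℝ × Euc d → F} (h : HasCompactSupport ψ) : HasCompactSupport (dx ψ) :=
  (h.fderiv (𝕜 := ℝ)).comp_left (g := fun L : (ℝ × Euc d) →L[ℝ] F => L.comp (ContinuousLinearMap.inr ℝ ℝ (Euc d))) (by simp)

lemma dt_supp {ψ : ℝ × Euc d → F} (h : HasCompactSupport ψ) : HasCompactSupport (dt ψ) :=
  (h.fderiv (𝕜 := ℝ)).comp_left (g := fun L : (ℝ × Euc d) →L[ℝ] F => L (1, 0)) (by simp)

lemma dx_has {ψ : ℝ × Euc d → F} (h : ContDiff ℝ ∞ ψ) (t : ℝ) (x : Euc d) : HasFDerivAt (fun x => ψ (t, x)) (dx ψ (t, x)) x :=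
  ((h.differentiable (by simp)) (t, x)).hasFDerivAt.comp x (hasFDerivAt_prodMk_right t x)

lemma dt_has {ψ : ℝ × Euc d → F} (h : ContDiff ℝ ∞ ψ) (t : ℝ) (x : Euc d) : HasDerivAt (fun t => ψ (t, x)) (dt ψ (t, x)) t :=
  ((h.differentiable (by simp)) (t, x)).hasFDerivAt.comp_hasDerivAt t ((hasDerivAt_id t).prodMk (hasDerivAt_const t x))

lemma nn_smooth (hα : α ∈ Ioo (0:ℝ) 1) {ψ : ℝ × Euc d → F} (h : ContDiff ℝ ∞ ψ) (hs : HasCompactSupport ψ) :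
    ∃ C, Nn α C (fun t x => ψ (t, x)) := by
  obtain ⟨U, hU⟩ := hs.exists_bound_of_continuous h.continuous
  obtain ⟨P, hP⟩ := (dx_supp hs).exists_bound_of_continuous (dx_smooth h).continuous
  exact ⟨_, nn_lip hα ((norm_nonneg _).trans (hP 0)) h.continuous (fun t x => hU _)
    fun t x y => lip_of_deriv (fun x => dx_has h t x) (fun x => hP _) x y⟩

structure Cut (α C : ℝ) (η : ℝ → Euc d → ℝ) (p : ℝ → Euc d → Lin d) (H : ℝ → Euc d → Bil d) (e : ℝ → Euc d → ℝ) : Prop where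
  J : Jet η p H
  n0 : Nn α C η
  n1 : Nn α C p
  n2 : Nn α C H
  n3 : Nn α C e
  ht : ∀ t x, HasDerivAt (fun t => η t x) (e t x) t

lemma cut_mk (hα : α ∈ Ioo (0:ℝ) 1) {η : ℝ × Euc d → ℝ} (h : ContDiff ℝ ∞ η) (hs : HasCompactSupport η) :
    ∃ C, Cut α C (fun t x => η (t, x)) (fun t x => dx η (t, x)) (fun t x => dx (dx η) (t, x)) (fun t x => dt η (t, x)) := by
  obtain ⟨C0, h0⟩ := nn_smooth hα h hs
  obtain ⟨C1, h1⟩ := nn_smooth hα (dx_smooth h) (dx_supp hs)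
  obtain ⟨C2, h2⟩ := nn_smooth hα (dx_smooth (dx_smooth h)) (dx_supp (dx_supp hs))
  obtain ⟨C3, h3⟩ := nn_smooth hα (dt_smooth h) (dt_supp hs)
  have a0 := h0.nonneg
  have a1 := h1.nonneg
  have a2 := h2.nonneg
  have a3 := h3.nonneg
  exact ⟨C0 + C1 + C2 + C3, ⟨fun t x => dx_has h t x, fun t x => dx_has (dx_smooth h) t x⟩, h0.mono (by linarith),
    h1.mono (by linarith), h2.mono (by linarith), h3.mono (by linarith), fun t x => dt_has h t x⟩

/-- the family `S (kψ - 1)` -/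
lemma cut_family (hα : α ∈ Ioo (0:ℝ) 1) {ψ : ℝ × Euc d → ℝ} (h : ContDiff ℝ ∞ ψ) (hs : HasCompactSupport ψ) :
    ∃ C, 1 ≤ C ∧ ∀ k : ℝ, 1 ≤ k → ∃ p H e, Cut α (C * k^3) (fun t x => Real.smoothTransition (k * ψ (t,x) - 1)) p H e := by
  obtain ⟨C, hC⟩ := cut_mk hα h hs
  have hC0 := hC.n0.nonneg
  set S := Real.smoothTransition with hS
  have s0 : ContDiff ℝ ∞ S := Real.smoothTransition.contDiff
  have s1 : ContDiff ℝ ∞ (deriv S) := ((contDiff_infty_iff_deriv).1 s0).2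
  have s2 : ContDiff ℝ ∞ (deriv (deriv S)) := ((contDiff_infty_iff_deriv).1 s1).2
  have s3 : ContDiff ℝ ∞ (deriv (deriv (deriv S))) := ((contDiff_infty_iff_deriv).1 s2).2
  have c1 : HasCompactSupport (deriv S) := by
    refine HasCompactSupport.intro (isCompact_Icc (a := (0:ℝ)) (b := 1)) fun x hx => ?_
    rcases lt_or_ge x 0 with h0 | h0
    · have : S =ᶠ[𝓝 x] fun _ => 0 := by
        filter_upwards [Iio_mem_nhds h0] with y hy using Real.smoothTransition.zero_of_nonpos (le_of_lt hy)
      rw [this.deriv_eq]; simp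
    · have h1 : 1 < x := by by_contra hh; exact hx ⟨h0, not_lt.1 hh⟩
      have : S =ᶠ[𝓝 x] fun _ => 1 := by
        filter_upwards [Ioi_mem_nhds h1] with y hy using Real.smoothTransition.one_of_one_le (le_of_lt hy)
      rw [this.deriv_eq]; simp
  obtain ⟨B1, b1⟩ := c1.exists_bound_of_continuous s1.continuous
  obtain ⟨B2, b2⟩ := c1.deriv.exists_bound_of_continuous s2.continuous
  obtain ⟨B3, b3⟩ := c1.deriv.deriv.exists_bound_of_continuous s3.continuous
  set B := 1 + |B1| + |B2| + |B3| with hB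
  have hB1 : 1 ≤ B := by have := abs_nonneg B1; have := abs_nonneg B2; have := abs_nonneg B3; linarith
  have b1' : ∀ x, ‖deriv S x‖ ≤ B := fun x => (b1 x).trans (by have := le_abs_self B1; have := abs_nonneg B2; have := abs_nonneg B3; linarith)
  have b2' : ∀ x, ‖deriv (deriv S) x‖ ≤ B := fun x => (b2 x).trans (by have := le_abs_self B2; have := abs_nonneg B1; have := abs_nonneg B3; linarith)
  have b3' : ∀ x, ‖deriv (deriv (deriv S)) x‖ ≤ B := fun x => (b3 x).trans (by have := le_abs_self B3; have := abs_nonneg B2; have := abs_nonneg B1; linarith)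
  have b0' : ∀ x, ‖S x‖ ≤ B := fun x => by
    rw [Real.norm_eq_abs, abs_of_nonneg (Real.smoothTransition.nonneg x)]
    exact (Real.smoothTransition.le_one x).trans hB1
  -- composition
  have key : ∀ {R : ℝ → ℝ}, ContDiff ℝ ∞ R → (∀ x, ‖R x‖ ≤ B) → (∀ x, ‖deriv R x‖ ≤ B) → ∀ k : ℝ, 1 ≤ k →
      Nn α (B * (2 + C) * k) (fun t x => R (k * ψ (t,x) - 1)) := fun {R} hR hb hb' k hk => by
    have hlip : ∀ a b, ‖R a - R b‖ ≤ B * ‖a - b‖ := fun a b =>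
      Convex.norm_image_sub_le_of_norm_deriv_le (fun x _ => hR.differentiable (by simp) x) (fun x _ => hb' x) convex_univ (mem_univ b) (mem_univ a)
    have hψ : ∀ t x y, ‖ψ (t,x) - ψ (t,y)‖ ≤ C * ‖x - y‖ := fun t x y => lip_of_deriv (hC.J.h1 t) (hC.n1.2.1 t) x y
    refine (nn_lip hα (U := B) (P := B * k * C) (by positivity) ?_ (fun t x => hb _) (fun t x y => (hlip _ _).trans ?_)).mono ?_
    · exact hR.continuous.comp (by have := h.continuous; fun_prop)
    · have : k * ψ (t,x) - 1 - (k * ψ (t,y) - 1) = k * (ψ (t,x) - ψ (t,y)) := by ring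
      rw [this, norm_mul, Real.norm_of_nonneg (by linarith : 0 ≤ k), mul_assoc B, mul_assoc B, mul_assoc k]
      have := hψ t x y
      gcongr
    · nlinarith [mul_le_mul_of_nonneg_left hk (by linarith : 0 ≤ B)]
  refine ⟨1 + 8 * (B * (2 + C)) * (1 + C) ^ 2, by have : 0 ≤ 8 * (B * (2 + C)) * (1 + C) ^ 2 := by positivity
                                                  linarith, fun k hk => ?_⟩
  set A := B * (2 + C) with hA
  have hA0 : 0 ≤ A := by positivity
  have hk0 : 0 < k := by linarith
  have hl : ∀ t x, HasFDerivAt (fun x => k * ψ (t,x) - 1) (k • dx ψ (t,x)) x := fun t x => ((hC.J.h1 t x).const_mul k).sub_const 1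
  have hcomp : ∀ {R : ℝ → ℝ}, ContDiff ℝ ∞ R → ∀ t x, HasFDerivAt (fun x => R (k * ψ (t,x) - 1)) (deriv R (k * ψ (t,x) - 1) • (k • dx ψ (t,x))) x :=
    fun {R} hR t x => ((hR.differentiable (by simp)) _).hasDerivAt.comp_hasFDerivAt x (hl t x)
  have hk1 : k ≤ k^3 := le_self_pow₀ hk (by norm_num)
  have hk2 : k^2 ≤ k^3 := pow_le_pow_right₀ hk (by norm_num)
  have q1 : (1:ℝ) ≤ (1 + C)^2 := one_le_pow₀ (by linarith)
  have q2 : C ≤ (1 + C)^2 := by nlinarith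
  have q3 : C^2 ≤ (1 + C)^2 := by nlinarith
  have z1 : 0 ≤ A * k^3 := by positivity
  refine ⟨fun t x => deriv S (k * ψ (t,x) - 1) • (k • dx ψ (t,x)),
    fun t x => deriv S (k * ψ (t,x) - 1) • (k • dx (dx ψ) (t,x)) + (deriv (deriv S) (k * ψ (t,x) - 1)) • (k^2 • tens d (dx ψ (t,x)) (dx ψ (t,x))),
    fun t x => deriv S (k * ψ (t,x) - 1) • (k * dt ψ (t,x)), ⟨fun t x => hcomp s0 t x, fun t x => ?_⟩, (key s0 b0' b1' k hk).mono ?_,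
    ((key s1 b1' b2' k hk).smul ((hC.n1.const_mul k hk0.le))).mono ?_,
    (((key s1 b1' b2' k hk).smul ((hC.n2.const_mul k hk0.le))).add ((key s2 b2' b3' k hk).smul ((Nn.bil (tens d) tens_le hC.n1 hC.n1).const_mul (k^2) (by positivity)))).mono ?_,
    ((key s1 b1' b2' k hk).smul ((hC.n3.const_mul k hk0.le))).mono ?_, fun t x => ?_⟩
  · refine ((hcomp s1 t x).smul ((hC.J.h2 t x).const_smul k)).congr_fderiv ?_
    ext y z
    simp only [add_apply, smul_apply, Pi.smul_apply, tens_apply, ContinuousLinearMap.smulRight_apply, smul_eq_mul]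
    ring
  · nlinarith [mul_le_mul_of_nonneg_left hk1 hA0, mul_le_mul_of_nonneg_left q1 z1]
  · have : 2 * (A * k) * (k * C) ≤ 2 * (A * k^3) * C := by nlinarith [mul_le_mul_of_nonneg_left hk2 (mul_nonneg hA0 hC0)]
    nlinarith [mul_le_mul_of_nonneg_left q2 z1, pow_pos hk0 3, mul_nonneg z1 (sq_nonneg (1+C))]
  · have : 2 * (A * k) * (k * C) ≤ 2 * (A * k^3) * C := by nlinarith [mul_le_mul_of_nonneg_left hk2 (mul_nonneg hA0 hC0)]
    nlinarith [mul_le_mul_of_nonneg_left q2 z1, mul_le_mul_of_nonneg_left q3 z1, pow_pos hk0 3, mul_nonneg z1 (sq_nonneg (1+C))]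
  · have : 2 * (A * k) * (k * C) ≤ 2 * (A * k^3) * C := by nlinarith [mul_le_mul_of_nonneg_left hk2 (mul_nonneg hA0 hC0)]
    nlinarith [mul_le_mul_of_nonneg_left q2 z1, pow_pos hk0 3, mul_nonneg z1 (sq_nonneg (1+C))]
  · exact ((s0.differentiable (by simp)) _).hasDerivAt.comp t (((hC.ht t x).const_mul k).sub_const 1)

end cut

section ser
variable {d : ℕ} {F : Type*} [NormedAddCommGroup F] [NormedSpace ℝ F] [CompleteSpace F] {α : ℝ}

lemma geo_sum (A : ℝ) : HasSum (fun n : ℕ => A * (1/2)^n) (2 * A) := by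
  have := hasSum_geometric_two.mul_left A
  rwa [mul_comm A 2] at this

lemma Nn.summable {A : ℝ} {g : ℕ → ℝ → Euc d → F} (h : ∀ n, Nn α (A * (1/2)^n) (g n)) (t : ℝ) (x : Euc d) : Summable fun n => g n t x :=
  Summable.of_norm_bounded (geo_sum A).summable fun n => (h n).2.1 t x

lemma Nn.tsum {A : ℝ} {g : ℕ → ℝ → Euc d → F} (h : ∀ n, Nn α (A * (1/2)^n) (g n)) : Nn α (2 * A) (fun t x => ∑' n, g n t x) := by
  refine ⟨continuous_tsum (fun n => (h n).1) (geo_sum A).summable fun n z => (h n).2.1 _ _,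
    fun t x => tsum_of_norm_bounded (geo_sum A) fun n => (h n).2.1 _ _, fun t x y => ?_⟩
  rw [← (Nn.summable h t x).tsum_sub (Nn.summable h t y)]
  refine tsum_of_norm_bounded ((geo_sum A).mul_right _) fun n => (h n).2.2 _ _ _

set_option maxHeartbeats 800000 in
lemma series {A1 A2 l : ℝ} {q : ℝ → Euc d → Bil d →L[ℝ] ℝ} {b : ℝ → Euc d → Lin d →L[ℝ] ℝ} {c : ℝ → Euc d → ℝ} {B : ℝ}
    (hq : ∀ t x, ‖q t x‖ ≤ B) (hb : ∀ t x, ‖b t x‖ ≤ B) (hc : ∀ t x, ‖c t x‖ ≤ B)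
    (happ : ∀ K (g : ℝ → Euc d → ℝ), Nn α K g → ∃ w p H r, Jet w p H ∧ Nn α (A1*K) w ∧ Nn α (A1*K) p ∧ Nn α (A2*K) H ∧ Nn α (K*(1/2)) r ∧
      ∀ t x, HasDerivAt (fun t => w t x) (q t x (H t x) + b t x (p t x) + c t x * w t x - l * w t x + (g t x - r t x)) t)
    {K : ℝ} {g : ℝ → Euc d → ℝ} (hg : Nn α K g) :
    ∃ w p H, Jet w p H ∧ Nn α (2*(A1*K)) w ∧ Nn α (2*(A1*K)) p ∧ Nn α (2*(A2*K)) H ∧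
      ∀ t x, HasDerivAt (fun t => w t x) (q t x (H t x) + b t x (p t x) + c t x * w t x - l * w t x + g t x) t := by
  have happ' : ∀ K (g : ℝ → Euc d → ℝ), ∃ w p H r, Nn α K g → (Jet w p H ∧ Nn α (A1*K) w ∧ Nn α (A1*K) p ∧ Nn α (A2*K) H ∧ Nn α (K*(1/2)) r ∧
      ∀ t x, HasDerivAt (fun t => w t x) (q t x (H t x) + b t x (p t x) + c t x * w t x - l * w t x + (g t x - r t x)) t) := fun K g => by
    by_cases h : Nn α K g
    · obtain ⟨w, p, H, r, h'⟩ := happ K g h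
      exact ⟨w, p, H, r, fun _ => h'⟩
    · exact ⟨0, 0, 0, 0, fun h' => (h h').elim⟩
  choose W P H R hR using happ'
  let G : ℕ → ℝ → Euc d → ℝ := fun n => Nat.rec g (fun n G => R (K * (1/2)^n) G) n
  have hGs : ∀ n, G (n+1) = R (K * (1/2)^n) (G n) := fun n => rfl
  have hG : ∀ n, Nn α (K * (1/2)^n) (G n) := fun n => by
    induction n with
    | zero => rw [pow_zero, mul_one]; exact hg
    | succ n ih => rw [hGs, pow_succ, ← mul_assoc]; exact (hR _ _ ih).2.2.2.2.1
  let w := fun n => W (K * (1/2)^n) (G n)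
  let p := fun n => P (K * (1/2)^n) (G n)
  let h := fun n => H (K * (1/2)^n) (G n)
  have hJ : ∀ n, Jet (w n) (p n) (h n) := fun n => (hR _ _ (hG n)).1
  have hw : ∀ n, Nn α (A1 * K * (1/2)^n) (w n) := fun n => by rw [mul_assoc]; exact (hR _ _ (hG n)).2.1
  have hp : ∀ n, Nn α (A1 * K * (1/2)^n) (p n) := fun n => by rw [mul_assoc]; exact (hR _ _ (hG n)).2.2.1
  have hh : ∀ n, Nn α (A2 * K * (1/2)^n) (h n) := fun n => by rw [mul_assoc]; exact (hR _ _ (hG n)).2.2.2.1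
  have hd : ∀ n t x, HasDerivAt (fun t => w n t x) (q t x (h n t x) + b t x (p n t x) + c t x * w n t x - l * w n t x + (G n t x - G (n+1) t x)) t :=
    fun n => (hR _ _ (hG n)).2.2.2.2.2
  refine ⟨fun t x => ∑' n, w n t x, fun t x => ∑' n, p n t x, fun t x => ∑' n, h n t x, ⟨fun t x => ?_, fun t x => ?_⟩,
    Nn.tsum hw, Nn.tsum hp, Nn.tsum hh, fun t x => ?_⟩
  · exact hasFDerivAt_tsum (geo_sum (A1*K)).summable (fun n y => (hJ n).h1 t y) (fun n y => (hp n).2.1 t y) (Nn.summable hw t x) x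
  · exact hasFDerivAt_tsum (geo_sum (A2*K)).summable (fun n y => (hJ n).h2 t y) (fun n y => (hh n).2.1 t y) (Nn.summable hp t x) x
  · have sG := Nn.summable hG t x
    have tel : HasSum (fun n => G n t x - G (n+1) t x) (g t x) := by
      have s2 : Summable fun n => G (n+1) t x := (summable_nat_add_iff 1).2 sG
      have := sG.hasSum.sub s2.hasSum
      rwa [sG.tsum_eq_zero_add, add_sub_cancel_right] at this
    have hs : HasSum (fun n => q t x (h n t x) + b t x (p n t x) + c t x * w n t x - l * w n t x + (G n t x - G (n+1) t x))
        (q t x (∑' n, h n t x) + b t x (∑' n, p n t x) + c t x * (∑' n, w n t x) - l * (∑' n, w n t x) + g t x) :=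
      (((((q t x).hasSum (Nn.summable hh t x).hasSum).add ((b t x).hasSum (Nn.summable hp t x).hasSum)).add
        ((Nn.summable hw t x).hasSum.mul_left (c t x))).sub ((Nn.summable hw t x).hasSum.mul_left l)).add tel
    rw [← hs.tsum_eq]
    refine hasDerivAt_tsum (geo_sum (B * (A2*K) + B * (A1*K) + B * (A1*K) + |l| * (A1*K) + 2 * K)).summable (fun n y => hd n y x) (fun n y => ?_) (Nn.summable hw t x) t
    have k0 : (0:ℝ) < (1/2)^n := by positivity
    have hB : 0 ≤ B := (norm_nonneg _).trans (hq 0 0)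
    have e1 : ‖q y x (h n y x)‖ ≤ B * (A2 * K * (1/2)^n) := ((q y x).le_opNorm _).trans (mul_le_mul (hq y x) ((hh n).2.1 y x) (norm_nonneg _) hB)
    have e2 : ‖b y x (p n y x)‖ ≤ B * (A1 * K * (1/2)^n) := ((b y x).le_opNorm _).trans (mul_le_mul (hb y x) ((hp n).2.1 y x) (norm_nonneg _) hB)
    have e3 : ‖c y x * w n y x‖ ≤ B * (A1 * K * (1/2)^n) := (norm_mul _ _).trans_le (mul_le_mul (hc y x) ((hw n).2.1 y x) (norm_nonneg _) hB)
    have e4 : ‖l * w n y x‖ ≤ |l| * (A1 * K * (1/2)^n) := (norm_mul _ _).trans_le (mul_le_mul le_rfl ((hw n).2.1 y x) (norm_nonneg _) (abs_nonneg l))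
    have e5 := (hG n).2.1 y x
    have e6 := (hG (n+1)).2.1 y x
    have hK := hg.nonneg
    have e7 : K * (1/2)^(n+1) ≤ K * (1/2)^n := by rw [pow_succ]; nlinarith [mul_nonneg hK k0.le]
    refine (norm_add_le _ _).trans ?_
    have n1 := norm_sub_le (q y x (h n y x) + b y x (p n y x) + c y x * w n y x) (l * w n y x)
    have n2 := norm_add_le (q y x (h n y x) + b y x (p n y x)) (c y x * w n y x)
    have n3 := norm_add_le (q y x (h n y x)) (b y x (p n y x))
    have n4 := norm_sub_le (G n y x) (G (n+1) y x)
    calc _ ≤ B * (A2 * K * (1/2)^n) + B * (A1 * K * (1/2)^n) + B * (A1 * K * (1/2)^n) + |l| * (A1 * K * (1/2)^n) + (K * (1/2)^n + K * (1/2)^n) := by linarith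
      _ = _ := by ring

end ser

section appr
variable {d : ℕ} {α : ℝ}

set_option maxHeartbeats 1600000 in
lemma approx {ι : Type*} [Fintype ι] {B C D ε l K : ℝ} (hB : 1 ≤ B) (hC : 1 ≤ C) (hD : 1 ≤ D) (hε0 : 0 ≤ ε) (hε : ε * C ≤ 1/4)
    {q : ℝ → Euc d → Bil d →L[ℝ] ℝ} {b : ℝ → Euc d → Lin d →L[ℝ] ℝ} {c : ℝ → Euc d → ℝ}
    (hq : Nn α B q) (hb : Nn α B b) (hc : Nn α B c)
    {η : ι → ℝ → Euc d → ℝ} {dη : ι → ℝ → Euc d → Lin d} {ddη : ι → ℝ → Euc d → Bil d} {e : ι → ℝ → Euc d → ℝ}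
    (hη : ∀ i, Cut α D (η i) (dη i) (ddη i) (e i)) (h0 : ∀ i t x, 0 ≤ η i t x) (h1 : ∀ t x, ∑ i, η i t x = 1)
    (qq : ι → Bil d →L[ℝ] ℝ) (hα : 0 < α) (hqB : ∀ i, ‖qq i‖ ≤ B) (hqe : ∀ i t x, η i t x ≠ 0 → ‖q t x - qq i‖ ≤ ε)
    {m : ℝ} (hm0 : 0 ≤ m) (hm1 : m ≤ 1) (hm : 120 * (Fintype.card ι) * B * D * C * m ≤ 1)
    {g : ℝ → Euc d → ℝ} (hg : Nn α K g)
    (hsol : ∀ i, ∃ u p H, Jet u p H ∧ Nn α (C * m * K) u ∧ Nn α (C * m * K) p ∧ Nn α (C * K) H ∧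
      (∀ t x, ‖H t x‖ ≤ C * m * K) ∧ ∀ t x, HasDerivAt (fun t => u t x) (qq i (H t x) - l * u t x + g t x) t) :
    ∃ w p H r, Jet w p H ∧ Nn α (8 * Fintype.card ι * D * C * m * K) w ∧ Nn α (8 * Fintype.card ι * D * C * m * K) p ∧
      Nn α (8 * Fintype.card ι * D * C * K) H ∧ Nn α (K * (1/2)) r ∧
      ∀ t x, HasDerivAt (fun t => w t x) (q t x (H t x) + b t x (p t x) + c t x * w t x - l * w t x + (g t x - r t x)) t := by
  choose u p H hJ hu hp hH hHb ht using hsol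
  have hK := hg.nonneg
  set n : ℝ := (Fintype.card ι : ℝ) with hn
  have hn0 : 0 ≤ n := by positivity
  set k := C * m * K with hk
  have hk0 : 0 ≤ k := by positivity
  have hkK : k ≤ C * K := by rw [hk]; nlinarith [mul_nonneg (by linarith : 0 ≤ C) hK]
  have cardsum : ∀ r : ℝ, ∑ i : ι, r = n * r := fun r => by simp [hn]
  have hX : ∀ i, Nn α (4 * D * B) (fun t x => η i t x • (q t x - qq i)) := fun i =>
    ((hη i).n0.smul (hq.sub (Nn.const hα (qq i)))).mono (by have := hqB i; nlinarith)
  have hXe : ∀ i t x, ‖η i t x • (q t x - qq i)‖ ≤ η i t x * ε := fun i t x => by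
    rw [norm_smul, Real.norm_of_nonneg (h0 i t x)]
    by_cases hz : η i t x = 0
    · simp [hz]
    · have := hqe i t x hz; have := h0 i t x; gcongr
  -- main residual
  have hF : Nn α (ε * C * K + n * (4 * D * B) * k) (fun t x => ∑ i, (η i t x • (q t x - qq i)) (H i t x)) := by
    refine ⟨continuous_finsetSum _ fun i _ => ((hX i).1.clm_apply (hH i).1), fun t x => ?_, fun t x y => ?_⟩
    · calc _ ≤ ∑ i, η i t x * ε * (C * K) := norm_sum_le_of_le _ fun i _ => (ContinuousLinearMap.le_opNorm _ _).trans
            (mul_le_mul (hXe i t x) ((hH i).2.1 t x) (norm_nonneg _) (mul_nonneg (h0 i t x) hε0))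
        _ = ε * C * K := by rw [← Finset.sum_mul, ← Finset.sum_mul, h1]; ring
        _ ≤ _ := by have : 0 ≤ n * (4 * D * B) * k := by positivity
                    linarith
    · rw [← Finset.sum_sub_distrib]
      calc _ ≤ ∑ i, (η i t x * ε * (C * K * ‖x-y‖^α) + 4 * D * B * ‖x-y‖^α * k) := norm_sum_le_of_le _ fun i _ => by
            have e1 : (η i t x • (q t x - qq i)) (H i t x) - (η i t y • (q t y - qq i)) (H i t y) =
              (η i t x • (q t x - qq i)) (H i t x - H i t y) + (η i t x • (q t x - qq i) - η i t y • (q t y - qq i)) (H i t y) := by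
              simp only [map_sub, sub_apply]; ring
            rw [e1]
            refine (norm_add_le _ _).trans (add_le_add ?_ ?_)
            · exact (ContinuousLinearMap.le_opNorm _ _).trans
                (mul_le_mul (hXe i t x) ((hH i).2.2 t x y) (norm_nonneg _) (mul_nonneg (h0 i t x) hε0))
            · exact (ContinuousLinearMap.le_opNorm _ _).trans
                (mul_le_mul ((hX i).2.2 t x y) (hHb i t y) (norm_nonneg _) (by positivity))
        _ = _ := by rw [Finset.sum_add_distrib, cardsum, ← Finset.sum_mul, ← Finset.sum_mul, h1]; ring
  have l1 : ∀ i, Nn α (4 * B * D * k) (fun t x => u i t x • q t x (ddη i t x)) := fun i =>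
    ((hu i).smul (hq.app (hη i).n2)).mono (by apply le_of_eq; ring)
  have l2 : ∀ i, Nn α (4 * B * D * k) (fun t x => q t x (tens d (dη i t x) (p i t x))) := fun i =>
    (hq.app (Nn.bil (tens d) tens_le (hη i).n1 (hp i))).mono (by apply le_of_eq; ring)
  have l3 : ∀ i, Nn α (4 * B * D * k) (fun t x => q t x (tens d (p i t x) (dη i t x))) := fun i =>
    (hq.app (Nn.bil (tens d) tens_le (hp i) (hη i).n1)).mono (by apply le_of_eq; ring)
  have l4 : ∀ i, Nn α (4 * D * k) (fun t x => η i t x • p i t x + u i t x • dη i t x) := fun i =>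
    (((hη i).n0.smul (hp i)).add ((hu i).smul (hη i).n1)).mono (by apply le_of_eq; ring)
  have l5 : ∀ i, Nn α (2 * D * k) (fun t x => η i t x * u i t x) := fun i => (hη i).n0.mul (hu i)
  have l6 : ∀ i, Nn α (2 * D * k) (fun t x => e i t x * u i t x) := fun i => (hη i).n3.mul (hu i)
  have lot : ∀ i, Nn α (26 * B * D * k) (fun t x => u i t x • q t x (ddη i t x) + q t x (tens d (dη i t x) (p i t x)) +
      q t x (tens d (p i t x) (dη i t x)) + b t x (η i t x • p i t x + u i t x • dη i t x) + c t x * (η i t x * u i t x) - e i t x * u i t x) := fun i =>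
    ((((((l1 i).add (l2 i)).add (l3 i)).add (hb.app (l4 i))).add (hc.mul (l5 i))).sub (l6 i)).mono (by
      nlinarith [mul_nonneg (mul_nonneg (by linarith : 0 ≤ D) hk0) (sub_nonneg.2 hB)])
  have hJ2 := Jet.sum Finset.univ fun i _ => (hη i).J.mul (hJ i)
  refine ⟨_, _, _, fun t x => ∑ i, (η i t x • (q t x - qq i)) (H i t x) + ∑ i, (u i t x • q t x (ddη i t x) + q t x (tens d (dη i t x) (p i t x)) +
      q t x (tens d (p i t x) (dη i t x)) + b t x (η i t x • p i t x + u i t x • dη i t x) + c t x * (η i t x * u i t x) - e i t x * u i t x),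
    hJ2, ?_, ?_, ?_, ?_, fun t x => ?_⟩
  · refine (Nn.sum Finset.univ fun i _ => l5 i).mono ?_
    rw [cardsum]
    have : 0 ≤ n * D * k := by positivity
    calc _ = 2 * (n * D * k) := by ring
      _ ≤ 8 * (n * D * k) := by linarith
      _ = _ := by rw [hk]; ring
  · refine (Nn.sum Finset.univ fun i _ => l4 i).mono ?_
    rw [cardsum]
    have : 0 ≤ n * D * k := by positivity
    calc _ = 4 * (n * D * k) := by ring
      _ ≤ 8 * (n * D * k) := by linarith
      _ = _ := by rw [hk]; ring
  · refine (Nn.sum Finset.univ fun i _ => ((((hη i).n0.smul (hH i)).add ((hu i).smul (hη i).n2)).add (Nn.bil (tens d) tens_le (hη i).n1 (hp i))).add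
      (Nn.bil (tens d) tens_le (hp i) (hη i).n1)).mono ?_
    rw [cardsum]
    have : n * D * k ≤ n * D * (C * K) := by gcongr
    calc _ = 2 * (n * D * (C * K)) + 6 * (n * D * k) := by rw [hk]; ring
      _ ≤ 8 * (n * D * (C * K)) := by linarith
      _ = _ := by ring
  · refine (hF.add (Nn.sum Finset.univ fun i _ => lot i)).mono ?_
    rw [cardsum]
    have a1 := mul_le_mul_of_nonneg_right hε hK
    have a2 := mul_le_mul_of_nonneg_right hm hK
    calc _ = ε * C * K + 30 * n * B * D * C * m * K := by rw [hk]; ring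
      _ ≤ _ := by linarith
  · refine (HasDerivAt.fun_sum fun i _ => ((hη i).ht t x).mul (ht i t x)).congr_deriv ?_
    have hg1 : g t x = ∑ i, η i t x * g t x := by rw [← Finset.sum_mul, h1, one_mul]
    conv_rhs => rw [hg1]
    simp only [map_sum, Finset.mul_sum]
    simp only [← Finset.sum_add_distrib, ← Finset.sum_sub_distrib]
    refine Finset.sum_congr rfl fun i _ => ?_
    simp only [map_add, map_smul, smul_apply, sub_apply, smul_eq_mul]
    ring

end appr

section m4
open scoped ContDiff Manifold
variable {d : ℕ} {α : ℝ}

structure COp (α ν B : ℝ) (q : ℝ → Euc d → Bil d →L[ℝ] ℝ) (b : ℝ → Euc d → Lin d →L[ℝ] ℝ) (c : ℝ → Euc d → ℝ) : Prop where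
  nq : Nn α B q
  nb : Nn α B b
  nc : Nn α B c
  ell : ∀ t x, Ell ν (q t x)
  cpt : ∃ (qI : Bil d →L[ℝ] ℝ) (S : Set (ℝ × Euc d)), Ell ν qI ∧ IsCompact S ∧ ∀ z ∉ S, q z.1 z.2 = qI

lemma Cut.mono {C C' : ℝ} {η : ℝ → Euc d → ℝ} {p : ℝ → Euc d → Lin d} {H : ℝ → Euc d → Bil d} {e : ℝ → Euc d → ℝ}
    (h : Cut α C η p H e) (hC : C ≤ C') : Cut α C' η p H e :=
  ⟨h.J, h.n0.mono hC, h.n1.mono hC, h.n2.mono hC, h.n3.mono hC, h.ht⟩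

lemma cut_compl (hα : 0 < α) {ι : Type*} [Fintype ι] {D : ℝ} {η : ι → ℝ → Euc d → ℝ} {p : ι → ℝ → Euc d → Lin d}
    {H : ι → ℝ → Euc d → Bil d} {e : ι → ℝ → Euc d → ℝ} (h : ∀ i, Cut α D (η i) (p i) (H i) (e i)) :
    Cut α (1 + ∑ i : ι, D) (fun t x => 1 - ∑ i, η i t x) (fun t x => 0 - ∑ i, p i t x) (fun t x => 0 - ∑ i, H i t x) (fun t x => 0 - ∑ i, e i t x) where
  J := (Jet.const fun _ => 1).sub (Jet.sum Finset.univ fun i _ => (h i).J)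
  n0 := ((Nn.const hα (1:ℝ)).sub (Nn.sum Finset.univ fun i _ => (h i).n0)).mono (by simp)
  n1 := ((Nn.const hα (0:Lin d)).sub (Nn.sum Finset.univ fun i _ => (h i).n1)).mono (by simp)
  n2 := ((Nn.const hα (0:Bil d)).sub (Nn.sum Finset.univ fun i _ => (h i).n2)).mono (by simp)
  n3 := ((Nn.const hα (0:ℝ)).sub (Nn.sum Finset.univ fun i _ => (h i).n3)).mono (by simp)
  ht t x := (hasDerivAt_const _ _).sub (HasDerivAt.fun_sum fun i _ => (h i).ht t x)

/-- partition adapted to a continuous function constant off a compact set -/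
lemma partit (hα : α ∈ Ioo (0:ℝ) 1) {q : ℝ → Euc d → Bil d →L[ℝ] ℝ} (hq : Continuous fun z : ℝ × Euc d => q z.1 z.2)
    {S : Set (ℝ × Euc d)} (hS : IsCompact S) {qI : Bil d →L[ℝ] ℝ} (hI : ∀ z ∉ S, q z.1 z.2 = qI) {ε : ℝ} (hε : 0 < ε) :
    ∃ (T : Finset (ℝ × Euc d)) (D : ℝ) (η : Option T → ℝ → Euc d → ℝ), 1 ≤ D ∧ (∀ i, ∃ p H e, Cut α D (η i) p H e) ∧
      (∀ i t x, 0 ≤ η i t x) ∧ (∀ t x, ∑ i, η i t x = 1) ∧ (∀ t x, η none t x ≠ 0 → q t x = qI) ∧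
      (∀ (i : T) t x, η (some i) t x ≠ 0 → ‖q t x - q i.1.1 i.1.2‖ ≤ ε) := by
  let U : ℝ × Euc d → Set (ℝ × Euc d) := fun z => {y | ‖q y.1 y.2 - q z.1 z.2‖ < ε} ∩ Metric.ball z 1
  have hUo : ∀ z, IsOpen (U z) := fun z =>
    (isOpen_lt (by fun_prop) continuous_const).inter Metric.isOpen_ball
  have hUz : ∀ z, z ∈ U z := fun z => ⟨by simpa using hε, Metric.mem_ball_self one_pos⟩
  obtain ⟨T, -, hT⟩ := hS.elim_nhds_subcover U fun z _ => (hUo z).mem_nhds (hUz z)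
  obtain ⟨φ, hφ⟩ := SmoothPartitionOfUnity.exists_isSubordinate 𝓘(ℝ, ℝ × Euc d) hS.isClosed (fun i : T => U i.1) (fun i => hUo _)
    (by intro z hz; obtain ⟨i, hi, h⟩ := mem_iUnion₂.1 (hT hz); exact mem_iUnion.2 ⟨⟨i, hi⟩, h⟩)
  have hcs : ∀ i, HasCompactSupport (φ i) := fun i => (isCompact_closedBall i.1 1).of_isClosed_subset (isClosed_tsupport _)
    ((hφ i).trans (inter_subset_right.trans Metric.ball_subset_closedBall))
  choose C hC using fun i => cut_mk hα (contMDiff_iff_contDiff.1 (φ i).contMDiff) (hcs i)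
  have hC0 : ∀ i, 0 ≤ C i := fun i => (hC i).n0.nonneg
  set D0 := ∑ i, C i
  have hD0 : 0 ≤ D0 := Finset.sum_nonneg fun i _ => hC0 i
  have hC2 := fun i => (hC i).mono (Finset.single_le_sum (fun i _ => hC0 i) (Finset.mem_univ i) : C i ≤ D0)
  have hN := cut_compl hα.1 hC2
  have hsum : ∀ z, ∑ i, φ i z ≤ 1 := fun z => by simpa [finsum_eq_sum_of_fintype] using φ.sum_le_one z
  have hsum1 : ∀ z ∈ S, ∑ i, φ i z = 1 := fun z hz => by simpa [finsum_eq_sum_of_fintype] using φ.sum_eq_one hz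
  have hs0 : (0:ℝ) ≤ ∑ i : T, D0 := Finset.sum_nonneg fun i _ => hD0
  refine ⟨T, 1 + ∑ i : T, D0 + D0, fun i => i.elim (fun t x => 1 - ∑ i, φ i (t,x)) fun i t x => φ i (t,x), by linarith, ?_, ?_, ?_, ?_, ?_⟩
  · rintro (_ | i)
    · exact ⟨_, _, _, hN.mono (by linarith)⟩
    · exact ⟨_, _, _, (hC2 i).mono (by linarith)⟩
  · rintro (_ | i) t x
    · simpa using hsum (t,x)
    · exact φ.nonneg i _
  · intro t x; simp
  · intro t x h
    refine hI (t,x) fun hz => h ?_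
    exact sub_eq_zero.2 (hsum1 _ hz).symm
  · intro i t x h
    exact (hφ i (subset_tsupport _ h)).1.le

theorem M4 (hα : α ∈ Ioo (0:ℝ) 1) {ν B : ℝ} (hν : 0 < ν) {q : ℝ → Euc d → Bil d →L[ℝ] ℝ} {b : ℝ → Euc d → Lin d →L[ℝ] ℝ} {c : ℝ → Euc d → ℝ}
    (h : COp α ν B q b c) : ∃ C l0 : ℝ, 1 ≤ C ∧ 1 ≤ l0 ∧ ∀ l ≥ l0, ∀ K g, Nn α K g →
    ∃ w p H, Jet w p H ∧ Nn α (C * l^(-(α/2)) * K) w ∧ Nn α (C * l^(-(α/2)) * K) p ∧ Nn α (C * K) H ∧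
    ∀ t x, HasDerivAt (fun t => w t x) (q t x (H t x) + b t x (p t x) + c t x * w t x - l * w t x + g t x) t := by
  obtain ⟨qI, S, hEI, hS, hI⟩ := h.cpt
  have hB0 := h.nc.nonneg
  set B' := 1 + B + ‖qI‖
  have hB1 : 1 ≤ B' := by have := norm_nonneg qI; simp only [B']; linarith
  have hBB : B ≤ B' := by have := norm_nonneg qI; simp only [B']; linarith
  obtain ⟨C, hC, hM⟩ := M2 d hα hν B'
  obtain ⟨T, D, η, hD, hcut, h0, h1, hn, hs⟩ := partit hα h.nq.1 hS hI (by positivity : 0 < 1/(4*C))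
  choose dη ddη e hcut using hcut
  let qq : Option T → Bil d →L[ℝ] ℝ := fun i => i.elim qI fun i => q i.1.1 i.1.2
  have hqB : ∀ i, ‖qq i‖ ≤ B' := by
    rintro (_ | i)
    · simp only [qq, Option.elim, B']; linarith
    · exact (h.nq.2.1 _ _).trans hBB
  have hqE : ∀ i, Ell ν (qq i) := by
    rintro (_ | i)
    · exact hEI
    · exact h.ell _ _
  have hqe : ∀ i t x, η i t x ≠ 0 → ‖q t x - qq i‖ ≤ 1/(4*C) := by
    rintro (_ | i) t x hne
    · rw [hn t x hne]; simp only [qq, Option.elim, sub_self, norm_zero]; positivity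
    · exact hs i t x hne
  set n : ℝ := (Fintype.card (Option T) : ℝ) with hnn
  have hn1 : 1 ≤ n := by rw [hnn]; exact_mod_cast Fintype.card_pos
  have hlim : Tendsto (fun l : ℝ => 120 * n * B' * D * C * l^(-(α/2))) atTop (𝓝 0) := by
    simpa using (tendsto_rpow_neg_atTop (by linarith [hα.1] : 0 < α/2)).const_mul (120 * n * B' * D * C)
  obtain ⟨l1, hl1⟩ := eventually_atTop.1 (hlim.eventually_le_const one_pos)
  refine ⟨16 * n * D * C, max l1 1, ?_, le_max_right _ _, fun l hl K g hg => ?_⟩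
  · have : 1 ≤ n * D * C := one_le_mul_of_one_le_of_one_le (one_le_mul_of_one_le_of_one_le hn1 hD) hC
    linarith
  have hl' : 1 ≤ l := (le_max_right _ _).trans hl
  have hm0 : 0 ≤ l^(-(α/2)) := Real.rpow_nonneg (by linarith) _
  have hm1 : l^(-(α/2)) ≤ 1 := Real.rpow_le_one_of_one_le_of_nonpos hl' (by linarith [hα.1])
  obtain ⟨w, p, H, hJ, hw, hp, hH, ht⟩ := series (A1 := 8 * n * D * C * l^(-(α/2))) (A2 := 8 * n * D * C) (l := l) h.nq.2.1 h.nb.2.1 h.nc.2.1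
    (fun K g hg => approx hB1 hC hD (by positivity) (by field_simp; norm_num) (h.nq.mono hBB) (h.nb.mono hBB) (h.nc.mono hBB) hcut h0 h1 qq hα.1 hqB hqe
      hm0 hm1 (hl1 l ((le_max_left _ _).trans hl)) hg fun i => by
        obtain ⟨Q, hs, he, hQ⟩ := hqE i
        have := hM Q hs he (fun ξ => (Ell.upper ξ).trans (by rw [← hQ]; have := hqB i; gcongr)) l K hl' g hg
        rw [hQ]
        simpa only [qf_apply] using this) hg
  exact ⟨w, p, H, hJ, hw.mono (by apply le_of_eq; ring), hp.mono (by apply le_of_eq; ring), hH.mono (by apply le_of_eq; ring), ht⟩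

end m4

section step
variable {d : ℕ} {α : ℝ}

lemma nn_interp (hα : α ∈ Ioo (0:ℝ) 1) {w : ℝ → Euc d → ℝ} {p : ℝ → Euc d → Lin d} {K M l : ℝ} (hl : 1 ≤ l)
    (hw : ∀ t x, HasFDerivAt (w t) (p t x) x) (hc : Continuous fun z : ℝ × Euc d => w z.1 z.2)
    (hp : ∀ t x, ‖p t x‖ ≤ K) (hM : ∀ t x, |w t x| ≤ M) : Nn α (l⁻¹ * K + 2 * l^((1-α)⁻¹ - 1) * M) w := by
  have hK : 0 ≤ K := (norm_nonneg _).trans (hp 0 0)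
  have hM0 : 0 ≤ M := (abs_nonneg _).trans (hM 0 0)
  have h1 : 0 < 1 - α := by linarith [hα.2]
  have he : 1 ≤ (1-α)⁻¹ := (one_le_inv₀ h1).2 (by linarith [hα.1])
  have hl0 : 0 < l := by linarith
  have hli : 0 < l⁻¹ := by positivity
  have hp1 : 1 ≤ l^((1-α)⁻¹ - 1) := Real.one_le_rpow hl (by linarith)
  refine ⟨hc, fun t x => (hM t x).trans ?_, fun t x y => ?_⟩
  · have : 0 ≤ l⁻¹ * K := by positivity
    nlinarith
  · set r := ‖x - y‖ with hr
    have hr0 : 0 ≤ r := norm_nonneg _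
    set ρ := l^(-(1-α)⁻¹) with hρ
    have hρ0 : 0 < ρ := Real.rpow_pos_of_pos hl0 _
    have e1 : ρ^(1-α) = l⁻¹ := by
      rw [hρ, ← Real.rpow_mul hl0.le, neg_mul, inv_mul_cancel₀ h1.ne', Real.rpow_neg_one]
    have e2 : ρ^(-α) = l^((1-α)⁻¹ - 1) := by
      rw [hρ, ← Real.rpow_mul hl0.le]; congr 1; field_simp; ring
    have hra := Real.rpow_nonneg hr0 α
    rcases le_total r ρ with h | h
    · have a1 : r = r^α * r^(1-α) := by
        rcases hr0.eq_or_lt with h0 | h0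
        · rw [← h0, Real.zero_rpow hα.1.ne']; simp
        · rw [← Real.rpow_add h0]; simp
      have a2 : r^(1-α) ≤ l⁻¹ := by rw [← e1]; exact Real.rpow_le_rpow hr0 h h1.le
      calc _ ≤ K * r := lip_of_deriv (hw t) (hp t) x y
        _ = K * r^α * r^(1-α) := by rw [mul_assoc, ← a1]
        _ ≤ K * r^α * l⁻¹ := by gcongr
        _ ≤ K * r^α * l⁻¹ + 2 * l^((1-α)⁻¹ - 1) * M * r^α := by
            have : 0 ≤ 2 * l^((1-α)⁻¹ - 1) * M * r^α := by positivity
            linarith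
        _ = _ := by ring
    · have a1 : 1 ≤ ρ^(-α) * r^α := by
        have : ρ^α ≤ r^α := Real.rpow_le_rpow hρ0.le h hα.1.le
        rw [Real.rpow_neg hρ0.le, inv_mul_eq_div]
        exact (one_le_div (Real.rpow_pos_of_pos hρ0 _)).2 this
      calc _ ≤ |w t x| + |w t y| := abs_sub _ _
        _ ≤ 2 * M * 1 := by linarith [hM t x, hM t y]
        _ ≤ 2 * M * (ρ^(-α) * r^α) := by gcongr
        _ ≤ l⁻¹ * K * r^α + 2 * M * (ρ^(-α) * r^α) := by
            have : 0 ≤ l⁻¹ * K * r^α := by positivity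
            linarith
        _ = _ := by rw [e2]; ring

lemma cut_zero {D : ℝ} {η : ℝ → Euc d → ℝ} {p : ℝ → Euc d → Lin d} {H : ℝ → Euc d → Bil d} {e : ℝ → Euc d → ℝ}
    (h : Cut α D η p H e) {t : ℝ} {x : Euc d} (hz : ∀ᶠ z : ℝ × Euc d in 𝓝 (t,x), η z.1 z.2 = 0) :
    η t x = 0 ∧ p t x = 0 ∧ H t x = 0 ∧ e t x = 0 := by
  have hx : ∀ᶠ y in 𝓝 x, η t y = 0 := (by fun_prop : ContinuousAt (fun y : Euc d => (t, y)) x).eventually hz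
  have ht : ∀ᶠ τ in 𝓝 t, η τ x = 0 := (by fun_prop : ContinuousAt (fun y : ℝ => (y, x)) t).eventually hz
  have hp : ∀ᶠ y in 𝓝 x, p t y = 0 := by
    filter_upwards [eventually_eventually_nhds.2 hx] with y hy
    exact (h.J.h1 t y).unique ((hasFDerivAt_const (0:ℝ) y).congr_of_eventuallyEq hy)
  exact ⟨hz.self_of_nhds, hp.self_of_nhds, (h.J.h2 t x).unique ((hasFDerivAt_const (0 : Lin d) x).congr_of_eventuallyEq hp),
    (h.ht t x).unique ((hasDerivAt_const t (0:ℝ)).congr_of_eventuallyEq ht)⟩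

/-- solver property at level `l` -/
def Slv (α C l : ℝ) (q : ℝ → Euc d → Bil d →L[ℝ] ℝ) (b : ℝ → Euc d → Lin d →L[ℝ] ℝ) (c : ℝ → Euc d → ℝ) : Prop :=
  ∀ K g, Nn α K g →
    ∃ w p H, Jet w p H ∧ Nn α (C * l^(-(α/2)) * K) w ∧ Nn α (C * l^(-(α/2)) * K) p ∧ Nn α (C * K) H ∧
    ∀ t x, HasDerivAt (fun t => w t x) (q t x (H t x) + b t x (p t x) + c t x * w t x - l * w t x + g t x) t

lemma Jet.unique {u : ℝ → Euc d → ℝ} {p p' : ℝ → Euc d → Lin d} {H H' : ℝ → Euc d → Bil d} (h : Jet u p H) (h' : Jet u p' H') :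
    p = p' ∧ H = H' := by
  have e : p = p' := by funext t x; exact (h.h1 t x).unique (h'.h1 t x)
  subst e
  exact ⟨rfl, by funext t x; exact (h.h2 t x).unique (h'.h2 t x)⟩

set_option maxHeartbeats 1600000 in
lemma int_step {ν B C D W K l a : ℝ} (hν : 0 < ν) (hB : 1 ≤ B) (hlB : B < l)
    {q : ℝ → Euc d → Bil d →L[ℝ] ℝ} {b : ℝ → Euc d → Lin d →L[ℝ] ℝ} {c : ℝ → Euc d → ℝ}
    (h : COp α ν B q b c) (hS : Slv α C l q b c)
    {η : ℝ → Euc d → ℝ} {dη : ℝ → Euc d → Lin d} {ddη : ℝ → Euc d → Bil d} {e : ℝ → Euc d → ℝ} (hη : Cut α D η dη ddη e)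
    {v w1 : ℝ → Euc d → ℝ} {p p1 : ℝ → Euc d → Lin d} {H : ℝ → Euc d → Bil d} (hJ : Jet v p H) (hv : Nn α a v)
    (hw1 : Nn α W w1) (hp1 : Nn α K p1)
    (hz : ∀ t x, (∀ᶠ z : ℝ × Euc d in 𝓝 (t,x), η z.1 z.2 = 0) ∨ (w1 t x = v t x ∧ p1 t x = p t x ∧
      HasDerivAt (fun t => v t x) (q t x (H t x) + b t x (p t x) + c t x * v t x) t))
    {S : ℝ} (hSS : S = 2 * (5 * B * D + l * D) * W + 8 * B * D * K) :
    Nn α (C * l^(-(α/2)) * S) (fun t x => η t x * v t x) ∧ Nn α (C * l^(-(α/2)) * S) (fun t x => η t x • p t x + v t x • dη t x) ∧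
    Nn α (C * S) (fun t x => η t x • H t x + v t x • ddη t x + tens d (dη t x) (p t x) + tens d (p t x) (dη t x)) ∧
    ∃ e' : ℝ → Euc d → ℝ, (∀ t x, HasDerivAt (fun t => η t x * v t x) (e' t x) t) ∧
      ∀ t x, |e' t x| ≤ B * (C * S) + (2 * B + l) * (C * l^(-(α/2)) * S) + S := by
  have hD0 := hη.n0.nonneg
  have hl0 : 0 < l := by linarith
  let g : ℝ → Euc d → ℝ := fun t x => (e t x - q t x (ddη t x) - b t x (dη t x) + l • η t x) * w1 t x
    - (q t x (tens d (dη t x) (p1 t x)) + q t x (tens d (p1 t x) (dη t x)))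
  have hg : Nn α S g := by
    refine (Nn.sub (Nn.mul ((((hη.n3.sub (h.nq.app hη.n2)).sub (h.nb.app hη.n1))).add (hη.n0.const_mul l hl0.le)) hw1)
      ((h.nq.app (Nn.bil (tens d) tens_le hη.n1 hp1)).add (h.nq.app (Nn.bil (tens d) tens_le hp1 hη.n1)))).mono ?_
    rw [hSS]
    have : D * W ≤ B * (D * W) := le_mul_of_one_le_left (mul_nonneg hD0 hw1.nonneg) hB
    nlinarith
  have hJ2 := hη.J.mul hJ
  have hgz : ∀ t x, HasDerivAt (fun t => η t x * v t x) (q t x (η t x • H t x + v t x • ddη t x + tens d (dη t x) (p t x) + tens d (p t x) (dη t x))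
      + b t x (η t x • p t x + v t x • dη t x) + c t x * (η t x * v t x) - l * (η t x * v t x) + g t x) t := fun t x => by
    rcases hz t x with hzz | ⟨hw, hp, ht⟩
    · obtain ⟨z0, z1, z2, z3⟩ := cut_zero hη hzz
      have ht : ∀ᶠ τ in 𝓝 t, η τ x = 0 := (by fun_prop : ContinuousAt (fun y : ℝ => (y, x)) t).eventually hzz
      refine (((hasDerivAt_const t (0:ℝ)).congr_of_eventuallyEq (f₁ := fun t => η t x * v t x) ?_)).congr_deriv ?_
      · filter_upwards [ht] with τ hτ; simp [hτ]
      · simp [g, z0, z1, z2, z3]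
    · refine ((hη.ht t x).mul ht).congr_deriv ?_
      simp only [g, hw, hp, map_add, map_smul, smul_eq_mul]
      ring
  obtain ⟨w, pw, Hw, hJw, nw, npw, nH, htw⟩ := hS S g hg
  have hcη : Continuous fun z : ℝ × Euc d => η z.1 z.2 * v z.1 z.2 := hη.n0.1.mul hv.1
  have heq : w = fun t x => η t x * v t x := by
    funext T x
    have := uniq (T := T) (M := C * l^(-(α/2)) * S + D * a) hν hlB h.ell h.nq.2.1 h.nb.2.1 (fun t x => (le_abs_self _).trans (h.nc.2.1 t x)) (hJw.sub hJ2)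
      (nw.1.sub hcη) (fun t x => (abs_sub _ _).trans (add_le_add (nw.2.1 t x) (by
        rw [abs_mul]; exact mul_le_mul (hη.n0.2.1 t x) (hv.2.1 t x) (abs_nonneg _) hD0)))
      (fun t _ x => ((htw t x).sub (hgz t x)).congr_deriv (by rw [map_sub (q t x), map_sub (b t x)]; ring)) x
    linarith
  subst heq
  obtain ⟨e1, e2⟩ := hJw.unique hJ2
  subst e1; subst e2
  refine ⟨nw, npw, nH, _, hgz, fun t x => ?_⟩
  have a0 := nw.2.1 t x
  have a1 := npw.2.1 t x
  have a2 := nH.2.1 t x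
  have b1 := h.nq.2.1 t x
  have b2 := h.nb.2.1 t x
  have b3 := h.nc.2.1 t x
  have a3 := hg.2.1 t x
  set m := C * l^(-(α/2)) * S
  have hm : 0 ≤ m := nw.nonneg
  have c1 : |q t x (η t x • H t x + v t x • ddη t x + tens d (dη t x) (p t x) + tens d (p t x) (dη t x))| ≤ B * (C * S) :=
    (ContinuousLinearMap.le_opNorm _ _).trans (mul_le_mul b1 a2 (norm_nonneg _) (by linarith))
  have c2 : |b t x (η t x • p t x + v t x • dη t x)| ≤ B * m :=
    (ContinuousLinearMap.le_opNorm _ _).trans (mul_le_mul b2 a1 (norm_nonneg _) (by linarith))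
  have c3 : |c t x * (η t x * v t x)| ≤ B * m := by
    rw [abs_mul]; exact mul_le_mul b3 a0 (abs_nonneg _) (by linarith)
  have c4 : |l * (η t x * v t x)| ≤ l * m := by
    rw [abs_mul, abs_of_pos hl0]; exact mul_le_mul_of_nonneg_left a0 hl0.le
  rw [Real.norm_eq_abs] at a3
  rw [abs_le] at *
  constructor <;> linarith [c1.1, c1.2]

end step

section int
open scoped ContDiff
variable {d : ℕ} {α : ℝ}

lemma iter (hα : α ∈ Ioo (0:ℝ) 1) {C l0 : ℝ} (hC : 1 ≤ C) : ∃ Y : ℝ, 0 ≤ Y ∧ ∀ (P : ℕ → ℝ → Prop) (M a : ℝ), 0 ≤ M → 0 ≤ a →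
    (∀ j K K', K ≤ K' → P j K → P j K') → (∀ j K, (∀ ε > 0, P j (K+ε)) → P j K) → (∀ j, P j (a * 8^j)) →
    (∀ j l K, l0 ≤ l → 0 ≤ K → P (j+1) K → P j (C * 8^j * l^(-(α/2)) * (K + l^((1-α)⁻¹) * M))) → P 0 (Y * M) := by
  obtain ⟨h0, h1⟩ := hα
  set e := (1-α)⁻¹ with he
  have he1 : 1 ≤ e := (one_le_inv₀ (by linarith)).2 (by linarith)
  set A : ℝ := 8^(2/α*e) with hA
  have hA8 : 8 ≤ A := by
    rw [hA]
    refine Real.self_le_rpow_of_one_le (by norm_num) ?_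
    have : 1 ≤ 2/α := (one_le_div h0).2 (by linarith)
    exact one_le_mul_of_one_le_of_one_le this he1
  have hlim : Tendsto (fun l : ℝ => C * l^(-(α/2)) * A) atTop (𝓝 0) := by
    simpa using ((tendsto_rpow_neg_atTop (by linarith : 0 < α/2)).const_mul C).mul_const A
  obtain ⟨L, hL1, hL2⟩ := ((hlim.eventually_le_const (by norm_num : (0:ℝ) < 1/2)).and (eventually_ge_atTop (max l0 1))).exists
  have hLl : l0 ≤ L := (le_max_left _ _).trans hL2
  have hL1' : 1 ≤ L := (le_max_right _ _).trans hL2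
  have hL0 : 0 < L := by linarith
  refine ⟨2 * L^e, by positivity, fun P M a hM ha hmono hcl hap hst => ?_⟩
  set y := L^e * M with hy
  have hy0 : 0 ≤ y := by positivity
  set κ := C * L^(-(α/2)) with hκ
  have hκ0 : 0 ≤ κ := by positivity
  have hκ1 : κ ≤ 1 := by nlinarith
  have key : ∀ x, 0 ≤ x → (∀ j, P j (x * A^j)) → ∀ j, P j ((x/2 + y) * A^j) := fun x hx h j => by
    have hr : (1:ℝ) ≤ 8^(2/α*j) := Real.one_le_rpow (by norm_num) (by positivity)
    have := hst j (L * 8^(2/α*j)) (x * A^(j+1)) (hLl.trans (le_mul_of_one_le_right hL0.le hr)) (by positivity) (h (j+1))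
    have e1 : (L * (8:ℝ)^(2/α*j))^(-(α/2)) = L^(-(α/2)) * ((8:ℝ)^j)⁻¹ := by
      rw [Real.mul_rpow hL0.le (by positivity), ← Real.rpow_mul (by norm_num), ← Real.rpow_natCast, ← Real.rpow_neg (by norm_num)]
      congr 2; field_simp
    have e2 : (L * (8:ℝ)^(2/α*j))^e = L^e * A^j := by
      rw [Real.mul_rpow hL0.le (by positivity), ← Real.rpow_mul (by norm_num), hA, ← Real.rpow_mul_natCast (by norm_num)]
      congr 2; ring
    rw [e1, e2] at this
    refine hmono _ _ _ ?_ this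
    have h8 : (0:ℝ) < 8^j := by positivity
    calc _ = κ * A * (x * A^j) + κ * (y * A^j) := by rw [hκ, hy]; field_simp; ring
      _ ≤ 1/2 * (x * A^j) + 1 * (y * A^j) := by gcongr
      _ = _ := by ring
  have hall : ∀ n : ℕ, ∀ j, P j ((a * (1/2)^n + 2 * y) * A^j) := fun n => by
    induction n with
    | zero => exact fun j => hmono _ _ _ (by
        have : (8:ℝ)^j ≤ A^j := by gcongr
        have : a * 8^j ≤ a * A^j := by gcongr
        have : 0 ≤ 2 * y * A^j := by positivity
        simp only [pow_zero, mul_one]; linarith) (hap j)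
    | succ n ih => exact fun j => hmono _ _ _ (by apply le_of_eq; ring) (key _ (by positivity) ih j)
  refine hcl _ _ fun ε hε => ?_
  have hlim2 : Tendsto (fun n : ℕ => a * (1/2:ℝ)^n) atTop (𝓝 0) := by
    simpa using (tendsto_pow_atTop_nhds_zero_of_lt_one (by norm_num : (0:ℝ) ≤ 1/2) (by norm_num)).const_mul a
  obtain ⟨n, hn⟩ := (hlim2.eventually_le_const hε).exists
  exact hmono _ _ _ (by simp only [pow_zero, mul_one]; rw [hy]; linarith) (hall n 0)

lemma Nn.closed {F : Type*} [NormedAddCommGroup F] {g : ℝ → Euc d → F} {K : ℝ} (h : ∀ ε > 0, Nn α (K + ε) g) : Nn α K g := by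
  refine ⟨(h 1 one_pos).1, fun t x => le_of_forall_pos_le_add fun ε hε => (h ε hε).2.1 t x, fun t x y => ?_⟩
  have hlim : Tendsto (fun ε : ℝ => (K + ε) * ‖x-y‖^α) (𝓝[>] 0) (𝓝 ((K + 0) * ‖x-y‖^α)) :=
    ((continuous_const.add continuous_id).mul continuous_const).continuousAt.mono_left nhdsWithin_le_nhds
  rw [add_zero] at hlim
  exact ge_of_tendsto hlim (by filter_upwards [self_mem_nhdsWithin] with ε hε; exact (h ε hε).2.2 t x y)

set_option maxHeartbeats 1600000 in
theorem M5 (hα : α ∈ Ioo (0:ℝ) 1) {ν B : ℝ} (hν : 0 < ν) {q : ℝ → Euc d → Bil d →L[ℝ] ℝ} {b : ℝ → Euc d → Lin d →L[ℝ] ℝ} {c : ℝ → Euc d → ℝ}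
    (h : COp α ν B q b c) {ψ : ℝ × Euc d → ℝ} (hψ : ContDiff ℝ ∞ ψ) (hs : HasCompactSupport ψ) :
    ∃ K0 : ℝ, 0 ≤ K0 ∧ ∀ v p H a M, Jet v p H → Nn α a v → Nn α a p → 0 ≤ M →
      (∀ t x, 0 < ψ (t,x) → |v t x| ≤ M ∧ HasDerivAt (fun t => v t x) (q t x (H t x) + b t x (p t x) + c t x * v t x) t) →
      ∃ (p' : ℝ → Euc d → Lin d) (H' : ℝ → Euc d → Bil d) (e' : ℝ → Euc d → ℝ), Jet (fun t x => Real.smoothTransition (2 * ψ (t,x) - 1) * v t x) p' H' ∧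
        Nn α (K0 * M) (fun t x => Real.smoothTransition (2 * ψ (t,x) - 1) * v t x) ∧ Nn α (K0 * M) p' ∧ Nn α (K0 * M) H' ∧
        (∀ t x, HasDerivAt (fun t => Real.smoothTransition (2 * ψ (t,x) - 1) * v t x) (e' t x) t) ∧ ∀ t x, |e' t x| ≤ K0 * M := by
  wlog hB : 1 ≤ B generalizing B
  · exact this ⟨h.nq.mono (le_of_not_ge hB), h.nb.mono (le_of_not_ge hB), h.nc.mono (le_of_not_ge hB), h.ell, h.cpt⟩ le_rfl
  obtain ⟨C4, l4, hC4, hl4, hM4⟩ := M4 hα hν h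
  obtain ⟨C1, hC1, hcf⟩ := cut_family hα hψ hs
  set e := (1-α)⁻¹ with he
  set l0 := max l4 (B+1) with hl0
  have hk1 : ∀ j : ℕ, (1:ℝ) ≤ 2 * 2^j := fun j => by have := one_le_pow₀ (n := j) (by norm_num : (1:ℝ) ≤ 2); linarith
  choose dη ddη ee hcut using fun j : ℕ => hcf (2 * 2^j) (hk1 j)
  set η : ℕ → ℝ → Euc d → ℝ := fun j t x => Real.smoothTransition (2 * 2^j * ψ (t,x) - 1) with hη
  have hcut' : ∀ j, Cut α (8 * C1 * 8^j) (η j) (dη j) (ddη j) (ee j) := fun j => (hcut j).mono (by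
    apply le_of_eq; rw [mul_pow, ← pow_mul, mul_comm j 3, pow_mul]; norm_num; ring)
  obtain ⟨Y, hY, hit⟩ := iter hα (C := C4 * (24 * 64 * B * C1)) (l0 := l0) (one_le_mul_of_one_le_of_one_le hC4 (by nlinarith))
  have hl00 : 1 ≤ l0 := hl4.trans (le_max_left _ _)
  set s := 24 * B * (8 * C1) * (Y + l0^e) with hss
  have hs0 : 0 ≤ s := by positivity
  set K0 := C4 * l0^(-(α/2)) * s + C4 * s + (B * (C4 * s) + (2 * B + l0) * (C4 * l0^(-(α/2)) * s) + s) with hK0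
  have q1 : 0 ≤ C4 * l0^(-(α/2)) * s := by positivity
  have q2 : 0 ≤ C4 * s := by positivity
  have q3 : 0 ≤ B * (C4 * s) + (2 * B + l0) * (C4 * l0^(-(α/2)) * s) + s := by positivity
  refine ⟨K0, by positivity, fun v p H a M hJ hv hp hM hloc => ?_⟩
  let G : ℕ → ℝ → Euc d → Lin d := fun j t x => η j t x • p t x + v t x • dη j t x
  have hη0 : ∀ j t x, 0 ≤ η j t x := fun j t x => Real.smoothTransition.nonneg _
  have hη1 : ∀ j t x, η j t x ≤ 1 := fun j t x => Real.smoothTransition.le_one _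
  have hwM : ∀ j t x, |η j t x * v t x| ≤ M := fun j t x => by
    rcases le_or_gt (ψ (t,x)) 0 with h0 | h0
    · have : η j t x = 0 := Real.smoothTransition.zero_of_nonpos (by have := hk1 j; nlinarith)
      simpa [this] using hM
    · rw [abs_mul, abs_of_nonneg (hη0 j t x)]
      exact (mul_le_of_le_one_left (abs_nonneg _) (hη1 j t x)).trans (hloc t x h0).1
  have hz : ∀ j t x, (∀ᶠ z : ℝ × Euc d in 𝓝 (t,x), η j z.1 z.2 = 0) ∨ (η (j+1) t x * v t x = v t x ∧ G (j+1) t x = p t x ∧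
      HasDerivAt (fun t => v t x) (q t x (H t x) + b t x (p t x) + c t x * v t x) t) := fun j t x => by
    have hk := hk1 j
    rcases lt_or_ge (2 * 2^j * ψ (t,x)) 1 with h0 | h0
    · left
      have : ∀ᶠ z : ℝ × Euc d in 𝓝 (t,x), 2 * 2^j * ψ z < 1 :=
        (continuous_const.mul hψ.continuous).continuousAt.eventually_lt_const h0
      filter_upwards [this] with z hz
      exact Real.smoothTransition.zero_of_nonpos (by linarith)
    · right
      have h1 : η (j+1) t x = 1 := Real.smoothTransition.one_of_one_le (by rw [pow_succ]; linarith)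
      have h2 : dη (j+1) t x = 0 := by
        have hmax : IsLocalMax (η (j+1) t) x := Eventually.of_forall fun y => by rw [h1]; exact hη1 _ _ _
        exact hmax.hasFDerivAt_eq_zero ((hcut' (j+1)).J.h1 t x)
      have h3 : 0 < ψ (t,x) := by by_contra hn; push Not at hn; nlinarith
      exact ⟨by rw [h1, one_mul], by simp only [G, h1, h2, one_smul, smul_zero, add_zero], (hloc t x h3).2⟩
  have step := fun j l (hl : l0 ≤ l) K (hK : Nn α K (G (j+1))) =>
    int_step (C := C4) hν hB (by have := (le_max_right l4 (B+1)).trans hl; linarith) h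
      (hM4 l ((le_max_left _ _).trans hl)) (hcut' j) hJ hv
      (nn_interp hα (hl00.trans hl) (fun t x => ((hcut' (j+1)).J.mul hJ).h1 t x) ((hcut' (j+1)).n0.1.mul hv.1) hK.2.1 (hwM (j+1))) hK (hz j) rfl
  have hSle : ∀ D l K : ℝ, 0 ≤ D → l0 ≤ l → 0 ≤ K → 2 * (5 * B * D + l * D) * (l⁻¹ * K + 2 * l^(e-1) * M) + 8 * B * D * K ≤
      24 * B * D * (K + l^e * M) := fun D l K hD hl hK => by
    have hl1 : 1 ≤ l := hl00.trans hl
    have hlp : 0 < l := by linarith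
    have a1 : 5 * B * D + l * D ≤ 6 * B * D * l := by
      have : B * D ≤ B * D * l := le_mul_of_one_le_right (by positivity) hl1
      have : l * D ≤ B * (l * D) := le_mul_of_one_le_left (by positivity) hB
      nlinarith
    have a2 : l * l^(e-1) = l^e := by rw [Real.rpow_sub_one hlp.ne']; field_simp
    have a3 : 0 ≤ B * D * K := by positivity
    calc _ ≤ 2 * (6 * B * D * l) * (l⁻¹ * K + 2 * l^(e-1) * M) + 8 * B * D * K := by gcongr
      _ = 20 * (B * D * K) + 24 * B * D * ((l * l^(e-1)) * M) := by field_simp; ring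
      _ ≤ _ := by rw [a2]; linarith
  have hP0 : Nn α (Y * M) (G 1) := by
    refine hit (fun j K => Nn α K (G (j+1))) M (256 * a * C1) hM (by have := hv.nonneg; positivity) (fun j K K' hK hn => hn.mono hK)
      (fun j K hh => Nn.closed hh) (fun j => ?_) (fun j l K hl hK hP => ?_)
    · refine (((hcut' (j+1)).n0.smul hp).add (hv.smul (hcut' (j+1)).n1)).mono (by apply le_of_eq; ring)
    · refine ((step (j+1) l hl K hP).2.1).mono ?_
      have hlp : 0 < l := by linarith [hl00.trans hl]
      calc _ ≤ C4 * l^(-(α/2)) * (24 * B * (8 * C1 * 8^(j+1)) * (K + l^e * M)) := by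
            gcongr
            exact hSle _ l K (by positivity) hl hK
        _ = _ := by ring
  obtain ⟨n0, n1, n2, e', ht, hb'⟩ := step 0 l0 le_rfl _ hP0
  have hfin := hSle (8 * C1 * 8^0) l0 (Y * M) (by positivity) le_rfl (by positivity)
  have hfin' : 24 * B * (8 * C1 * 8^0) * (Y * M + l0^e * M) = s * M := by rw [hss]; ring
  rw [hfin'] at hfin
  rw [← he] at n0 n1 n2 hb'
  set SS := 2 * (5 * B * (8 * C1 * 8 ^ 0) + l0 * (8 * C1 * 8 ^ 0)) * (l0⁻¹ * (Y * M) + 2 * l0 ^ (e - 1) * M) + 8 * B * (8 * C1 * 8 ^ 0) * (Y * M)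
  have r1 : C4 * l0^(-(α/2)) * SS ≤ C4 * l0^(-(α/2)) * s * M := by rw [mul_assoc _ s]; gcongr
  have r2 : C4 * SS ≤ C4 * s * M := by rw [mul_assoc C4 s]; gcongr
  have eη : (fun t x => Real.smoothTransition (2 * ψ (t,x) - 1) * v t x) = fun t x => η 0 t x * v t x := by
    funext t x; simp [hη]
  have eη' : ∀ x, (fun t => Real.smoothTransition (2 * ψ (t,x) - 1) * v t x) = fun t => η 0 t x * v t x := fun x => by
    funext t; simp [hη]
  simp only [eη, eη']
  have t1 : C4 * l0^(-(α/2)) * s * M ≤ K0 * M := by gcongr; rw [hK0]; linarith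
  have t2 : C4 * s * M ≤ K0 * M := by gcongr; rw [hK0]; linarith
  have t3 : (B * (C4 * s) + (2 * B + l0) * (C4 * l0^(-(α/2)) * s) + s) * M ≤ K0 * M := by gcongr; rw [hK0]; linarith
  refine ⟨_, _, e', (hcut' 0).J.mul hJ, n0.mono (r1.trans t1), n1.mono (r1.trans t1), n2.mono (r2.trans t2), ht, fun t x => (hb' t x).trans (le_trans ?_ t3)⟩
  calc _ ≤ B * (C4 * s * M) + (2 * B + l0) * (C4 * l0^(-(α/2)) * s * M) + s * M := by gcongr
    _ = _ := by ring

end int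

section lop
open scoped ContDiff Manifold
variable {d : ℕ} {α : ℝ} {F : Type*} [NormedAddCommGroup F] [NormedSpace ℝ F]

def LH (α : ℝ) (g : ℝ → Euc d → F) : Prop := Continuous (fun z : ℝ × Euc d => g z.1 z.2) ∧
  ∀ R : ℝ, ∃ L : ℝ, ∀ t x y, |t| ≤ R → ‖x‖ ≤ R → ‖y‖ ≤ R → ‖g t x - g t y‖ ≤ L * ‖x - y‖^α

lemma loc_nn (hα : α ∈ Ioo (0:ℝ) 1) {g : ℝ → Euc d → F} (hg : LH α g) {χ : ℝ × Euc d → ℝ} (h : ContDiff ℝ ∞ χ) (hs : HasCompactSupport χ) :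
    ∃ K, Nn α K (fun t x => χ (t,x) • g t x) := by
  obtain ⟨D, hD⟩ := nn_smooth hα h hs
  have hD0 := hD.nonneg
  obtain ⟨R, hR⟩ := hs.isCompact.isBounded.subset_closedBall 0
  have hz : ∀ t x, ¬ (|t| ≤ R ∧ ‖x‖ ≤ R) → χ (t,x) = 0 := fun t x hn => by
    by_contra hne
    have := hR (subset_tsupport _ hne)
    rw [mem_closedBall_zero_iff, Prod.norm_def, max_le_iff] at this
    exact hn this
  obtain ⟨L, hL⟩ := hg.2 R
  obtain ⟨G, hG⟩ := (isCompact_closedBall (0 : ℝ × Euc d) R).exists_bound_of_continuousOn hg.1.continuousOn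
  have hG' : ∀ t x, |t| ≤ R → ‖x‖ ≤ R → ‖g t x‖ ≤ |G| := fun t x h1 h2 => (hG (t,x) (by
    rw [mem_closedBall_zero_iff, Prod.norm_def, max_le_iff]; exact ⟨h1, h2⟩)).trans (le_abs_self _)
  have hc : Continuous fun z : ℝ × Euc d => χ (z.1, z.2) • g z.1 z.2 := h.continuous.smul hg.1
  refine ⟨D * |G| + D * |L|, hc, fun t x => ?_, fun t x y => ?_⟩
  · have hp : 0 ≤ D * |L| := by positivity
    by_cases hin : |t| ≤ R ∧ ‖x‖ ≤ R
    · rw [norm_smul]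
      have := mul_le_mul (hD.2.1 t x) (hG' t x hin.1 hin.2) (norm_nonneg _) hD0
      linarith
    · show ‖χ (t,x) • g t x‖ ≤ _
      rw [hz t x hin]; simp; positivity
  · have hr := Real.rpow_nonneg (norm_nonneg (x-y)) α
    have hp : 0 ≤ D * |L| * ‖x-y‖^α := by positivity
    have key : ∀ x y, (|t| ≤ R ∧ ‖x‖ ≤ R) → ‖χ (t,x) • g t x - χ (t,y) • g t y‖ ≤ (D * |G| + D * |L|) * ‖x-y‖^α := fun x y hx => by
      have hr := Real.rpow_nonneg (norm_nonneg (x-y)) α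
      have e : χ (t,x) • g t x - χ (t,y) • g t y = (χ (t,x) - χ (t,y)) • g t x + χ (t,y) • (g t x - g t y) := by
        rw [sub_smul, smul_sub]; abel
      rw [e, add_mul]
      refine (norm_add_le _ _).trans (add_le_add ?_ ?_)
      · rw [norm_smul]
        calc _ ≤ (D * ‖x-y‖^α) * |G| := mul_le_mul (hD.2.2 t x y) (hG' t x hx.1 hx.2) (norm_nonneg _) (by positivity)
          _ = _ := by ring
      · by_cases hy : |t| ≤ R ∧ ‖y‖ ≤ R
        · rw [norm_smul, mul_assoc]
          exact mul_le_mul (hD.2.1 t y) ((hL t x y hx.1 hx.2 hy.2).trans (by gcongr; exact le_abs_self _)) (norm_nonneg _) hD0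
        · rw [hz t y hy]; simp; positivity
    show ‖χ (t,x) • g t x - χ (t,y) • g t y‖ ≤ _
    by_cases hx : |t| ≤ R ∧ ‖x‖ ≤ R
    · exact key x y hx
    · by_cases hy : |t| ≤ R ∧ ‖y‖ ≤ R
      · rw [norm_sub_rev, norm_sub_rev x y]; exact key y x hy
      · rw [hz t x hx, hz t y hy]; simp; positivity

structure LOp (α ν c0 : ℝ) (q : ℝ → Euc d → Bil d →L[ℝ] ℝ) (b : ℝ → Euc d → Lin d →L[ℝ] ℝ) (c : ℝ → Euc d → ℝ) : Prop where
  nq : LH α q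
  nb : LH α b
  nc : LH α c
  ell : ∀ t x, Ell ν (q t x)
  hc : ∀ t x, c t x ≤ c0

lemma LH.sub_const {g : ℝ → Euc d → F} (hg : LH α g) (v : F) : LH α (fun t x => g t x - v) :=
  ⟨hg.1.sub continuous_const, fun R => by
    obtain ⟨L, hL⟩ := hg.2 R
    exact ⟨L, fun t x y h1 h2 h3 => by rw [sub_sub_sub_cancel_right]; exact hL t x y h1 h2 h3⟩⟩

def qc (q : ℝ → Euc d → Bil d →L[ℝ] ℝ) (χ : ℝ × Euc d → ℝ) : ℝ → Euc d → Bil d →L[ℝ] ℝ := fun t x => χ (t,x) • q t x + (1 - χ (t,x)) • q 0 0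
def bc (b : ℝ → Euc d → Lin d →L[ℝ] ℝ) (χ : ℝ × Euc d → ℝ) : ℝ → Euc d → Lin d →L[ℝ] ℝ := fun t x => χ (t,x) • b t x
def cct (c : ℝ → Euc d → ℝ) (c0 : ℝ) (χ : ℝ × Euc d → ℝ) : ℝ → Euc d → ℝ := fun t x => χ (t,x) * c t x + (1 - χ (t,x)) * c0

lemma cop_mk (hα : α ∈ Ioo (0:ℝ) 1) {ν c0 : ℝ} {q : ℝ → Euc d → Bil d →L[ℝ] ℝ} {b : ℝ → Euc d → Lin d →L[ℝ] ℝ} {c : ℝ → Euc d → ℝ}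
    (h : LOp α ν c0 q b c) {χ : ℝ × Euc d → ℝ} (hχ : ContDiff ℝ ∞ χ) (hs : HasCompactSupport χ) (h0 : ∀ z, 0 ≤ χ z) (h1 : ∀ z, χ z ≤ 1) :
    (∃ B, COp α ν B (qc q χ) (bc b χ) (cct c c0 χ)) ∧ ∀ t x, cct c c0 χ t x ≤ c0 := by
  obtain ⟨B1, n1⟩ := loc_nn hα (h.nq.sub_const (q 0 0)) hχ hs
  obtain ⟨B2, n2⟩ := loc_nn hα h.nb hχ hs
  obtain ⟨B3, n3⟩ := loc_nn hα (h.nc.sub_const c0) hχ hs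
  have m1 := n1.add (Nn.const hα.1 (q 0 0))
  have m3 := n3.add (Nn.const hα.1 c0)
  have e1 : qc q χ = fun t x => χ (t,x) • (q t x - q 0 0) + q 0 0 := by
    funext t x; simp only [qc]; module
  have e3 : cct c c0 χ = fun t x => χ (t,x) • (c t x - c0) + c0 := by
    funext t x; simp only [cct, smul_eq_mul]; ring
  have p1 := m1.nonneg
  have p2 := n2.nonneg
  have p3 := m3.nonneg
  refine ⟨⟨(B1 + ‖q 0 0‖) + B2 + (B3 + ‖c0‖), ?_, n2.mono (by linarith), ?_, fun t x => (h.ell t x).mix (h.ell 0 0) (h0 _) (h1 _), q 0 0, tsupport χ, h.ell 0 0, hs, fun z hz => ?_⟩, fun t x => ?_⟩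
  · rw [e1]; exact m1.mono (by linarith)
  · rw [e3]; exact m3.mono (by linarith)
  · simp only [qc, Prod.mk.eta, image_eq_zero_of_notMem_tsupport hz]; simp
  · have := mul_le_mul_of_nonneg_left (h.hc t x) (h0 (t,x))
    simp only [cct]; linarith

/-- smooth approximation of a continuous function -/
lemma smooth_approx {f : Euc d → ℝ} (hf : Continuous f) {ε : ℝ} (hε : 0 < ε) : ∃ g : Euc d → ℝ, ContDiff ℝ ∞ g ∧ ∀ x, |g x - f x| ≤ ε := by
  obtain ⟨g, hg⟩ := exists_contMDiffMap_forall_mem_convex_of_local_const 𝓘(ℝ, Euc d) (n := ⊤) (t := fun x => Metric.closedBall (f x) ε)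
    (fun x => convex_closedBall _ _) (fun x => ⟨f x, by
      filter_upwards [hf.continuousAt.eventually (Metric.closedBall_mem_nhds (f x) hε)] with y hy
      exact Metric.mem_closedBall_comm.1 hy⟩)
  exact ⟨g, contMDiff_iff_contDiff.1 g.contMDiff, fun x => by simpa [Real.dist_eq] using hg x⟩

lemma Nn.comp_time {K : ℝ} {g : ℝ → Euc d → F} (h : Nn α K g) {τ : ℝ → ℝ} (hτ : Continuous τ) : Nn α K (fun t x => g (τ t) x) :=
  ⟨h.1.comp (by fun_prop : Continuous fun z : ℝ × Euc d => (τ z.1, z.2)), fun t x => h.2.1 _ _, fun t x y => h.2.2 _ _ _⟩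

lemma Nn.time {r : ℝ → ℝ} (hr : Continuous r) {R : ℝ} (h : ∀ t, |r t| ≤ R) : Nn α R (fun t (_ : Euc d) => r t) :=
  ⟨by fun_prop, fun t x => h t, fun t x y => by
    have := (abs_nonneg _).trans (h t)
    simp; positivity⟩

/-- `u` is an exact solution for `t ≥ s` -/
structure Sol (α s : ℝ) (q : ℝ → Euc d → Bil d →L[ℝ] ℝ) (b : ℝ → Euc d → Lin d →L[ℝ] ℝ) (c : ℝ → Euc d → ℝ)
    (u : ℝ → Euc d → ℝ) (p : ℝ → Euc d → Lin d) (H : ℝ → Euc d → Bil d) : Prop where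
  J : Jet u p H
  hc : Continuous fun z : ℝ × Euc d => u z.1 z.2
  bd : ∀ T, s ≤ T → ∃ a, Nn α a (fun t x => u (max s (min t T)) x) ∧ Nn α a (fun t x => p (max s (min t T)) x)
  ht : ∀ t, s ≤ t → ∀ x, HasDerivAt (fun t => u t x) (q t x (H t x) + b t x (p t x) + c t x * u t x) t

lemma init_sol (hα : α ∈ Ioo (0:ℝ) 1) {ν B s ε Kf : ℝ} (hν : 0 < ν) {q : ℝ → Euc d → Bil d →L[ℝ] ℝ} {b : ℝ → Euc d → Lin d →L[ℝ] ℝ} {c : ℝ → Euc d → ℝ}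
    (h : COp α ν B q b c) {f : Euc d → ℝ} {pf : Euc d → Lin d} {Hf : Euc d → Bil d}
    (hJ : Jet (fun _ : ℝ => f) (fun _ => pf) (fun _ => Hf)) (n0 : Nn α Kf (fun _ : ℝ => f)) (n1 : Nn α Kf (fun _ : ℝ => pf)) (n2 : Nn α Kf (fun _ : ℝ => Hf))
    (hε : 0 < ε) : ∃ u p H, Sol α s q b c u p H ∧ ∀ x, |u s x - f x| ≤ ε := by
  obtain ⟨C, l0, hC, hl0, hM⟩ := M4 hα hν h
  have hg0 := ((h.nq.app n2).add (h.nb.app n1)).add (h.nc.mul n0)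
  set K := 2 * B * Kf + 2 * B * Kf + 2 * B * Kf with hK
  have hlim : Tendsto (fun l : ℝ => C * l^(-(α/2)) * (2 * 1 * K)) atTop (𝓝 0) := by
    simpa using ((tendsto_rpow_neg_atTop (by linarith [hα.1] : 0 < α/2)).const_mul C).mul_const (2 * 1 * K)
  obtain ⟨l, hl1, hl2⟩ := ((hlim.eventually_le_const hε).and (eventually_ge_atTop l0)).exists
  have hlp : 0 < l := by linarith
  let r : ℝ → ℝ := fun t => Real.exp (- (l * (max t s - s)))
  have hr : Nn α 1 (fun t (_ : Euc d) => r t) := Nn.time (by fun_prop) fun t => by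
    rw [abs_of_pos (Real.exp_pos _)]
    exact Real.exp_le_one_iff.2 (by have := mul_nonneg hlp.le (sub_nonneg.2 (le_max_right t s)); linarith)
  obtain ⟨w, p, H, hJw, nw, np, nH, ht⟩ := hM l hl2 _ _ (hr.mul hg0)
  let E : ℝ → ℝ := fun t => Real.exp (l * (t - s))
  have hE : ∀ t, HasDerivAt E (E t * l) t := fun t => by
    have := (((hasDerivAt_id t).sub_const s).const_mul l).exp
    simpa [E] using this
  refine ⟨fun t x => f x + E t * w t x, fun t x => pf x + E t • p t x, fun t x => Hf x + E t • H t x,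
    ⟨hJ.add (hJw.sm E), ?_, fun T hT => ?_, fun t hst x => ?_⟩, fun x => ?_⟩
  · have e1 : Continuous fun z : ℝ × Euc d => E z.1 := by fun_prop
    exact n0.1.add (e1.mul nw.1)
  · have hτ : Continuous fun t => max s (min t T) := by fun_prop
    have hτb : ∀ t, |E (max s (min t T))| ≤ E T := fun t => by
      rw [abs_of_pos (Real.exp_pos _)]
      refine Real.exp_le_exp.2 (mul_le_mul_of_nonneg_left ?_ hlp.le)
      have : max s (min t T) ≤ T := max_le hT (min_le_right _ _)
      linarith
    have hEn : Nn α (E T) (fun t (_ : Euc d) => E (max s (min t T))) := Nn.time (by fun_prop) hτb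
    exact ⟨_, n0.add (hEn.mul (nw.comp_time hτ)), n1.add (hEn.smul (np.comp_time hτ))⟩
  · refine (((hE t).mul (ht t x)).const_add (f x)).congr_deriv ?_
    have e1 : E t * r t = 1 := by
      simp only [E, r, max_eq_left hst, ← Real.exp_add]; simp
    simp only [map_add, map_smul, smul_eq_mul]
    linear_combination (q t x (Hf x) + b t x (pf x) + c t x * f x) * e1
  · have : E s = 1 := by simp [E]
    simp only [this, one_mul, add_sub_cancel_left]
    exact (nw.2.1 s x).trans hl1

lemma sup_aux {ν B s m M T c0 : ℝ} (hν : 0 < ν) {q : ℝ → Euc d → Bil d →L[ℝ] ℝ} {b : ℝ → Euc d → Lin d →L[ℝ] ℝ} {c : ℝ → Euc d → ℝ}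
    (hE : ∀ t x, Ell ν (q t x)) (hq : ∀ t x, ‖q t x‖ ≤ B) (hb : ∀ t x, ‖b t x‖ ≤ B) (hc0 : ∀ t x, c t x ≤ c0)
    {u : ℝ → Euc d → ℝ} {p : ℝ → Euc d → Lin d} {H : ℝ → Euc d → Bil d} (hJ : Jet u p H) (hc : Continuous fun z : ℝ × Euc d => u z.1 z.2)
    (hM : ∀ t ∈ Icc s T, ∀ x, |u t x| ≤ M) (hm : 0 ≤ m) (h0 : ∀ x, u s x ≤ m)
    (ht : ∀ t, s ≤ t → ∀ x, HasDerivAt (fun t => u t x) (q t x (H t x) + b t x (p t x) + c t x * u t x) t) :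
    ∀ t ∈ Icc s T, ∀ x, u t x ≤ Real.exp (c0 * (t-s)) * m := by
  let E : ℝ → ℝ := fun t => Real.exp (-c0 * (t - s))
  have hE' : ∀ t, HasDerivAt E (E t * (-c0)) t := fun t => by
    have := (((hasDerivAt_id t).sub_const s).const_mul (-c0)).exp
    simpa [E] using this
  have hE0 : ∀ t, 0 < E t := fun t => Real.exp_pos _
  have hEc : Continuous E := by fun_prop
  have hJ2 := (hJ.sm E).sub (Jet.const fun _ => m)
  obtain ⟨e0, he0⟩ := isCompact_Icc.exists_bound_of_continuousOn (s := Icc s T) hEc.continuousOn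
  have key := MP (s := s) (T := T) (B := B) (M := |e0| * M) (w := fun t x => E t * u t x - m) hν (by fun_prop) (fun t ht x => ?_) (fun x => ?_) (fun t htt x hpos => ?_)
  · intro t htt x
    have := key t htt x
    have h2 : Real.exp (c0 * (t-s)) * E t = 1 := by simp only [E, ← Real.exp_add]; simp
    have h3 := Real.exp_pos (c0 * (t-s))
    calc u t x = Real.exp (c0 * (t-s)) * E t * u t x := by rw [h2, one_mul]
      _ = Real.exp (c0 * (t-s)) * (E t * u t x) := by ring
      _ ≤ _ := by gcongr; linarith
  · have a1 := hM t ht x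
    have a2 := he0 t ht
    rw [Real.norm_of_nonneg (hE0 t).le] at a2
    have : E t * u t x ≤ |e0| * M := (mul_le_mul_of_nonneg_left ((le_abs_self _).trans a1) (hE0 t).le).trans
      (mul_le_mul_of_nonneg_right (a2.trans (le_abs_self _)) ((abs_nonneg _).trans a1))
    linarith
  · simp [E]; linarith [h0 x]
  · refine ⟨_, _, _, q t x, b t x, fun y => hJ2.h1 t y, hJ2.h2 t x, ((hE' t).mul (ht t htt.1.le x)).sub_const m, hE t x, hq t x, hb t x, ?_⟩
    have hu : 0 < E t * u t x := by linarith
    have := mul_le_mul_of_nonneg_right (hc0 t x) hu.le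
    simp only [sub_zero, map_smul, smul_eq_mul]
    linarith

lemma Jet.negj {u : ℝ → Euc d → ℝ} {p : ℝ → Euc d → Lin d} {H : ℝ → Euc d → Bil d} (h : Jet u p H) :
    Jet (fun t x => - u t x) (fun t x => - p t x) (fun t x => - H t x) :=
  ⟨fun t x => (h.h1 t x).neg, fun t x => (h.h2 t x).neg⟩

lemma Sol.neg {s : ℝ} {q : ℝ → Euc d → Bil d →L[ℝ] ℝ} {b : ℝ → Euc d → Lin d →L[ℝ] ℝ} {c : ℝ → Euc d → ℝ}
    {u : ℝ → Euc d → ℝ} {p : ℝ → Euc d → Lin d} {H : ℝ → Euc d → Bil d} (h : Sol α s q b c u p H) :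
    Sol α s q b c (fun t x => - u t x) (fun t x => - p t x) (fun t x => - H t x) where
  J := h.J.negj
  hc := h.hc.neg
  bd T hT := by obtain ⟨a, h1, h2⟩ := h.bd T hT; exact ⟨a, h1.neg, h2.neg⟩
  ht t hst x := (h.ht t hst x).neg.congr_deriv (by simp only [map_neg]; ring)

lemma Sol.bdd {s T : ℝ} {q : ℝ → Euc d → Bil d →L[ℝ] ℝ} {b : ℝ → Euc d → Lin d →L[ℝ] ℝ} {c : ℝ → Euc d → ℝ}
    {u : ℝ → Euc d → ℝ} {p : ℝ → Euc d → Lin d} {H : ℝ → Euc d → Bil d} (h : Sol α s q b c u p H) :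
    ∃ M, ∀ t ∈ Icc s T, ∀ x, |u t x| ≤ M := by
  rcases le_total s T with hT | hT
  · obtain ⟨a, h1, -⟩ := h.bd T hT
    refine ⟨a, fun t ht x => ?_⟩
    have := h1.2.1 t x
    beta_reduce at this
    rwa [min_eq_left ht.2, max_eq_right ht.1] at this
  · obtain ⟨a, h1, -⟩ := h.bd s le_rfl
    refine ⟨a, fun t ht x => ?_⟩
    have := h1.2.1 t x
    beta_reduce at this
    rwa [min_eq_left (ht.2.trans hT), max_eq_right ht.1] at this

lemma sup_bd {ν B s m c0 : ℝ} (hν : 0 < ν) {q : ℝ → Euc d → Bil d →L[ℝ] ℝ} {b : ℝ → Euc d → Lin d →L[ℝ] ℝ} {c : ℝ → Euc d → ℝ}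
    (h : COp α ν B q b c) (hc0 : ∀ t x, c t x ≤ c0)
    {u : ℝ → Euc d → ℝ} {p : ℝ → Euc d → Lin d} {H : ℝ → Euc d → Bil d} (hS : Sol α s q b c u p H)
    (h0 : ∀ x, |u s x| ≤ m) : ∀ t, s ≤ t → ∀ x, |u t x| ≤ Real.exp (c0 * (t-s)) * m := by
  intro t ht x
  have hm : 0 ≤ m := (abs_nonneg _).trans (h0 0)
  obtain ⟨M, hM⟩ := hS.bdd (T := t)
  have a1 := sup_aux hν h.ell h.nq.2.1 h.nb.2.1 hc0 hS.J hS.hc hM hm (fun x => (le_abs_self _).trans (h0 x)) hS.ht t ⟨ht, le_rfl⟩ x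
  have a2 := sup_aux hν h.ell h.nq.2.1 h.nb.2.1 hc0 hS.neg.J hS.neg.hc (fun t ht x => by rw [abs_neg]; exact hM t ht x) hm
    (fun x => (neg_le_abs _).trans (h0 x)) hS.neg.ht t ⟨ht, le_rfl⟩ x
  exact abs_le.2 ⟨by linarith, a1⟩

lemma barrier {ν B B' s m M K : ℝ} (hν : 0 < ν) {q : ℝ → Euc d → Bil d →L[ℝ] ℝ} {b : ℝ → Euc d → Lin d →L[ℝ] ℝ} {c : ℝ → Euc d → ℝ}
    (h : COp α ν B' q b c) {x0 : Euc d} (hl : ∀ t ∈ Icc s (s+1), ∀ x, ‖x - x0‖ ≤ 1 → ‖q t x‖ ≤ B ∧ ‖b t x‖ ≤ B ∧ |c t x| ≤ B)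
    {u : ℝ → Euc d → ℝ} {p : ℝ → Euc d → Lin d} {H : ℝ → Euc d → Bil d} (hS : Sol α s q b c u p H)
    (hM : ∀ t ∈ Icc s (s+1), ∀ x, |u t x| ≤ M) (hK : M + |m| ≤ K) (h0 : ∀ x, ‖x - x0‖ ≤ 1 → u s x ≤ m + K * ‖x - x0‖^2) :
    ∀ t ∈ Icc s (s+1), ∀ x, u t x ≤ m + K * ‖x - x0‖^2 + (B * M + 4 * K * B) * (t - s) := by
  have hM0 : 0 ≤ M := (abs_nonneg _).trans (hM s ⟨le_rfl, by linarith⟩ 0)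
  have hK0 : 0 ≤ K := by have := abs_nonneg m; linarith
  have hB0 : 0 ≤ B := (norm_nonneg _).trans (hl s ⟨le_rfl, by linarith⟩ x0 (by simp)).1
  set K' := B * M + 4 * K * B with hK'
  have hK'0 : 0 ≤ K' := by positivity
  let I : Bil d := (innerSL ℝ : Euc d →L[ℝ] Euc d →L[ℝ] ℝ)
  have hI : ‖I‖ ≤ 1 := ContinuousLinearMap.opNorm_le_bound _ zero_le_one fun y => by
    simp only [I]; rw [one_mul, innerSL_apply_norm]
  have k1 : ∀ y, HasFDerivAt (fun x => m + K * ‖x - x0‖^2) ((K * 2) • I (y - x0)) y := fun y => by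
    have := (((hasStrictFDerivAt_norm_sq (y - x0)).hasFDerivAt.comp y ((hasFDerivAt_id y).sub_const x0)).const_mul K).const_add m
    refine this.congr_fderiv ?_
    ext v
    show K * (2 • inner ℝ (y-x0) v) = K * 2 * inner ℝ (y-x0) v
    rw [nsmul_eq_mul]; push_cast; ring
  have k2 : ∀ y, HasFDerivAt (fun y => (K * 2) • I (y - x0)) ((K * 2) • I) y := fun y =>
    (((I.hasFDerivAt).comp y ((hasFDerivAt_id y).sub_const x0)).const_smul (K * 2)).congr_fderiv (by ext; simp)
  have hfar : ∀ t ∈ Icc s (s+1), ∀ x, 1 < ‖x - x0‖ → u t x - (m + K * ‖x - x0‖^2) ≤ 0 := fun t ht x hx => by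
    have a1 := (le_abs_self _).trans (hM t ht x)
    have a2 : K ≤ K * ‖x - x0‖^2 := le_mul_of_one_le_right hK0 (one_le_pow₀ hx.le)
    linarith [neg_abs_le m]
  have key := MP (s := s) (T := s+1) (B := B') (M := M + |m|) (w := fun t x => u t x - (m + K * ‖x - x0‖^2) - K' * (t - s)) hν
    (by have := hS.hc; fun_prop) (fun t ht x => ?_) (fun x => ?_) (fun t htt x hpos => ?_)
  · intro t ht x
    linarith [key t ht x]
  · have a1 := (le_abs_self _).trans (hM t ht x)
    have a2 : 0 ≤ K * ‖x - x0‖^2 := by positivity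
    have a3 : 0 ≤ K' * (t - s) := mul_nonneg hK'0 (by linarith [ht.1])
    linarith [neg_abs_le m]
  · rcases le_or_gt ‖x - x0‖ 1 with hx | hx
    · linarith [h0 x hx]
    · have := hfar s ⟨le_rfl, by linarith⟩ x hx
      linarith
  · have ht' : t ∈ Icc s (s+1) := ⟨htt.1.le, htt.2⟩
    have hx : ‖x - x0‖ ≤ 1 := by
      by_contra hn
      push Not at hn
      have a3 : 0 ≤ K' * (t - s) := mul_nonneg hK'0 (by linarith [ht'.1])
      linarith [hfar t ht' x hn]
    obtain ⟨l1, l2, l3⟩ := hl t ht' x hx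
    refine ⟨fun y => p t y - (K * 2) • I (y - x0), H t x - (K * 2) • I, _, q t x, b t x,
      fun y => ((hS.J.h1 t y).sub (k1 y)).sub_const _, (hS.J.h2 t x).sub (k2 x),
      ((hS.ht t htt.1.le x).sub_const (m + K * ‖x - x0‖^2)).sub (((hasDerivAt_id t).sub_const s).const_mul K'), h.ell t x, h.nq.2.1 t x, h.nb.2.1 t x, ?_⟩
    have b1 : |q t x I| ≤ B := ((q t x).le_opNorm _).trans (by
      calc _ ≤ B * 1 := mul_le_mul l1 hI (norm_nonneg _) hB0
        _ = B := mul_one _)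
    have b2 : |b t x (I (x - x0))| ≤ B := ((b t x).le_opNorm _).trans (by
      calc _ ≤ B * 1 := mul_le_mul l2 (by simp only [I]; rw [innerSL_apply_norm]; exact hx) (norm_nonneg _) hB0
        _ = B := mul_one _)
    have b3 : c t x * u t x ≤ B * M := (le_abs_self _).trans (by
      rw [abs_mul]; exact mul_le_mul l3 (hM t ht' x) (abs_nonneg _) hB0)
    have b1' := mul_le_mul_of_nonneg_left ((le_abs_self _).trans b1) (by positivity : 0 ≤ K * 2)
    have b2' := mul_le_mul_of_nonneg_left ((le_abs_self _).trans b2) (by positivity : 0 ≤ K * 2)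
    simp only [map_sub] at b2'
    simp only [map_sub, map_smul, smul_eq_mul, mul_one]
    rw [hK']
    linarith

end lop

section app
open scoped ContDiff
variable {d : ℕ} {α : ℝ}

lemma jet_smooth (hα : α ∈ Ioo (0:ℝ) 1) {f : Euc d → ℝ} (h : ContDiff ℝ ∞ f) (hs : HasCompactSupport f) :
    ∃ (K : ℝ) (p : Euc d → Lin d) (H : Euc d → Bil d), Jet (fun _ : ℝ => f) (fun _ => p) (fun _ => H) ∧ Nn α K (fun _ : ℝ => f) ∧
      Nn α K (fun _ : ℝ => p) ∧ Nn α K (fun _ : ℝ => H) := by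
  have hp : ContDiff ℝ ∞ (fderiv ℝ f) := h.fderiv_right (by simp)
  have hH : ContDiff ℝ ∞ (fderiv ℝ (fderiv ℝ f)) := hp.fderiv_right (by simp)
  have hW : ContDiff ℝ ∞ (fderiv ℝ (fderiv ℝ (fderiv ℝ f))) := hH.fderiv_right (by simp)
  have sp : HasCompactSupport (fderiv ℝ f) := hs.fderiv ℝ
  have sH : HasCompactSupport (fderiv ℝ (fderiv ℝ f)) := sp.fderiv ℝ
  have sW : HasCompactSupport (fderiv ℝ (fderiv ℝ (fderiv ℝ f))) := sH.fderiv ℝ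
  obtain ⟨K0, h0⟩ := hs.exists_bound_of_continuous h.continuous
  obtain ⟨K1, h1⟩ := sp.exists_bound_of_continuous hp.continuous
  obtain ⟨K2, h2⟩ := sH.exists_bound_of_continuous hH.continuous
  obtain ⟨K3, h3⟩ := sW.exists_bound_of_continuous hW.continuous
  have k0 := (norm_nonneg _).trans (h0 0)
  have k1 := (norm_nonneg _).trans (h1 0)
  have k2 := (norm_nonneg _).trans (h2 0)
  have k3 := (norm_nonneg _).trans (h3 0)
  have d0 : ∀ x, HasFDerivAt f (fderiv ℝ f x) x := fun x => (h.differentiable (by simp) x).hasFDerivAt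
  have d1 : ∀ x, HasFDerivAt (fderiv ℝ f) (fderiv ℝ (fderiv ℝ f) x) x := fun x => (hp.differentiable (by simp) x).hasFDerivAt
  have d2 : ∀ x, HasFDerivAt (fderiv ℝ (fderiv ℝ f)) (fderiv ℝ (fderiv ℝ (fderiv ℝ f)) x) x := fun x => (hH.differentiable (by simp) x).hasFDerivAt
  refine ⟨2 * K0 + 2 * K1 + 2 * K2 + K3, fderiv ℝ f, fderiv ℝ (fderiv ℝ f), ⟨fun _ => d0, fun _ => d1⟩, ?_, ?_, ?_⟩
  · exact (nn_lip hα k1 (h.continuous.comp continuous_snd) (fun _ => h0) (fun _ => lip_of_deriv d0 h1)).mono (by linarith)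
  · exact (nn_lip hα k2 (hp.continuous.comp continuous_snd) (fun _ => h1) (fun _ => lip_of_deriv d1 h2)).mono (by linarith)
  · exact (nn_lip hα k3 (hH.continuous.comp continuous_snd) (fun _ => h2) (fun _ => lip_of_deriv d2 h3)).mono (by linarith)

structure App (α ν c0 s : ℝ) (q : ℝ → Euc d → Bil d →L[ℝ] ℝ) (b : ℝ → Euc d → Lin d →L[ℝ] ℝ) (c : ℝ → Euc d → ℝ) (f : Euc d → ℝ) (N : ℝ)
    (χ : ℝ × Euc d → ℝ) (u : ℝ → Euc d → ℝ) (p : ℝ → Euc d → Lin d) (H : ℝ → Euc d → Bil d) : Prop where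
  sm : ContDiff ℝ ∞ χ
  cs : HasCompactSupport χ
  n0 : ∀ z, 0 ≤ χ z
  n1 : ∀ z, χ z ≤ 1
  one : ∀ t x, |t| ≤ N → ‖x‖ ≤ N → χ (t,x) = 1
  sol : Sol α s (qc q χ) (bc b χ) (cct c c0 χ) u p H
  a1 : ∀ x, ‖x‖ ≤ N → |u s x - f x| ≤ 2 / N
  a2 : ∀ Mf, (∀ x, |f x| ≤ Mf) → ∀ x, |u s x| ≤ Mf + 2 / N

lemma app_mk (hα : α ∈ Ioo (0:ℝ) 1) {ν c0 s N : ℝ} (hν : 0 < ν) (hN : 0 < N) {q : ℝ → Euc d → Bil d →L[ℝ] ℝ} {b : ℝ → Euc d → Lin d →L[ℝ] ℝ} {c : ℝ → Euc d → ℝ}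
    (h : LOp α ν c0 q b c) {f : Euc d → ℝ} (hf : Continuous f) : ∃ χ u p H, App α ν c0 s q b c f N χ u p H := by
  let χ : ContDiffBump (0 : ℝ × Euc d) := ⟨N, N+1, hN, by linarith⟩
  let ξ : ContDiffBump (0 : Euc d) := ⟨N, N+1, hN, by linarith⟩
  obtain ⟨⟨B, hB⟩, -⟩ := cop_mk hα h χ.contDiff χ.hasCompactSupport (fun _ => χ.nonneg) (fun _ => χ.le_one)
  have hε : 0 < 1 / N := by positivity
  obtain ⟨g, hg, hgf⟩ := smooth_approx hf hε
  obtain ⟨K, pf, Hf, hJ, m0, m1, m2⟩ := jet_smooth hα (f := fun x => ξ x * g x) (ξ.contDiff.mul hg) (ξ.hasCompactSupport.mul_right)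
  obtain ⟨u, p, H, hS, hu⟩ := init_sol hα (s := s) hν hB hJ m0 m1 m2 hε
  have e2 : 2 / N = 1 / N + 1 / N := by ring
  refine ⟨χ, u, p, H, χ.contDiff, χ.hasCompactSupport, fun _ => χ.nonneg, fun _ => χ.le_one, fun t x h1 h2 => ?_, hS, fun x hx => ?_, fun Mf hM x => ?_⟩
  · apply χ.one_of_mem_closedBall
    rw [mem_closedBall_zero_iff, Prod.norm_def]
    exact max_le h1 h2
  · have h1 := hu x
    rw [ξ.one_of_mem_closedBall (by rw [mem_closedBall_zero_iff]; exact hx), one_mul] at h1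
    rw [e2]
    have := abs_add_le (u s x - g x) (g x - f x)
    rw [sub_add_sub_cancel] at this
    linarith [hgf x]
  · have h1 := hu x
    have h2 : |ξ x * g x| ≤ Mf + 1 / N := by
      rw [abs_mul, abs_of_nonneg ξ.nonneg]
      have h3 := abs_add_le (g x - f x) (f x)
      rw [sub_add_cancel] at h3
      exact (mul_le_of_le_one_left (abs_nonneg _) ξ.le_one).trans (by linarith [hgf x, hM x])
    have := abs_add_le (u s x - ξ x * g x) (ξ x * g x)
    rw [sub_add_cancel] at this
    linarith

lemma App.bd (hα : α ∈ Ioo (0:ℝ) 1) {ν c0 s N : ℝ} (hν : 0 < ν) {q : ℝ → Euc d → Bil d →L[ℝ] ℝ} {b : ℝ → Euc d → Lin d →L[ℝ] ℝ} {c : ℝ → Euc d → ℝ}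
    (h : LOp α ν c0 q b c) {f : Euc d → ℝ} {χ u p H} (hA : App α ν c0 s q b c f N χ u p H) {Mf : ℝ} (hM : ∀ x, |f x| ≤ Mf) :
    ∀ t, s ≤ t → ∀ x, |u t x| ≤ Real.exp (c0 * (t-s)) * (Mf + 2 / N) := by
  obtain ⟨⟨B, hB⟩, hc⟩ := cop_mk hα h hA.sm hA.cs hA.n0 hA.n1
  exact sup_bd hν hB hc hA.sol (hA.a2 Mf hM)

lemma qc_one {q : ℝ → Euc d → Bil d →L[ℝ] ℝ} {χ : ℝ × Euc d → ℝ} {t : ℝ} {x : Euc d} (h : χ (t,x) = 1) : qc q χ t x = q t x := by simp [qc, h]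
lemma bc_one {q : ℝ → Euc d → Lin d →L[ℝ] ℝ} {χ : ℝ × Euc d → ℝ} {t : ℝ} {x : Euc d} (h : χ (t,x) = 1) : bc q χ t x = q t x := by simp [bc, h]
lemma cct_one {c : ℝ → Euc d → ℝ} {c0 : ℝ} {χ : ℝ × Euc d → ℝ} {t : ℝ} {x : Euc d} (h : χ (t,x) = 1) : cct c c0 χ t x = c t x := by simp [cct, h]

lemma app_init (hα : α ∈ Ioo (0:ℝ) 1) {ν c0 s : ℝ} (hν : 0 < ν) {q : ℝ → Euc d → Bil d →L[ℝ] ℝ} {b : ℝ → Euc d → Lin d →L[ℝ] ℝ} {c : ℝ → Euc d → ℝ}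
    (h : LOp α ν c0 q b c) {f : Euc d → ℝ} (hf : Continuous f) {Mf : ℝ} (hM : ∀ x, |f x| ≤ Mf) (x0 : Euc d) {ε : ℝ} (hε : 0 < ε) :
    ∃ K N0 : ℝ, 0 < N0 ∧ ∀ N ≥ N0, ∀ χ u p H, App α ν c0 s q b c f N χ u p H → ∀ t ∈ Icc s (s+1), ∀ x, |u t x - f x0| ≤ ε + K * ‖x-x0‖^2 + K * (t - s) := by
  obtain ⟨δ, hδ, hd⟩ := Metric.continuous_iff.1 hf x0 (ε/2) (by positivity)
  have hMf : 0 ≤ Mf := (abs_nonneg _).trans (hM 0)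
  set S := Icc s (s+1) ×ˢ Metric.closedBall x0 1 with hS
  have hSc : IsCompact S := isCompact_Icc.prod (isCompact_closedBall _ _)
  obtain ⟨B1, hB1⟩ := hSc.exists_bound_of_continuousOn h.nq.1.continuousOn
  obtain ⟨B2, hB2⟩ := hSc.exists_bound_of_continuousOn h.nb.1.continuousOn
  obtain ⟨B3, hB3⟩ := hSc.exists_bound_of_continuousOn h.nc.1.continuousOn
  set B := max B1 (max B2 B3)
  set M := Real.exp |c0| * (Mf + 2) with hMdef
  have hM0 : 0 ≤ M := by positivity
  set K := M + |f x0| + ε + 2 * Mf / δ^2 with hKdef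
  have hKp : 0 ≤ 2 * Mf / δ^2 := by positivity
  have hfx := abs_nonneg (f x0)
  have hK0 : 0 ≤ K := by linarith
  set K' := B * M + 4 * K * B
  refine ⟨max K K', max (max 1 (4/ε)) (max (‖x0‖ + 1) (|s| + 1)), lt_of_lt_of_le one_pos ((le_max_left _ _).trans (le_max_left _ _)), fun N hN χ u p H hA t ht x => ?_⟩
  simp only [ge_iff_le, max_le_iff] at hN
  obtain ⟨⟨hN1, hN2⟩, hN3, hN4⟩ := hN
  have hNp : 0 < N := by linarith
  have h2N : 2 / N ≤ ε / 2 := by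
    rw [div_le_iff₀ hε] at hN2
    rw [div_le_div_iff₀ hNp two_pos]; linarith
  have h2N' : 2 / N ≤ 2 := div_le_self two_pos.le hN1
  obtain ⟨⟨B', hB'⟩, hc⟩ := cop_mk hα h hA.sm hA.cs hA.n0 hA.n1
  have hub : ∀ t ∈ Icc s (s+1), ∀ x, |u t x| ≤ M := fun t ht x => (hA.bd hα hν h hM t ht.1 x).trans (by
    have : c0 * (t-s) ≤ |c0| := by
      have h1 : 0 ≤ t - s := by linarith [ht.1]
      have h2 : t - s ≤ 1 := by linarith [ht.2]
      calc c0 * (t-s) ≤ |c0| * (t-s) := mul_le_mul_of_nonneg_right (le_abs_self _) h1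
        _ ≤ |c0| * 1 := mul_le_mul_of_nonneg_left h2 (abs_nonneg _)
        _ = _ := mul_one _
    have h2 := Real.exp_le_exp.2 this
    have h3 : 0 ≤ 2 / N := by positivity
    rw [hMdef]; gcongr)
  have hl : ∀ t ∈ Icc s (s+1), ∀ x, ‖x - x0‖ ≤ 1 → ‖qc q χ t x‖ ≤ B ∧ ‖bc b χ t x‖ ≤ B ∧ |cct c c0 χ t x| ≤ B := fun t ht x hx => by
    have ho : χ (t,x) = 1 := hA.one t x (by
      have := abs_add_le s (t-s)
      rw [add_sub_cancel, abs_of_nonneg (by linarith [ht.1] : 0 ≤ t - s)] at this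
      linarith [ht.2]) (by
      have := norm_add_le x0 (x - x0)
      rw [add_sub_cancel] at this
      linarith)
    rw [qc_one ho, bc_one ho, cct_one ho]
    have hz : (t,x) ∈ S := mk_mem_prod ht (by rw [mem_closedBall_iff_norm]; exact hx)
    exact ⟨(hB1 _ hz).trans (le_max_left _ _), (hB2 _ hz).trans ((le_max_left _ _).trans (le_max_right _ _)), (hB3 _ hz).trans ((le_max_right _ _).trans (le_max_right _ _))⟩
  have hfc : ∀ x, |f x - f x0| ≤ ε/2 + K * ‖x - x0‖^2 := fun x => by
    rcases lt_or_ge ‖x - x0‖ δ with hx | hx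
    · have := hd x (by rwa [dist_eq_norm])
      rw [Real.dist_eq] at this
      have : 0 ≤ K * ‖x - x0‖^2 := by positivity
      linarith
    · have h1 := abs_sub (f x) (f x0)
      have h2 : 2 * Mf ≤ 2 * Mf / δ^2 * ‖x - x0‖^2 := by
        rw [div_mul_eq_mul_div, le_div_iff₀ (by positivity)]; gcongr
      have h3 : 2 * Mf / δ^2 * ‖x - x0‖^2 ≤ K * ‖x-x0‖^2 := by gcongr; linarith
      linarith [hM x, hM x0]
  have h0 : ∀ x, ‖x - x0‖ ≤ 1 → |u s x - f x0| ≤ ε + K * ‖x - x0‖^2 := fun x hx => by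
    have h1 := hA.a1 x (by
      have := norm_add_le x0 (x - x0)
      rw [add_sub_cancel] at this
      linarith)
    have := abs_add_le (u s x - f x) (f x - f x0)
    rw [sub_add_sub_cancel] at this
    linarith [hfc x]
  have e1 := abs_add_le (f x0) ε
  have e2 := abs_add_le (-f x0) ε
  rw [abs_neg, abs_of_pos hε] at e2
  rw [abs_of_pos hε] at e1
  have r1 := barrier hν hB' hl hA.sol hub (m := f x0 + ε) (K := K) (by linarith) (fun x hx => by linarith [(abs_le.1 (h0 x hx)).2]) t ht x
  have r2 := barrier hν hB' hl hA.sol.neg (fun t ht x => by rw [abs_neg]; exact hub t ht x) (m := - f x0 + ε) (K := K) (by linarith)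
    (fun x hx => by linarith [(abs_le.1 (h0 x hx)).1]) t ht x
  have f1 : K * ‖x-x0‖^2 ≤ max K K' * ‖x-x0‖^2 := mul_le_mul_of_nonneg_right (le_max_left _ _) (by positivity)
  have f2 : K' * (t-s) ≤ max K K' * (t-s) := mul_le_mul_of_nonneg_right (le_max_right _ _) (by linarith [ht.1])
  rw [abs_le]
  constructor <;> linarith

end app

section ulim
variable {d : ℕ} {α : ℝ} {F : Type*} [NormedAddCommGroup F] [NormedSpace ℝ F] {U : Ultrafilter ℕ}

lemma ulim [ProperSpace F] {g : ℕ → F} {K : ℝ} (h : ∀ᶠ n in (U : Filter ℕ), ‖g n‖ ≤ K) : ∃ l, Tendsto g U (𝓝 l) := by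
  obtain ⟨l, -, hl⟩ := (isCompact_closedBall (0:F) K).ultrafilter_le_nhds (U.map g) (by
    rw [Ultrafilter.coe_map, le_principal_iff, mem_map]
    filter_upwards [h] with n hn
    simpa using hn)
  exact ⟨l, hl⟩

/-- time equicontinuity, uniform in space -/
def UTC (U : Ultrafilter ℕ) (g : ℕ → ℝ → Euc d → F) : Prop :=
  ∀ t, ∀ ε > 0, ∀ᶠ z in 𝓝 t ×ˢ (U : Filter ℕ), ∀ x, ‖g z.2 z.1 x - g z.2 t x‖ ≤ ε

lemma UTC.deriv (hα : α ∈ Ioo (0:ℝ) 1) {g : ℕ → ℝ → Euc d → F} {g' : ℕ → ℝ → Euc d → Euc d →L[ℝ] F} {K : ℝ} (hK : 0 ≤ K) (hg : UTC U g)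
    (hd : ∀ᶠ n in (U : Filter ℕ), (∀ t x, HasFDerivAt (g n t) (g' n t x) x) ∧ Nn α K (g' n)) : UTC U g' := by
  intro t ε hε
  obtain ⟨h, hh, hhK⟩ : ∃ h : ℝ, 0 < h ∧ 2 * (K * h^α) ≤ ε/2 := by
    have h1 : Tendsto (fun h : ℝ => 2 * (K * h^α)) (𝓝[>] 0) (𝓝 (2 * (K * (0:ℝ)^α))) :=
      (((Real.continuous_rpow_const hα.1.le).const_mul K).const_mul 2).continuousAt.mono_left nhdsWithin_le_nhds
    rw [Real.zero_rpow hα.1.ne', mul_zero, mul_zero] at h1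
    obtain ⟨h, a, b⟩ := ((h1.eventually_le_const (by positivity : 0 < ε/2)).and self_mem_nhdsWithin).exists
    exact ⟨h, b, a⟩
  filter_upwards [hg t (ε * h / 4) (by positivity), hd.prod_inr (𝓝 t)] with z h1 h2 x
  refine ContinuousLinearMap.opNorm_le_of_unit_norm hε.le fun v hv => ?_
  have hn : ‖h • v‖ = h := by rw [norm_smul, hv, mul_one, Real.norm_of_nonneg hh.le]
  have t1 := taylor1 hα.1.le hK (h2.1 z.1) (h2.2.2.2 z.1) x (h • v)
  have t2 := taylor1 hα.1.le hK (h2.1 t) (h2.2.2.2 t) x (h • v)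
  rw [hn] at t1 t2
  have e : (g' z.2 z.1 x - g' z.2 t x) (h • v) = (g z.2 z.1 (x + h • v) - g z.2 t (x + h • v)) - (g z.2 z.1 x - g z.2 t x)
      - (g z.2 z.1 (x + h • v) - g z.2 z.1 x - g' z.2 z.1 x (h • v)) + (g z.2 t (x + h • v) - g z.2 t x - g' z.2 t x (h • v)) := by
    rw [sub_apply]; abel
  have h3 : ‖(g' z.2 z.1 x - g' z.2 t x) (h • v)‖ ≤ ε * h := by
    rw [e]
    have a1 := norm_add_le ((g z.2 z.1 (x + h • v) - g z.2 t (x + h • v)) - (g z.2 z.1 x - g z.2 t x)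
      - (g z.2 z.1 (x + h • v) - g z.2 z.1 x - g' z.2 z.1 x (h • v))) (g z.2 t (x + h • v) - g z.2 t x - g' z.2 t x (h • v))
    have a2 := norm_sub_le ((g z.2 z.1 (x + h • v) - g z.2 t (x + h • v)) - (g z.2 z.1 x - g z.2 t x)) (g z.2 z.1 (x + h • v) - g z.2 z.1 x - g' z.2 z.1 x (h • v))
    have a3 := norm_sub_le (g z.2 z.1 (x + h • v) - g z.2 t (x + h • v)) (g z.2 z.1 x - g z.2 t x)
    have a4 := h1 (x + h • v)
    have a5 := h1 x
    have a6 := mul_le_mul_of_nonneg_right hhK hh.le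
    linarith
  rw [map_smul, norm_smul, Real.norm_of_nonneg hh.le, mul_comm ε] at h3
  exact le_of_mul_le_mul_left h3 hh

lemma lim_nn (hα : α ∈ Ioo (0:ℝ) 1) {g : ℕ → ℝ → Euc d → F} {g0 : ℝ → Euc d → F} {K : ℝ} (hg : UTC U g)
    (hd : ∀ᶠ n in (U : Filter ℕ), Nn α K (g n)) (hl : ∀ t x, Tendsto (fun n => g n t x) U (𝓝 (g0 t x))) : Nn α K g0 := by
  have hh : ∀ t x y, ‖g0 t x - g0 t y‖ ≤ K * ‖x - y‖^α := fun t x y =>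
    le_of_tendsto ((hl t x).sub (hl t y)).norm (hd.mono fun n hn => hn.2.2 t x y)
  refine ⟨?_, fun t x => le_of_tendsto (hl t x).norm (hd.mono fun n hn => hn.2.1 t x), hh⟩
  rw [continuous_iff_continuousAt]
  rintro ⟨t, x⟩
  rw [ContinuousAt, tendsto_iff_norm_sub_tendsto_zero, Metric.tendsto_nhds]
  intro ε hε
  have h1 := ((hg t (ε/3) (by positivity)).curry).prod_inl (𝓝 x)
  have h2 : Tendsto (fun y => K * ‖y - x‖^α) (𝓝 x) (𝓝 (K * ‖x - x‖^α)) :=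
    (((continuous_id.sub continuous_const).norm.rpow_const (fun _ => Or.inr hα.1.le)).const_mul K).continuousAt
  rw [sub_self, norm_zero, Real.zero_rpow hα.1.ne', mul_zero] at h2
  have h3 := (h2.eventually_le_const (by positivity : 0 < ε/3)).prod_inr (𝓝 t)
  rw [nhds_prod_eq]
  filter_upwards [h1, h3] with z a1 a2
  have a3 : ‖g0 z.1 z.2 - g0 t z.2‖ ≤ ε/3 := le_of_tendsto ((hl _ _).sub (hl _ _)).norm (a1.mono fun n hn => hn z.2)
  have a4 := norm_sub_le_norm_sub_add_norm_sub (g0 z.1 z.2) (g0 t z.2) (g0 t x)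
  rw [Real.dist_0_eq_abs, abs_norm]
  linarith [hh t z.2 x]

lemma fd_taylor {α K : ℝ} (hα : 0 < α) {f : Euc d → F} {L : Euc d →L[ℝ] F} {x : Euc d}
    (h : ∀ z, ‖f (x+z) - f x - L z‖ ≤ K * ‖z‖^α * ‖z‖) : HasFDerivAt f L x := by
  rw [hasFDerivAt_iff_isLittleO_nhds_zero, Asymptotics.isLittleO_iff]
  intro ε hε
  have h2 : Tendsto (fun y : Euc d => K * ‖y‖^α) (𝓝 0) (𝓝 (K * ‖(0 : Euc d)‖^α)) :=
    ((continuous_norm.rpow_const (fun _ => Or.inr hα.le)).const_mul K).continuousAt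
  rw [norm_zero, Real.zero_rpow hα.ne', mul_zero] at h2
  filter_upwards [h2.eventually_le_const hε] with z hz
  exact (h z).trans (mul_le_mul_of_nonneg_right hz (norm_nonneg _))

lemma lim_fd (hα : α ∈ Ioo (0:ℝ) 1) {g : ℕ → ℝ → Euc d → F} {g0 : ℝ → Euc d → F} {g' : ℕ → ℝ → Euc d → Euc d →L[ℝ] F} {g0' : ℝ → Euc d → Euc d →L[ℝ] F} {K : ℝ} (hK : 0 ≤ K)
    (hd : ∀ᶠ n in (U : Filter ℕ), (∀ t x, HasFDerivAt (g n t) (g' n t x) x) ∧ Nn α K (g' n)) (hl : ∀ t x, Tendsto (fun n => g n t x) U (𝓝 (g0 t x)))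
    (hl' : ∀ t x, Tendsto (fun n => g' n t x) U (𝓝 (g0' t x))) (t : ℝ) (x : Euc d) : HasFDerivAt (g0 t) (g0' t x) x := by
  refine fd_taylor hα.1 (K := K) fun z => ?_
  have h1 : Tendsto (fun n => g' n t x z) U (𝓝 (g0' t x z)) := ((ContinuousLinearMap.apply ℝ F z).continuous.tendsto _).comp (hl' t x)
  exact le_of_tendsto (((hl t (x+z)).sub (hl t x)).sub h1).norm (hd.mono fun n hn => taylor1 hα.1.le hK (hn.1 t) (hn.2.2.2 t) x z)

/-- pointwise time equicontinuity -/
def UT (U : Ultrafilter ℕ) (g : ℕ → ℝ → F) (t : ℝ) : Prop :=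
  Tendsto (fun z : ℝ × ℕ => g z.2 z.1 - g z.2 t) (𝓝 t ×ˢ (U : Filter ℕ)) (𝓝 0)

lemma UTC.ut {g : ℕ → ℝ → Euc d → F} (h : UTC U g) (t : ℝ) (x : Euc d) : UT U (fun n t => g n t x) t := by
  rw [UT, tendsto_zero_iff_norm_tendsto_zero, Metric.tendsto_nhds]
  intro ε hε
  filter_upwards [h t (ε/2) (by positivity)] with z hz
  rw [Real.dist_0_eq_abs, abs_norm]
  linarith [hz x]

lemma UT.app {A : ℝ → F →L[ℝ] ℝ} {t : ℝ} (hA : ContinuousAt A t) {g : ℕ → ℝ → F} (h : UT U g t) {K : ℝ} (hK : ∀ᶠ n in (U : Filter ℕ), ∀ t, ‖g n t‖ ≤ K) :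
    UT U (fun n t => A t (g n t)) t := by
  have h1 : Tendsto (fun z : ℝ × ℕ => (A z.1 - A t) (g z.2 z.1)) (𝓝 t ×ˢ (U : Filter ℕ)) (𝓝 0) := by
    have h2 : Tendsto (fun z : ℝ × ℕ => ‖A z.1 - A t‖ * K) (𝓝 t ×ˢ (U : Filter ℕ)) (𝓝 0) := by
      have := (((hA.tendsto.sub_const (A t)).norm.mul_const K)).comp (tendsto_fst (f := 𝓝 t) (g := (U : Filter ℕ)))
      rw [sub_self, norm_zero, zero_mul] at this
      exact this
    refine squeeze_zero_norm' ?_ h2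
    filter_upwards [hK.prod_inr (𝓝 t)] with z hz
    exact ((A z.1 - A t).le_opNorm _).trans (mul_le_mul_of_nonneg_left (hz _) (norm_nonneg _))
  have h3 : Tendsto (fun z : ℝ × ℕ => A t (g z.2 z.1 - g z.2 t)) (𝓝 t ×ˢ (U : Filter ℕ)) (𝓝 0) := by
    have := ((A t).continuous.tendsto 0).comp h
    rw [map_zero] at this
    exact this
  have := h1.add h3
  rw [add_zero] at this
  refine this.congr fun z => ?_
  rw [sub_apply, map_sub]; ring

lemma UT.add {g h : ℕ → ℝ → F} {t : ℝ} (hg : UT U g t) (hh : UT U h t) : UT U (fun n t => g n t + h n t) t := by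
  have := Tendsto.add hg hh
  rw [add_zero] at this
  exact this.congr fun z => by beta_reduce; abel

lemma lim_dt {g e : ℕ → ℝ → ℝ} {g0 : ℝ → ℝ} {e0 t : ℝ} (hu : UT U e t) (hd : ∀ᶠ z in 𝓝 t ×ˢ (U : Filter ℕ), HasDerivAt (g z.2) (e z.2 z.1) z.1)
    (hg : ∀ t, Tendsto (fun n => g n t) U (𝓝 (g0 t))) (he : Tendsto (fun n => e n t) U (𝓝 e0)) : HasDerivAt g0 e0 t := by
  rw [hasDerivAt_iff_isLittleO, Asymptotics.isLittleO_iff]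
  intro ε hε
  have h1 : ∀ᶠ z in 𝓝 t ×ˢ (U : Filter ℕ), ‖e z.2 z.1 - e z.2 t‖ ≤ ε := by
    have := (tendsto_zero_iff_norm_tendsto_zero.1 hu).eventually_le_const hε
    exact this
  obtain ⟨pa, ha, pb, hb, hab⟩ := eventually_prod_iff.1 (h1.and hd)
  obtain ⟨δ, hδ, hball⟩ := Metric.eventually_nhds_iff_ball.1 ha
  filter_upwards [Metric.ball_mem_nhds t hδ] with t' ht'
  have h2 : Tendsto (fun n => g n t' - g n t - (t' - t) • e n t) U (𝓝 (g0 t' - g0 t - (t' - t) • e0)) := ((hg t').sub (hg t)).sub (he.const_smul _)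
  refine le_of_tendsto h2.norm (hb.mono fun n hn => ?_)
  have h3 := (convex_ball t δ).norm_image_sub_le_of_norm_hasDerivWithin_le (f := fun τ => g n τ - τ * e n t) (f' := fun τ => e n τ - e n t) (C := ε)
    (fun τ hτ => (((hab (hball τ hτ) hn).2.sub ((hasDerivAt_id τ).mul_const (e n t))).congr_deriv (by simp)).hasDerivWithinAt) (fun τ hτ => (hab (hball τ hτ) hn).1)
    (Metric.mem_ball_self hδ) ht'
  have e1 : g n t' - g n t - (t' - t) • e n t = g n t' - t' * e n t - (g n t - t * e n t) := by rw [smul_eq_mul]; ring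
  rw [e1]; exact h3

lemma lim_loc (hα : α ∈ Ioo (0:ℝ) 1) {w : ℕ → ℝ → Euc d → ℝ} {p : ℕ → ℝ → Euc d → Lin d} {H : ℕ → ℝ → Euc d → Bil d} {e : ℕ → ℝ → Euc d → ℝ} {K : ℝ} (hK : 0 ≤ K)
    (h : ∀ᶠ n in (U : Filter ℕ), Jet (w n) (p n) (H n) ∧ Nn α K (w n) ∧ Nn α K (p n) ∧ Nn α K (H n) ∧ (∀ t x, HasDerivAt (fun t => w n t x) (e n t x) t) ∧ ∀ t x, |e n t x| ≤ K) :
    ∃ (w0 : ℝ → Euc d → ℝ) (p0 : ℝ → Euc d → Lin d) (H0 : ℝ → Euc d → Bil d), (∀ t x, Tendsto (fun n => w n t x) U (𝓝 (w0 t x))) ∧ Jet w0 p0 H0 ∧ Nn α K w0 ∧ Nn α K p0 ∧ Nn α K H0 ∧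
      ∀ (q : ℝ → Euc d → Bil d →L[ℝ] ℝ) (b : ℝ → Euc d → Lin d →L[ℝ] ℝ) (c : ℝ → Euc d → ℝ) t x, ContinuousAt (fun t => q t x) t → ContinuousAt (fun t => b t x) t → ContinuousAt (fun t => c t x) t →
        (∀ᶠ z in 𝓝 t ×ˢ (U : Filter ℕ), e z.2 z.1 x = q z.1 x (H z.2 z.1 x) + b z.1 x (p z.2 z.1 x) + c z.1 x * w z.2 z.1 x) →
        HasDerivAt (fun t => w0 t x) (q t x (H0 t x) + b t x (p0 t x) + c t x * w0 t x) t := by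
  have u0 : UTC U w := by
    intro t ε hε
    have h1 : Tendsto (fun t' => K * ‖t' - t‖) (𝓝 t) (𝓝 (K * ‖t - t‖)) := (by fun_prop : Continuous fun t' => K * ‖t' - t‖).continuousAt
    rw [sub_self, norm_zero, mul_zero] at h1
    filter_upwards [h.prod_inr (𝓝 t), (h1.eventually_le_const hε).prod_inl (U : Filter ℕ)] with z hz h2 x
    refine le_trans ?_ h2
    exact convex_univ.norm_image_sub_le_of_norm_hasDerivWithin_le (f := fun t => w z.2 t x) (fun τ _ => (hz.2.2.2.2.1 τ x).hasDerivWithinAt) (fun τ _ => hz.2.2.2.2.2 τ x) (mem_univ _) (mem_univ _)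
  have hp := h.mono fun n hn => (⟨hn.1.h1, hn.2.2.1⟩ : (∀ t x, HasFDerivAt (w n t) (p n t x) x) ∧ Nn α K (p n))
  have hH := h.mono fun n hn => (⟨hn.1.h2, hn.2.2.2.1⟩ : (∀ t x, HasFDerivAt (p n t) (H n t x) x) ∧ Nn α K (H n))
  have u1 : UTC U p := u0.deriv hα hK hp
  have u2 : UTC U H := u1.deriv hα hK hH
  choose w0 hw0 using fun t x => ulim (h.mono fun n hn => hn.2.1.2.1 t x)
  choose p0 hp0 using fun t x => ulim (hp.mono fun n hn => hn.2.2.1 t x)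
  choose H0 hH0 using fun t x => ulim (hH.mono fun n hn => hn.2.2.1 t x)
  refine ⟨w0, p0, H0, hw0, ⟨lim_fd hα hK hp hw0 hp0, lim_fd hα hK hH hp0 hH0⟩, lim_nn hα u0 (h.mono fun n hn => hn.2.1) hw0,
    lim_nn hα u1 (hp.mono fun n hn => hn.2) hp0, lim_nn hα u2 (hH.mono fun n hn => hn.2) hH0, fun q b c t x cq cb cc' he => ?_⟩
  let C : ℝ → ℝ →L[ℝ] ℝ := fun t => ContinuousLinearMap.mul ℝ ℝ (c t x)
  have cC : ContinuousAt C t := (ContinuousLinearMap.mul ℝ ℝ).continuous.continuousAt.comp cc'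
  have hut := (((u2.ut t x).app cq (hH.mono fun n hn τ => hn.2.2.1 τ x)).add ((u1.ut t x).app cb (hp.mono fun n hn τ => hn.2.2.1 τ x))).add ((u0.ut t x).app cC (h.mono fun n hn τ => hn.2.1.2.1 τ x))
  refine lim_dt (g := fun n t => w n t x) hut ?_ (fun t => hw0 t x) ?_
  · filter_upwards [he, h.prod_inr (𝓝 t)] with z hz hn
    refine (hn.2.2.2.2.1 z.1 x).congr_deriv hz
  · have l1 := ((q t x).continuous.tendsto _).comp (hH0 t x)
    have l2 := ((b t x).continuous.tendsto _).comp (hp0 t x)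
    have l3 := ((C t).continuous.tendsto _).comp (hw0 t x)
    exact (l1.add l2).add l3

end ulim

section glob
variable {d : ℕ} {α : ℝ}

lemma jet_loc {u u' : ℝ → Euc d → ℝ} {p p' : ℝ → Euc d → Lin d} {H H' : ℝ → Euc d → Bil d} (h : Jet u p H) (h' : Jet u' p' H') {t : ℝ} {S : Set (Euc d)}
    (hS : IsOpen S) (he : ∀ y ∈ S, u t y = u' t y) : ∀ y ∈ S, p t y = p' t y ∧ H t y = H' t y := by
  have h1 : ∀ y ∈ S, p t y = p' t y := fun y hy => (h.h1 t y).unique ((h'.h1 t y).congr_of_eventuallyEq (by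
    filter_upwards [hS.mem_nhds hy] with z hz; exact he z hz))
  exact fun y hy => ⟨h1 y hy, (h.h2 t y).unique ((h'.h2 t y).congr_of_eventuallyEq (by
    filter_upwards [hS.mem_nhds hy] with z hz; exact h1 z hz))⟩

set_option maxHeartbeats 1000000 in
lemma loc_lim (hα : α ∈ Ioo (0:ℝ) 1) {ν c0 s : ℝ} (hν : 0 < ν) {q : ℝ → Euc d → Bil d →L[ℝ] ℝ} {b : ℝ → Euc d → Lin d →L[ℝ] ℝ} {c : ℝ → Euc d → ℝ}
    (h : LOp α ν c0 q b c) {f : Euc d → ℝ} {Mf : ℝ} (hM : ∀ x, |f x| ≤ Mf) {χ : ℕ → ℝ × Euc d → ℝ} {u : ℕ → ℝ → Euc d → ℝ} {p : ℕ → ℝ → Euc d → Lin d} {H : ℕ → ℝ → Euc d → Bil d}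
    (hA : ∀ n : ℕ, App α ν c0 s q b c f (n + 1) (χ n) (u n) (p n) (H n)) {U : Ultrafilter ℕ} (hU : (U : Filter ℕ) ≤ atTop) {u0 : ℝ → Euc d → ℝ}
    (hu0 : ∀ t, s ≤ t → ∀ x, Tendsto (fun n => u n t x) U (𝓝 (u0 t x))) {t0 : ℝ} (ht0 : s < t0) (x0 : Euc d) :
    ∃ (w : ℝ → Euc d → ℝ) (p : ℝ → Euc d → Lin d) (H : ℝ → Euc d → Bil d) (K : ℝ), Jet w p H ∧ Nn α K w ∧ Nn α K p ∧ Nn α K H ∧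
      ∀ᶠ z in 𝓝 (t0,x0), u0 z.1 z.2 = w z.1 z.2 ∧ HasDerivAt (fun t => w t z.2) (q z.1 z.2 (H z.1 z.2) + b z.1 z.2 (p z.1 z.2) + c z.1 z.2 * w z.1 z.2) z.1 := by
  obtain ⟨r, hr0, hr1, hr2⟩ : ∃ r : ℝ, 0 < r ∧ r < 1 ∧ r < t0 - s := ⟨min 1 (t0-s) / 2, by have := lt_min one_pos (sub_pos.2 ht0); linarith,
    by have := lt_min one_pos (sub_pos.2 ht0); linarith [min_le_left 1 (t0-s)], by have := lt_min one_pos (sub_pos.2 ht0); linarith [min_le_right 1 (t0-s)]⟩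
  have hMf : 0 ≤ Mf := (abs_nonneg _).trans (hM 0)
  set T := t0 + 1 with hT
  obtain ⟨n0, hn0⟩ := exists_nat_ge (max (|t0| + 1) (‖x0‖ + 1))
  let ψ : ContDiffBump ((t0, x0) : ℝ × Euc d) := ⟨r/2, r, by positivity, by linarith⟩
  have hψ : ∀ t x, 0 < ψ (t,x) → |t - t0| < r ∧ ‖x - x0‖ < r := fun t x hp => by
    have : (t,x) ∈ Function.support ψ := hp.ne'
    rw [ψ.support_eq, ← ball_prod_same] at this
    exact ⟨this.1, mem_ball_iff_norm.1 this.2⟩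
  have hψ1 : ∀ t x, |t - t0| < r/2 → ‖x - x0‖ < r/2 → ψ (t,x) = 1 := fun t x h1 h2 => ψ.one_of_mem_closedBall (by
    rw [← closedBall_prod_same]; exact mk_mem_prod h1.le (mem_closedBall_iff_norm.2 h2.le))
  have hχ : ∀ n ≥ n0, ∀ t x, |t - t0| < r → ‖x - x0‖ < r → χ n (t,x) = 1 := fun n hn t x h1 h2 => by
    have hn' : (n0 : ℝ) ≤ n := by exact_mod_cast hn
    have a1 := (max_le_iff.1 hn0).1
    have a2 := (max_le_iff.1 hn0).2
    refine (hA n).one t x ?_ ?_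
    · have := abs_add_le (t - t0) t0
      rw [sub_add_cancel] at this; linarith
    · have := norm_add_le (x - x0) x0
      rw [sub_add_cancel] at this; linarith
  obtain ⟨⟨B, hB⟩, -⟩ := cop_mk hα h (hA n0).sm (hA n0).cs (hA n0).n0 (hA n0).n1
  obtain ⟨K0, hK0, hM5⟩ := M5 hα hν hB ψ.contDiff ψ.hasCompactSupport
  set M := Real.exp (|c0| * (T - s)) * (Mf + 2) with hMdef
  have hM0 : 0 ≤ M := by positivity
  have hub : ∀ n, ∀ t ∈ Icc s T, ∀ x, |u n t x| ≤ M := fun n t ht x => ((hA n).bd hα hν h hM t ht.1 x).trans (by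
    have e1 : c0 * (t-s) ≤ |c0| * (T-s) := by
      have h1 : 0 ≤ t - s := by linarith [ht.1]
      have h2 : t - s ≤ T - s := by linarith [ht.2]
      exact (mul_le_mul_of_nonneg_right (le_abs_self _) h1).trans (mul_le_mul_of_nonneg_left h2 (abs_nonneg _))
    have e2 := Real.exp_le_exp.2 e1
    have e3 : 0 ≤ 2 / ((n:ℝ)+1) := by positivity
    have e4 : 2 / ((n:ℝ)+1) ≤ 2 := div_le_self two_pos.le (by have := n.cast_nonneg (α := ℝ); linarith)
    rw [hMdef]; gcongr)
  let τ : ℝ → ℝ := fun t => max s (min t T)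
  have hτ : ∀ t, |t - t0| < r → τ t = t ∧ s < t ∧ t < T := fun t ht => by
    rw [abs_lt] at ht
    have h1 : t < T := by linarith
    have h2 : s < t := by linarith
    exact ⟨by simp only [τ]; rw [min_eq_left h1.le, max_eq_right h2.le], h2, h1⟩
  have hfam : ∀ n, ∃ (p' : ℝ → Euc d → Lin d) (H' : ℝ → Euc d → Bil d) (e' : ℝ → Euc d → ℝ), n0 ≤ n →
      (Jet (fun t x => Real.smoothTransition (2 * ψ (t,x) - 1) * u n (τ t) x) p' H' ∧
        Nn α (K0 * M) (fun t x => Real.smoothTransition (2 * ψ (t,x) - 1) * u n (τ t) x) ∧ Nn α (K0 * M) p' ∧ Nn α (K0 * M) H' ∧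
        (∀ t x, HasDerivAt (fun t => Real.smoothTransition (2 * ψ (t,x) - 1) * u n (τ t) x) (e' t x) t) ∧ ∀ t x, |e' t x| ≤ K0 * M) := fun n => by
    by_cases hn : n0 ≤ n
    · obtain ⟨a, ha1, ha2⟩ := (hA n).sol.bd T (by linarith)
      obtain ⟨p', H', e', hh⟩ := hM5 (fun t x => u n (τ t) x) (fun t x => p n (τ t) x) (fun t x => H n (τ t) x) a M
        ⟨fun t x => (hA n).sol.J.h1 _ x, fun t x => (hA n).sol.J.h2 _ x⟩ ha1 ha2 hM0 (fun t x hp => by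
          obtain ⟨h1, h2⟩ := hψ t x hp
          obtain ⟨h3, h4, h5⟩ := hτ t h1
          beta_reduce
          rw [h3]
          refine ⟨hub n t ⟨h4.le, h5.le⟩ x, ?_⟩
          have e1 := (hA n).sol.ht t h4.le x
          have o1 := hχ n hn t x h1 h2
          have o2 := hχ n0 le_rfl t x h1 h2
          rw [qc_one o1, bc_one o1, cct_one o1] at e1
          rw [qc_one o2, bc_one o2, cct_one o2]
          refine e1.congr_of_eventuallyEq ?_
          filter_upwards [Ioo_mem_nhds h4 h5] with t' ht'
          simp only [τ]
          rw [min_eq_left ht'.2.le, max_eq_right ht'.1.le])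
      exact ⟨p', H', e', fun _ => hh⟩
    · exact ⟨fun _ _ => 0, fun _ _ => 0, fun _ _ => 0, fun h => absurd h hn⟩
  choose p' H' e' hfam using hfam
  have hev : ∀ᶠ n in (U : Filter ℕ), n0 ≤ n := hU (eventually_ge_atTop n0)
  obtain ⟨w, pw, Hw, hw, hJ, k1, k2, k3, hpde⟩ := lim_loc hα (mul_nonneg hK0 hM0) (hev.mono fun n hn => hfam n hn)
  have heq : ∀ n t x, |t - t0| < r/2 → ‖x - x0‖ < r/2 → Real.smoothTransition (2 * ψ (t,x) - 1) * u n (τ t) x = u n t x := fun n t x h1 h2 => by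
    rw [hψ1 t x h1 h2, (hτ t (by linarith)).1, Real.smoothTransition.one_of_one_le (by norm_num), one_mul]
  refine ⟨w, pw, Hw, K0 * M, hJ, k1, k2, k3, ?_⟩
  have hO : ∀ᶠ z : ℝ × Euc d in 𝓝 (t0,x0), |z.1 - t0| < r/2 ∧ ‖z.2 - x0‖ < r/2 := by
    filter_upwards [Metric.ball_mem_nhds (t0,x0) (half_pos hr0)] with z hz
    rw [← ball_prod_same] at hz
    exact ⟨hz.1, mem_ball_iff_norm.1 hz.2⟩
  filter_upwards [hO] with z hz
  obtain ⟨h1, h2⟩ := hz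
  obtain ⟨h3, h4, h5⟩ := hτ z.1 (by linarith)
  constructor
  · refine tendsto_nhds_unique (hu0 z.1 h4.le z.2) ((hw z.1 z.2).congr fun n => heq n _ _ h1 h2)
  · refine hpde q b c z.1 z.2 ?_ ?_ ?_ ?_
    · exact (h.nq.1.comp (by fun_prop : Continuous fun t : ℝ => (t, z.2))).continuousAt
    · exact (h.nb.1.comp (by fun_prop : Continuous fun t : ℝ => (t, z.2))).continuousAt
    · exact (h.nc.1.comp (by fun_prop : Continuous fun t : ℝ => (t, z.2))).continuousAt
    · have hb : ∀ᶠ t in 𝓝 z.1, |t - t0| < r/2 := (continuous_abs.comp (continuous_id.sub continuous_const)).continuousAt.eventually_lt_const h1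
      filter_upwards [hb.prod_inl (U : Filter ℕ), hev.prod_inr (𝓝 z.1)] with y hy hn
      obtain ⟨g3, g4, g5⟩ := hτ y.1 (by linarith)
      have hF := hfam y.2 hn
      have hj := jet_loc hF.1 (hA y.2).sol.J (t := y.1) (S := Metric.ball x0 (r/2)) Metric.isOpen_ball (fun x hx => heq y.2 y.1 x hy (mem_ball_iff_norm.1 hx)) z.2 (mem_ball_iff_norm.2 h2)
      rw [hj.1, hj.2, heq _ _ _ hy h2]
      have e1 := (hA y.2).sol.ht y.1 g4.le z.2
      have o1 := hχ y.2 hn y.1 z.2 (by linarith) (by linarith)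
      rw [qc_one o1, bc_one o1, cct_one o1] at e1
      refine (hF.2.2.2.2.1 y.1 z.2).unique (e1.congr_of_eventuallyEq ?_)
      have hb' : ∀ᶠ t in 𝓝 y.1, |t - t0| < r/2 := (continuous_abs.comp (continuous_id.sub continuous_const)).continuousAt.eventually_lt_const hy
      filter_upwards [hb'] with t ht
      exact heq _ _ _ ht h2

/-- global existence, abstract form -/
theorem M7 (hα : α ∈ Ioo (0:ℝ) 1) {ν c0 : ℝ} (s : ℝ) (hν : 0 < ν) {q : ℝ → Euc d → Bil d →L[ℝ] ℝ} {b : ℝ → Euc d → Lin d →L[ℝ] ℝ} {c : ℝ → Euc d → ℝ}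
    (h : LOp α ν c0 q b c) {f : Euc d → ℝ} (hf : Continuous f) {Mf : ℝ} (hM : ∀ x, |f x| ≤ Mf) :
    ∃ u : ℝ → Euc d → ℝ, (∀ Mf, (∀ x, |f x| ≤ Mf) → ∀ t, s ≤ t → ∀ x, |u t x| ≤ Real.exp (c0 * (t-s)) * Mf) ∧ (∀ x, u s x = f x) ∧
      (∀ x0, ContinuousWithinAt (fun z : ℝ × Euc d => u z.1 z.2) (Ici s ×ˢ univ) (s,x0)) ∧
      ∀ t0, s < t0 → ∀ x0, ∃ (w : ℝ → Euc d → ℝ) (p : ℝ → Euc d → Lin d) (H : ℝ → Euc d → Bil d) (K : ℝ), Jet w p H ∧ Nn α K w ∧ Nn α K p ∧ Nn α K H ∧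
      ∀ᶠ z in 𝓝 (t0,x0), u z.1 z.2 = w z.1 z.2 ∧ HasDerivAt (fun t => w t z.2) (q z.1 z.2 (H z.1 z.2) + b z.1 z.2 (p z.1 z.2) + c z.1 z.2 * w z.1 z.2) z.1 := by
  choose χ u p H hA using fun n : ℕ => app_mk (s := s) hα hν (by positivity : (0:ℝ) < n + 1) h hf
  set U : Ultrafilter ℕ := hyperfilter ℕ
  have hU : (U : Filter ℕ) ≤ atTop := by rw [← Nat.cofinite_eq_atTop]; exact hyperfilter_le_cofinite
  have hlim : Tendsto (fun n : ℕ => 2 / ((n:ℝ) + 1)) U (𝓝 0) := by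
    have := (tendsto_one_div_add_atTop_nhds_zero_nat (𝕜 := ℝ)).const_mul 2
    rw [mul_zero] at this
    exact (this.mono_left hU).congr fun n => by ring
  have hex : ∀ t x, ∃ l, s ≤ t → Tendsto (fun n => u n t x) U (𝓝 l) := fun t x => by
    by_cases ht : s ≤ t
    · obtain ⟨l, hl⟩ := ulim (U := U) (g := fun n => u n t x) (K := Real.exp (c0 * (t-s)) * (Mf + 2)) (Eventually.of_forall fun n => ((hA n).bd hα hν h hM t ht x).trans (by
        have e4 : 2 / ((n:ℝ)+1) ≤ 2 := div_le_self two_pos.le (by have := n.cast_nonneg (α := ℝ); linarith)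
        gcongr))
      exact ⟨l, fun _ => hl⟩
    · exact ⟨0, fun h => absurd h ht⟩
  choose u0 hu0 using hex
  have hin : ∀ x0, ∀ ε > 0, ∃ K, ∀ t ∈ Icc s (s+1), ∀ x, |u0 t x - f x0| ≤ ε + K * ‖x-x0‖^2 + K * (t - s) := fun x0 ε hε => by
    obtain ⟨K, N0, -, hK⟩ := app_init (s := s) hα hν h hf hM x0 hε
    obtain ⟨n0, hn0⟩ := exists_nat_ge N0
    refine ⟨K, fun t ht x => le_of_tendsto ((hu0 t x ht.1).sub_const _).abs ?_⟩
    filter_upwards [hU (eventually_ge_atTop n0)] with n hn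
    have : (n0 : ℝ) ≤ n := by exact_mod_cast hn
    exact hK (n+1) (by linarith) _ _ _ _ (hA n) t ht x
  have hs0 : ∀ x, u0 s x = f x := fun x => by
    have : |u0 s x - f x| ≤ 0 := le_of_forall_pos_le_add fun ε hε => by
      obtain ⟨K, hK⟩ := hin x ε hε
      have := hK s ⟨le_rfl, by linarith⟩ x
      simpa using this
    exact sub_eq_zero.1 (abs_nonpos_iff.1 this)
  refine ⟨u0, fun Mf hM t ht x => ?_, hs0, fun x0 => ?_, fun t0 ht0 x0 => loc_lim hα hν h hM hA hU (fun t ht x => hu0 t x ht) ht0 x0⟩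
  · have h2 : Tendsto (fun n : ℕ => Real.exp (c0 * (t-s)) * (Mf + 2 / ((n:ℝ)+1))) U (𝓝 (Real.exp (c0 * (t-s)) * (Mf + 0))) := (hlim.const_add Mf).const_mul _
    rw [add_zero] at h2
    exact le_of_tendsto_of_tendsto' (hu0 t x ht).abs h2 fun n => (hA n).bd hα hν h hM t ht x
  · rw [ContinuousWithinAt, tendsto_iff_norm_sub_tendsto_zero, Metric.tendsto_nhds]
    intro ε hε
    obtain ⟨K, hK⟩ := hin x0 (ε/2) (by positivity)
    have hcc : Continuous fun z : ℝ × Euc d => ε/2 + K * ‖z.2-x0‖^2 + K * (z.1 - s) :=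
      (continuous_const.add (((continuous_snd.sub continuous_const).norm.pow 2).const_mul K)).add ((continuous_fst.sub continuous_const).const_mul K)
    have hc := (hcc.tendsto (s,x0)).mono_left (nhdsWithin_le_nhds (s := Ici s ×ˢ univ))
    simp only [sub_self, norm_zero, mul_zero, add_zero, ne_eq, OfNat.ofNat_ne_zero, not_false_eq_true, zero_pow] at hc
    have h1 : ∀ᶠ z : ℝ × Euc d in 𝓝[Ici s ×ˢ univ] (s,x0), z.1 < s + 1 :=
      (continuous_fst.continuousAt.eventually_lt_const (by simp : ((s,x0) : ℝ × Euc d).1 < s + 1)).filter_mono nhdsWithin_le_nhds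
    filter_upwards [hc.eventually_lt_const (by linarith : ε/2 < ε), h1, self_mem_nhdsWithin] with z a1 a2 a3
    rw [Real.dist_0_eq_abs, abs_norm]
    simp only [hs0]
    exact (hK z.1 ⟨a3.1, a2.le⟩ z.2).trans_lt a1

end glob

section bridge
variable {d : ℕ} {α : ℝ} {F : Type*} [NormedAddCommGroup F] [NormedSpace ℝ F]

lemma LH.sum {ι : Type*} (S : Finset ι) {g : ι → ℝ → Euc d → F} (h : ∀ i ∈ S, LH α (g i)) : LH α (fun t x => ∑ i ∈ S, g i t x) := by
  classical
  induction S using Finset.induction_on with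
  | empty => exact ⟨by simpa using continuous_const, fun R => ⟨0, fun t x y _ _ _ => by simp⟩⟩
  | insert a S ha ih =>
    have h1 := h a (Finset.mem_insert_self _ _)
    have h2 := ih fun i hi => h i (Finset.mem_insert_of_mem hi)
    simp only [Finset.sum_insert ha]
    refine ⟨h1.1.add h2.1, fun R => ?_⟩
    obtain ⟨L1, l1⟩ := h1.2 R
    obtain ⟨L2, l2⟩ := h2.2 R
    refine ⟨L1 + L2, fun t x y a1 a2 a3 => ?_⟩
    rw [add_sub_add_comm, add_mul]
    exact (norm_add_le _ _).trans (add_le_add (l1 t x y a1 a2 a3) (l2 t x y a1 a2 a3))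

lemma LH.smulc {g : ℝ → Euc d → ℝ} (h : LH α g) (v : F) : LH α (fun t x => g t x • v) := by
  refine ⟨h.1.smul continuous_const, fun R => ?_⟩
  obtain ⟨L, hL⟩ := h.2 R
  refine ⟨L * ‖v‖, fun t x y a1 a2 a3 => ?_⟩
  rw [← sub_smul, norm_smul]
  calc _ ≤ (L * ‖x-y‖^α) * ‖v‖ := mul_le_mul_of_nonneg_right (hL t x y a1 a2 a3) (norm_nonneg _)
    _ = _ := by ring

lemma lh_of (hα : α ∈ Ioo (0:ℝ) 1) {I : Set ℝ} (hI : ∀ ⦃t t' : ℝ⦄, t ∈ I → t ≤ t' → t' ∈ I) {s : ℝ} (hs : s ∈ I) {g : ℝ → Euc d → ℝ} (h : LocHolderParab d α I g) :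
    LH α (fun t x => g (max t s) x) := by
  have hC : ∀ R : ℝ, ∃ C > 0, ∀ t t' : ℝ, ∀ x x' : Euc d, t ≤ R → t' ≤ R → ‖x‖ ≤ R → ‖x'‖ ≤ R →
      |g (max t s) x - g (max t' s) x'| ≤ C * (√|max t s - max t' s| + ‖x - x'‖)^α := fun R => by
    obtain ⟨C, hC0, hC⟩ := h (Icc s (max R s) ×ˢ Metric.closedBall 0 R) (isCompact_Icc.prod (isCompact_closedBall _ _)) fun z hz => mk_mem_prod (hI hs hz.1.1) (mem_univ _)
    exact ⟨C, hC0, fun t t' x x' h1 h2 h3 h4 => hC (max t s, x) (mk_mem_prod ⟨le_max_right _ _, max_le_max_right _ h1⟩ (by simpa using h3)) (max t' s, x')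
      (mk_mem_prod ⟨le_max_right _ _, max_le_max_right _ h2⟩ (by simpa using h4))⟩
  constructor
  · rw [continuous_iff_continuousAt]
    rintro ⟨t, x⟩
    obtain ⟨C, hC0, hC⟩ := hC (max (t+1) (‖x‖+1))
    rw [ContinuousAt, tendsto_iff_norm_sub_tendsto_zero]
    have hc : Continuous fun z : ℝ × Euc d => C * (√|max z.1 s - max t s| + ‖z.2 - x‖)^α := by
      have h1 : Continuous fun z : ℝ × Euc d => √|max z.1 s - max t s| := by fun_prop
      have h2 : Continuous fun z : ℝ × Euc d => ‖z.2 - x‖ := (continuous_snd.sub continuous_const).norm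
      exact ((h1.add h2).rpow_const (fun _ => Or.inr hα.1.le)).const_mul C
    have hl := hc.tendsto (t,x)
    simp only [sub_self, abs_zero, Real.sqrt_zero, norm_zero, add_zero, Real.zero_rpow hα.1.ne', mul_zero] at hl
    have e1 : ∀ᶠ z : ℝ × Euc d in 𝓝 (t,x), z.1 < t + 1 := (continuous_fst.tendsto (t,x)).eventually_lt_const (by simp)
    have e2 : ∀ᶠ z : ℝ × Euc d in 𝓝 (t,x), ‖z.2‖ < ‖x‖ + 1 := ((continuous_norm.comp continuous_snd).tendsto ((t,x) : ℝ × Euc d)).eventually_lt_const (by simp)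
    refine squeeze_zero' (Eventually.of_forall fun _ => norm_nonneg _) ?_ hl
    filter_upwards [e1, e2] with z a1 a2
    exact hC z.1 t z.2 x (a1.le.trans (le_max_left _ _)) ((by linarith : t ≤ t+1).trans (le_max_left _ _)) (a2.le.trans (le_max_right _ _)) ((by linarith : ‖x‖ ≤ ‖x‖+1).trans (le_max_right _ _))
  · intro R
    obtain ⟨C, hC0, hC⟩ := hC R
    refine ⟨C, fun t x y h1 h2 h3 => ?_⟩
    have := hC t t x y ((le_abs_self _).trans h1) ((le_abs_self _).trans h1) h2 h3
    simpa using this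

lemma ell_of {Q : Fin d → Fin d → ℝ} (hs : ∀ i j, Q i j = Q j i) {ν : ℝ} (h : ν ≤ minEig d Q) : Ell ν (qf Q) := by
  refine ⟨Q, hs, fun ξ => ?_, rfl⟩
  rcases eq_or_ne ξ 0 with rfl | hξ
  · simp
  have hn : 0 < ‖ξ‖ := norm_pos_iff.2 hξ
  have hb : BddBelow {r : ℝ | ∃ ξ : Euc d, ‖ξ‖ = 1 ∧ (∑ i, ∑ j, Q i j * ξ i * ξ j) = r} := by
    refine ⟨-‖qf (fun i j => - Q i j)‖, ?_⟩
    rintro r ⟨η, hη, rfl⟩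
    have := Ell.upper (Q := fun i j => - Q i j) η
    simp only [neg_mul, Finset.sum_neg_distrib, hη, one_pow, mul_one] at this
    linarith
  have h1 : ν ≤ ∑ i, ∑ j, Q i j * (‖ξ‖⁻¹ • ξ) i * (‖ξ‖⁻¹ • ξ) j := h.trans (csInf_le hb ⟨‖ξ‖⁻¹ • ξ, by rw [norm_smul, norm_inv, norm_norm, inv_mul_cancel₀ hn.ne'], rfl⟩)
  have h2 : (∑ i, ∑ j, Q i j * (‖ξ‖⁻¹ • ξ) i * (‖ξ‖⁻¹ • ξ) j) * ‖ξ‖^2 = ∑ i, ∑ j, Q i j * ξ i * ξ j := by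
    simp only [Finset.sum_mul]
    refine Finset.sum_congr rfl fun i _ => Finset.sum_congr rfl fun j _ => ?_
    simp only [PiLp.smul_apply, smul_eq_mul]
    field_simp
  rw [← h2]
  exact mul_le_mul_of_nonneg_right h1 (by positivity)

lemma loc_facts {w : ℝ → Euc d → ℝ} {p : ℝ → Euc d → Lin d} {H : ℝ → Euc d → Bil d} (hJ : Jet w p H) (hHc : Continuous fun z : ℝ × Euc d => H z.1 z.2)
    {u : ℝ → Euc d → ℝ} {e : ℝ → Euc d → ℝ} {z0 : ℝ × Euc d} (h : ∀ᶠ z in 𝓝 z0, u z.1 z.2 = w z.1 z.2 ∧ HasDerivAt (fun t => w t z.2) (e z.1 z.2) z.1) :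
    ∀ᶠ z in 𝓝 z0, u z.1 z.2 = w z.1 z.2 ∧ fderiv ℝ (u z.1) z.2 = p z.1 z.2 ∧ (hess d (u z.1) z.2 = fun i j => H z.1 z.2 (ee i) (ee j)) ∧
      HasDerivAt (fun t => u t z.2) (e z.1 z.2) z.1 ∧ ContDiffAt ℝ 2 (u z.1) z.2 := by
  filter_upwards [h.eventually_nhds] with z hz
  have e1 : u z.1 =ᶠ[𝓝 z.2] w z.1 := by
    have : Tendsto (fun y : Euc d => (z.1, y)) (𝓝 z.2) (𝓝 z) := (by fun_prop : Continuous fun y : Euc d => (z.1, y)).tendsto z.2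
    filter_upwards [this.eventually hz] with y hy
    exact hy.1
  have e2 : (fun t => u t z.2) =ᶠ[𝓝 z.1] fun t => w t z.2 := by
    have : Tendsto (fun t : ℝ => (t, z.2)) (𝓝 z.1) (𝓝 z) := (by fun_prop : Continuous fun t : ℝ => (t, z.2)).tendsto z.1
    filter_upwards [this.eventually hz] with t ht
    exact ht.1
  have hp : ∀ t, fderiv ℝ (w t) = p t := fun t => funext fun x => (hJ.h1 t x).fderiv
  have hH : ∀ t, fderiv ℝ (p t) = H t := fun t => funext fun x => (hJ.h2 t x).fderiv
  have e3 : fderiv ℝ (u z.1) =ᶠ[𝓝 z.2] p z.1 := by rw [← hp]; exact e1.fderiv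
  refine ⟨e1.eq_of_nhds, e3.eq_of_nhds, ?_, hz.self_of_nhds.2.congr_of_eventuallyEq e2, ?_⟩
  · funext i j
    have e4 : (fun y => fderiv ℝ (u z.1) y (EuclideanSpace.single j 1)) =ᶠ[𝓝 z.2] fun y => p z.1 y (ee j) := e3.fun_comp (fun L : Lin d => L (ee j))
    have e5 : HasFDerivAt (fun y => p z.1 y (ee j)) ((ContinuousLinearMap.apply ℝ ℝ (ee j : Euc d)).comp (H z.1 z.2)) z.2 :=
      ((ContinuousLinearMap.apply ℝ ℝ (ee j : Euc d)).hasFDerivAt).comp z.2 (hJ.h2 z.1 z.2)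
    rw [hess, e4.fderiv_eq, e5.fderiv]
    rfl
  · have hw : ContDiff ℝ 2 (w z.1) := by
      have h1 : ContDiff ℝ 1 (p z.1) := by
        rw [contDiff_one_iff_fderiv]
        refine ⟨fun x => (hJ.h2 _ x).differentiableAt, ?_⟩
        rw [hH]
        exact hHc.comp (by fun_prop : Continuous fun y : Euc d => (z.1, y))
      rw [show (2 : WithTop ℕ∞) = 1 + 1 from by norm_num, contDiff_succ_iff_fderiv]
      refine ⟨fun x => (hJ.h1 _ x).differentiableAt, by simp, ?_⟩
      rw [hp]; exact h1
    exact hw.contDiffAt.congr_of_eventuallyEq e1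

end bridge

theorem existence_and_sup_bound
    (d : ℕ) (hd : 1 ≤ d) (I : Set ℝ)
    (hI : ∀ ⦃t t' : ℝ⦄, t ∈ I → t ≤ t' → t' ∈ I)
    (Q : ℝ → Euc d → Fin d → Fin d → ℝ) (b : ℝ → Euc d → Fin d → ℝ) (c : ℝ → Euc d → ℝ)
    (α : ℝ) (hα : α ∈ Ioo (0:ℝ) 1)
    (hQhold : ∀ i j, LocHolderParab d α I (fun t x => Q t x i j))
    (hbhold : ∀ j, LocHolderParab d α I (fun t x => b t x j))
    (hchold : LocHolderParab d α I c)
    (hsymm : ∀ t ∈ I, ∀ x : Euc d, ∀ i j, Q t x i j = Q t x j i)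
    (ν₀ : ℝ) (hν₀ : 0 < ν₀) (hell : ∀ t ∈ I, ∀ x : Euc d, ν₀ ≤ minEig d (Q t x))
    (c₀ : ℝ) (hc₀ : ∀ t ∈ I, ∀ x : Euc d, c t x ≤ c₀)
    (s : ℝ) (hs : s ∈ I)
    (f : Euc d → ℝ) (hfc : Continuous f) (hfb : ∃ M, ∀ x, |f x| ≤ M) :
    ∃ u : ℝ → Euc d → ℝ,
      IsClassicalSolution d Q b c s f u ∧
      (∀ Mf : ℝ, (∀ x, |f x| ≤ Mf) →
        ∀ t, s < t → ∀ x, |u t x| ≤ Real.exp (c₀ * (t - s)) * Mf) ∧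
      BoundedOnStrips d s u := by
  obtain ⟨Mf, hMf⟩ := hfb
  have hmem : ∀ t, max t s ∈ I := fun t => hI hs (le_max_right _ _)
  let qq : ℝ → Euc d → Bil d →L[ℝ] ℝ := fun t x => qf (Q (max t s) x)
  let bb : ℝ → Euc d → Lin d →L[ℝ] ℝ := fun t x => ∑ i, b (max t s) x i • ContinuousLinearMap.apply ℝ ℝ (ee i : Euc d)
  let c' : ℝ → Euc d → ℝ := fun t x => c (max t s) x
  have hop : LOp α ν₀ c₀ qq bb c' :=
    { nq := LH.sum _ fun i _ => LH.sum _ fun j _ => (lh_of hα hI hs (hQhold i j)).smulc _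
      nb := LH.sum _ fun i _ => (lh_of hα hI hs (hbhold i)).smulc _
      nc := lh_of hα hI hs hchold
      ell := fun t x => ell_of (hsymm _ (hmem t) x) (hell _ (hmem t) x)
      hc := fun t x => hc₀ _ (hmem t) x }
  obtain ⟨u, hbd, hin, hcs, hloc⟩ := M7 hα s hν₀ hop hfc hMf
  have hfacts : ∀ z0 : ℝ × Euc d, s < z0.1 → ∃ (w : ℝ → Euc d → ℝ) (p : ℝ → Euc d → Lin d) (H : ℝ → Euc d → Bil d),
      (Continuous fun z : ℝ × Euc d => w z.1 z.2) ∧ (Continuous fun z : ℝ × Euc d => p z.1 z.2) ∧ (Continuous fun z : ℝ × Euc d => H z.1 z.2) ∧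
      ∀ᶠ z in 𝓝 z0, u z.1 z.2 = w z.1 z.2 ∧ fderiv ℝ (u z.1) z.2 = p z.1 z.2 ∧ (hess d (u z.1) z.2 = fun i j => H z.1 z.2 (ee i) (ee j)) ∧
      HasDerivAt (fun t => u t z.2) (qq z.1 z.2 (H z.1 z.2) + bb z.1 z.2 (p z.1 z.2) + c' z.1 z.2 * w z.1 z.2) z.1 ∧ ContDiffAt ℝ 2 (u z.1) z.2 := fun z0 hz0 => by
    obtain ⟨w, p, H, K, hJ, k1, k2, k3, hev⟩ := hloc z0.1 hz0 z0.2
    exact ⟨w, p, H, k1.1, k2.1, k3.1, loc_facts hJ k3.1 (e := fun t x => qq t x (H t x) + bb t x (p t x) + c' t x * w t x) hev⟩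
  refine ⟨u, ⟨?_, ?_, ?_, ?_, ?_, ?_, ?_, hin⟩, fun M hM t ht x => hbd M hM t ht.le x, fun T hT => ?_⟩
  · rintro ⟨t, x⟩ hz
    rcases eq_or_lt_of_le (show s ≤ t from hz.1) with rfl | ht
    · exact hcs x
    · obtain ⟨w, p, H, k1, k2, k3, hev⟩ := hfacts (t,x) ht
      exact (k1.continuousAt.congr_of_eventuallyEq (hev.mono fun z hz => hz.1)).continuousWithinAt
  · intro t ht x
    obtain ⟨w, p, H, k1, k2, k3, hev⟩ := hfacts (t,x) ht
    exact hev.self_of_nhds.2.2.2.1.differentiableAt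
  · rintro ⟨t, x⟩ hz
    obtain ⟨w, p, H, k1, k2, k3, hev⟩ := hfacts (t,x) hz.1
    have hc : Continuous fun z : ℝ × Euc d => qq z.1 z.2 (H z.1 z.2) + bb z.1 z.2 (p z.1 z.2) + c' z.1 z.2 * w z.1 z.2 :=
      ((hop.nq.1.clm_apply k3).add (hop.nb.1.clm_apply k2)).add (hop.nc.1.mul k1)
    exact (hc.continuousAt.congr_of_eventuallyEq (hev.mono fun z hz => hz.2.2.2.1.deriv)).continuousWithinAt
  · intro t ht
    rw [contDiff_iff_contDiffAt]
    intro x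
    obtain ⟨w, p, H, k1, k2, k3, hev⟩ := hfacts (t,x) ht
    exact hev.self_of_nhds.2.2.2.2
  · rintro ⟨t, x⟩ hz
    obtain ⟨w, p, H, k1, k2, k3, hev⟩ := hfacts (t,x) hz.1
    exact (k2.continuousAt.congr_of_eventuallyEq (hev.mono fun z hz => hz.2.1)).continuousWithinAt
  · rintro ⟨t, x⟩ hz
    obtain ⟨w, p, H, k1, k2, k3, hev⟩ := hfacts (t,x) hz.1
    have hc : Continuous fun z : ℝ × Euc d => fun i j => H z.1 z.2 (ee i) (ee j) :=
      continuous_pi fun i => continuous_pi fun j => (k3.clm_apply continuous_const).clm_apply continuous_const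
    exact (hc.continuousAt.congr_of_eventuallyEq (hev.mono fun z hz => hz.2.2.1)).continuousWithinAt
  · intro t ht x
    obtain ⟨w, p, H, k1, k2, k3, hev⟩ := hfacts (t,x) ht
    obtain ⟨g1, g2, g3, g4, -⟩ := hev.self_of_nhds
    rw [g4.deriv, Aop]
    simp only at g1 g2 g3
    rw [g3, g2, g1]
    simp only [qq, bb, c', max_eq_left ht.le, qf_apply, qtr, sum_apply, smul_apply, ContinuousLinearMap.apply_apply, smul_eq_mul]
  · refine ⟨Real.exp (|c₀| * (T - s)) * Mf, fun t ht x => (hbd Mf hMf t ht.1 x).trans ?_⟩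
    have h0 : 0 ≤ Mf := (abs_nonneg _).trans (hMf 0)
    have e1 : c₀ * (t-s) ≤ |c₀| * (T-s) := by
      have h1 : 0 ≤ t - s := by linarith [ht.1]
      have h2 : t - s ≤ T - s := by linarith [ht.2]
      exact (mul_le_mul_of_nonneg_right (le_abs_self _) h1).trans (mul_le_mul_of_nonneg_left h2 (abs_nonneg _))
    exact mul_le_mul_of_nonneg_right (Real.exp_le_exp.2 e1) h0
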